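/- arXiv:0806.0097 — 2 statements merged into one kernel-verified Lean document; each statement's English description precedes it below -/
import Mathlib

section
/- Let Ω ⊆ ℂ be a Denjoy domain with Ω ∩ ℝ = (−∞, 0) ∪ ⋃_{n=1}^∞ (a_n, b_n), where 0 < a_n < b_n ≤ a_{n+1} for every n ≥ 1 and lim_{n→∞} a_n = ∞. If liminf_{n→∞} (b_n − a_n)/a_n > 0, then the metric space (Ω, k_Ω) with the quasihyperbolic metric is Gromov hyperbolic. -/
open Set Metric Filter Complex

noncomputable section

/-- The length of a curve `γ : [0,1] → E` with respect to the conformal density `ρ`. -/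
def curveLen {E : Type*} [NormedAddCommGroup E] [NormedSpace ℝ E]
    (ρ : E → ℝ) (γ : ℝ → E) : ℝ :=
  ∫ t in (0:ℝ)..1, ρ (γ t) * ‖deriv γ t‖

/-- The distance induced on the set `S` by the conformal density `ρ`, defined as the infimum
of the `ρ`-lengths of C¹ curves joining the two points inside `S`. -/
def densityDist {E : Type*} [NormedAddCommGroup E] [NormedSpace ℝ E]
    (S : Set E) (ρ : E → ℝ) (z w : E) : ℝ :=
  sInf { L | ∃ γ : ℝ → E, ContDiffOn ℝ 1 γ (Icc 0 1) ∧ γ 0 = z ∧ γ 1 = w ∧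
      (∀ t ∈ Icc (0:ℝ) 1, γ t ∈ S) ∧ L = curveLen ρ γ }

/-- The quasihyperbolic density `1/δ_Ω(z)` of a domain `Ω`. -/
def qhDensity {E : Type*} [NormedAddCommGroup E] [NormedSpace ℝ E] (Ω : Set E) : E → ℝ :=
  fun z => (Metric.infDist z Ωᶜ)⁻¹

/-- The quasihyperbolic distance of a domain `Ω`. -/
def qhDist {E : Type*} [NormedAddCommGroup E] [NormedSpace ℝ E] (Ω : Set E) : E → E → ℝ :=
  densityDist Ω (qhDensity Ω)

/-- `lam` is the density of the Poincaré (hyperbolic) metric of the plane domain `Ω`: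
it is the pushforward of the density `2/(1-|z|²)` of the unit disk under a holomorphic
universal covering map `p : 𝔻 → Ω`. -/
def IsPoincareDensity (Ω : Set ℂ) (lam : ℂ → ℝ) : Prop :=
  ∃ p : ℂ → ℂ,
    (∀ z ∈ ball (0:ℂ) 1, DifferentiableAt ℂ p z) ∧
    p '' ball (0:ℂ) 1 = Ω ∧
    IsCoveringMapOn (fun z : ball (0:ℂ) 1 => p z) Ω ∧
    ∀ z ∈ ball (0:ℂ) 1, lam (p z) * ‖deriv p z‖ = 2 / (1 - ‖z‖ ^ 2)

/-- `g` is a geodesic in `(S, d)` from `x` to `y`, parametrized by arclength on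
`[0, d x y]`. -/
def IsGeodesicIn {α : Type*} (S : Set α) (d : α → α → ℝ) (g : ℝ → α) (x y : α) : Prop :=
  g 0 = x ∧ g (d x y) = y ∧ (∀ t ∈ Icc (0:ℝ) (d x y), g t ∈ S) ∧
  ∀ s ∈ Icc (0:ℝ) (d x y), ∀ t ∈ Icc (0:ℝ) (d x y), d (g s) (g t) = |s - t|

/-- Every geodesic triangle of `(S, d)` is `δ`-thin (Rips condition). -/
def GromovHyperbolicWith {α : Type*} (S : Set α) (d : α → α → ℝ) (δ : ℝ) : Prop :=
  ∀ x ∈ S, ∀ y ∈ S, ∀ z ∈ S, ∀ gxy gxz gzy : ℝ → α,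
    IsGeodesicIn S d gxy x y → IsGeodesicIn S d gxz x z → IsGeodesicIn S d gzy z y →
    ∀ t ∈ Icc (0:ℝ) (d x y),
      ∃ p ∈ gxz '' Icc (0:ℝ) (d x z) ∪ gzy '' Icc (0:ℝ) (d z y), d (gxy t) p ≤ δ

/-- `(S, d)` is Gromov hyperbolic: some `δ ≥ 0` works for all geodesic triangles. -/
def IsGromovHyperbolic {α : Type*} (S : Set α) (d : α → α → ℝ) : Prop :=
  ∃ δ : ℝ, 0 ≤ δ ∧ GromovHyperbolicWith S d δ

/-- The real axis inside `ℂ`. -/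
def realLine : Set ℂ := {z : ℂ | z.im = 0}

/-- A Denjoy domain: a domain whose boundary is contained in the real axis. -/
def IsDenjoyDomain (Ω : Set ℂ) : Prop :=
  IsOpen Ω ∧ IsConnected Ω ∧ frontier Ω ⊆ realLine

/-- The distance (for the distance function `d`) from a point to a set. -/
def distToSet {α : Type*} (d : α → α → ℝ) (z : α) (A : Set α) : ℝ :=
  sInf (d z '' A)

/-- A fundamental geodesic: a geodesic of `(S, d)` contained in the closed upper half plane,
joining a point of the boundary interval `I` (on the real axis) to a point of the boundary
interval `J`. -/
def IsFundGeodesic (S : Set ℂ) (d : ℂ → ℂ → ℝ) (I J : Set ℝ) (g : ℝ → ℂ) (x y : ℂ) : Prop :=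
  IsGeodesicIn S d g x y ∧ x.im = 0 ∧ x.re ∈ I ∧ y.im = 0 ∧ y.re ∈ J ∧
  ∀ t ∈ Icc (0:ℝ) (d x y), 0 ≤ (g t).im

end

noncomputable section

/-- `k` is comparable with the logarithmic distance `log (1 + d x y / δ x) + log (1 + d x y / δ y)`
on `S`, where `d` is a pseudometric on `S` and `δ` is positive and `1`-Lipschitz for `d`. -/
structure IsLogComparable {α : Type*} (S : Set α) (k d : α → α → ℝ) (δ : α → ℝ) (B : ℝ) :
    Prop where
  pos : ∀ x ∈ S, 0 < δ x
  self : ∀ x ∈ S, d x x = 0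
  symm : ∀ x ∈ S, ∀ y ∈ S, d x y = d y x
  tri : ∀ x ∈ S, ∀ y ∈ S, ∀ z ∈ S, d x z ≤ d x y + d y z
  lip : ∀ x ∈ S, ∀ y ∈ S, δ y ≤ δ x + d x y
  lower : ∀ x ∈ S, ∀ y ∈ S, δ x + d x y ≤ δ x * Real.exp (k x y)
  upper : ∀ x ∈ S, ∀ y ∈ S,
    k x y ≤ 2 * Real.log (1 + d x y / δ x) + 2 * Real.log (1 + d x y / δ y) + B

/-- `g` maps `[0, T]` isometrically into `(S, k)`. -/
structure IsArc {α : Type*} (S : Set α) (k : α → α → ℝ) (g : ℝ → α) (T : ℝ) : Prop where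
  mem : ∀ t ∈ Icc (0:ℝ) T, g t ∈ S
  dist : ∀ s ∈ Icc (0:ℝ) T, ∀ t ∈ Icc (0:ℝ) T, k (g s) (g t) = |s - t|

namespace IsArc

variable {α : Type*} {S : Set α} {k : α → α → ℝ} {g : ℝ → α} {T : ℝ}

theorem reverse (hg : IsArc S k g T) : IsArc S k (fun t => g (T - t)) T where
  mem t ht := hg.mem _ ⟨by linarith [ht.2], by linarith [ht.1]⟩
  dist s hs t ht := by
    rw [hg.dist _ ⟨by linarith [hs.2], by linarith [hs.1]⟩ _
      ⟨by linarith [ht.2], by linarith [ht.1]⟩, abs_sub_comm]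
    congr 1
    ring

end IsArc

/-- A bound for the length of an arc along which `δ` is at most twice its endpoint values. -/
def levelConst (B : ℝ) : ℝ := 8 * Real.log 32 + 2 * B

/-- A bound for the `d`-diameter, relative to the top height, of an arc ending at its top. -/
def riseConst (B : ℝ) : ℝ := 2 * Real.exp (levelConst B)

namespace IsLogComparable

variable {α : Type*} {S : Set α} {k d : α → α → ℝ} {δ : α → ℝ} {B : ℝ} {g : ℝ → α} {T : ℝ}

theorem nonneg (H : IsLogComparable S k d δ B) {x y : α} (hx : x ∈ S) (hy : y ∈ S) :
    0 ≤ d x y := by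
  have h1 := H.tri x hx y hy x hx
  rw [H.self x hx, H.symm y hy x hx] at h1
  linarith

theorem dist_nonneg (H : IsLogComparable S k d δ B) {x y : α} (hx : x ∈ S) (hy : y ∈ S) :
    0 ≤ k x y := by
  have h1 := H.lower x hx y hy
  have h2 := H.nonneg hx hy
  have h3 := H.pos x hx
  by_contra! h
  have h4 : Real.exp (k x y) < 1 := by simpa using h
  nlinarith

theorem upper_of_le (H : IsLogComparable S k d δ B) {x y : α} (hx : x ∈ S) (hy : y ∈ S)
    {h m : ℝ} (hh : 0 < h) (hhx : h ≤ δ x) (hhy : h ≤ δ y) (hd : d x y ≤ m * h) :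
    k x y ≤ 4 * Real.log (1 + m) + B := by
  have h0 := H.nonneg hx hy
  have key : ∀ z, h ≤ δ z → Real.log (1 + d x y / δ z) ≤ Real.log (1 + m) := by
    intro z hz
    have hzp : 0 < δ z := hh.trans_le hz
    apply Real.log_le_log (by positivity)
    have h1 : d x y / δ z ≤ d x y / h := by gcongr
    have h2 : d x y / h ≤ m := by rwa [div_le_iff₀ hh]
    linarith
  have := H.upper x hx y hy
  linarith [key x hhx, key y hhy]

theorem height_le (H : IsLogComparable S k d δ B) (hg : IsArc S k g T) {s t : ℝ}
    (hs : s ∈ Icc 0 T) (ht : t ∈ Icc 0 T) : δ (g t) ≤ δ (g s) * Real.exp |s - t| := by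
  rw [← hg.dist s hs t ht]
  exact (H.lip _ (hg.mem s hs) _ (hg.mem t ht)).trans (H.lower _ (hg.mem s hs) _ (hg.mem t ht))

theorem d_le (H : IsLogComparable S k d δ B) (hg : IsArc S k g T) {s t : ℝ}
    (hs : s ∈ Icc 0 T) (ht : t ∈ Icc 0 T) : d (g s) (g t) ≤ δ (g s) * Real.exp |s - t| := by
  rw [← hg.dist s hs t ht]
  linarith [H.lower _ (hg.mem s hs) _ (hg.mem t ht), H.pos _ (hg.mem s hs)]

theorem continuousOn_height (H : IsLogComparable S k d δ B) (hg : IsArc S k g T) :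
    ContinuousOn (fun t => δ (g t)) (Icc 0 T) := by
  intro s hs
  have h1 : Tendsto (fun t => δ (g s) * Real.exp |s - t|) (nhdsWithin s (Icc 0 T))
      (nhds (δ (g s))) := by
    have : Continuous fun t => δ (g s) * Real.exp |s - t| := by fun_prop
    have h := this.tendsto s
    simp only [sub_self, abs_zero, Real.exp_zero, mul_one] at h
    exact h.mono_left nhdsWithin_le_nhds
  have h2 : Tendsto (fun t => δ (g s) * Real.exp (-|s - t|)) (nhdsWithin s (Icc 0 T))
      (nhds (δ (g s))) := by
    have : Continuous fun t => δ (g s) * Real.exp (-|s - t|) := by fun_prop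
    have h := this.tendsto s
    simp only [sub_self, abs_zero, neg_zero, Real.exp_zero, mul_one] at h
    exact h.mono_left nhdsWithin_le_nhds
  refine tendsto_of_tendsto_of_tendsto_of_le_of_le' h2 h1 ?_ ?_
  · filter_upwards [self_mem_nhdsWithin] with t ht
    have := H.height_le hg ht hs
    rw [abs_sub_comm] at this
    rw [Real.exp_neg, ← div_eq_mul_inv, div_le_iff₀ (Real.exp_pos _)]
    exact this
  · filter_upwards [self_mem_nhdsWithin] with t ht
    exact H.height_le hg hs ht

theorem d_le_of_height_le (H : IsLogComparable S k d δ B) (hg : IsArc S k g T) {h : ℝ} (n : ℕ) :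
    ∀ {s t : ℝ}, s ∈ Icc 0 T → t ∈ Icc 0 T → s ≤ t → t ≤ s + n →
    (∀ τ ∈ Icc s t, δ (g τ) ≤ h) → d (g s) (g t) ≤ 2 * h * n := by
  induction n with
  | zero =>
    intro s t hs ht hst hts _
    have : s = t := by
      apply le_antisymm hst
      simpa using hts
    subst this
    rw [H.self _ (hg.mem s hs)]
    simp
  | succ n ih =>
    intro s t hs ht hst hts hle
    push_cast at hts ⊢
    set m := max s (t - 1) with hm
    have hsm : s ≤ m := le_max_left _ _
    have hmt : m ≤ t := max_le hst (by linarith)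
    have htm : t - 1 ≤ m := le_max_right _ _
    have hmT : m ∈ Icc 0 T := ⟨hs.1.trans hsm, hmt.trans ht.2⟩
    have hmn : m ≤ s + n := max_le (le_add_of_nonneg_right (Nat.cast_nonneg n)) (by linarith)
    have h1 := ih hs hmT hsm hmn fun τ hτ => hle τ ⟨hτ.1, hτ.2.trans hmt⟩
    have h2 := H.lower _ (hg.mem m hmT) _ (hg.mem t ht)
    rw [hg.dist m hmT t ht] at h2
    have h3 : Real.exp |m - t| ≤ 3 := by
      have : |m - t| ≤ 1 := by rw [abs_le]; constructor <;> linarith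
      have h4 := Real.exp_le_exp.mpr this
      linarith [Real.exp_one_lt_d9]
    have h5 := hle m ⟨hsm, hmt⟩
    have h6 := H.pos _ (hg.mem m hmT)
    have h7 := H.tri _ (hg.mem s hs) _ (hg.mem m hmT) _ (hg.mem t ht)
    nlinarith

/-- An arc along which the height is at most twice the height of the endpoints is short. -/
theorem length_le (H : IsLogComparable S k d δ B) (hg : IsArc S k g T) {h s t : ℝ}
    (hs : s ∈ Icc 0 T) (ht : t ∈ Icc 0 T) (hst : s ≤ t) (hle : ∀ τ ∈ Icc s t, δ (g τ) ≤ h)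
    (h1 : h ≤ 2 * δ (g s)) (h2 : h ≤ 2 * δ (g t)) : t - s ≤ levelConst B := by
  have hp : 0 < h := (H.pos _ (hg.mem s hs)).trans_le (hle s ⟨le_rfl, hst⟩)
  set n := ⌈t - s⌉₊ with hn
  have hn1 : t - s ≤ n := Nat.le_ceil _
  have hn2 : (n : ℝ) < t - s + 1 := Nat.ceil_lt_add_one (by linarith)
  have hd := H.d_le_of_height_le hg n hs ht hst (by linarith) hle
  have hd' : d (g s) (g t) ≤ (4 * (t - s + 1)) * (h / 2) := by nlinarith
  have hk := H.upper_of_le (hg.mem s hs) (hg.mem t ht) (half_pos hp) (by linarith) (by linarith) hd'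
  rw [hg.dist s hs t ht, abs_sub_comm, abs_of_nonneg (by linarith)] at hk
  have hlog : Real.log (1 + 4 * (t - s + 1)) ≤ (1 + 4 * (t - s + 1)) / 32 - 1 + Real.log 32 := by
    have h3 : 0 < (1 + 4 * (t - s + 1)) / 32 := by
      apply div_pos <;> linarith
    have h4 := Real.log_le_sub_one_of_pos h3
    rw [Real.log_div (by linarith) (by norm_num)] at h4
    linarith
  unfold levelConst
  linarith

theorem exists_first (H : IsLogComparable S k d δ B) (hg : IsArc S k g T) {h r s : ℝ}
    (hr : r ∈ Icc 0 T) (hs : s ∈ Icc 0 T) (hrs : r ≤ s) (h1 : δ (g r) ≤ h) (h2 : h ≤ δ (g s)) :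
    ∃ m ∈ Icc r s, δ (g m) = h ∧ ∀ τ ∈ Icc r m, δ (g τ) ≤ h := by
  have hsub : Icc r s ⊆ Icc 0 T := fun τ hτ => ⟨hr.1.trans hτ.1, hτ.2.trans hs.2⟩
  have hc : ContinuousOn (fun t => δ (g t)) (Icc r s) := (H.continuousOn_height hg).mono hsub
  have hK : IsCompact {τ ∈ Icc r s | h ≤ δ (g τ)} := by
    have : IsClosed {τ ∈ Icc r s | h ≤ δ (g τ)} :=
      isClosed_Icc.isClosed_le continuousOn_const hc
    exact isCompact_Icc.of_isClosed_subset this fun τ hτ => hτ.1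
  obtain ⟨m, hm⟩ := hK.exists_isLeast ⟨s, ⟨hrs, le_rfl⟩, h2⟩
  have hlt : ∀ τ ∈ Icc r s, τ < m → δ (g τ) < h := by
    intro τ hτ hτm
    by_contra! hcon
    exact absurd (hm.2 ⟨hτ, hcon⟩) (not_le.mpr hτm)
  have heq : δ (g m) = h := by
    obtain ⟨c, hcm, hch⟩ := intermediate_value_Icc hm.1.1.1
      (hc.mono (Icc_subset_Icc le_rfl hm.1.1.2)) (⟨h1, hm.1.2⟩ : h ∈ Icc _ _)
    have hch' : δ (g c) = h := hch
    have : m ≤ c := hm.2 ⟨⟨hcm.1, hcm.2.trans hm.1.1.2⟩, hch'.ge⟩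
    rwa [le_antisymm hcm.2 this] at hch'
  refine ⟨m, hm.1.1, heq, fun τ hτ => ?_⟩
  rcases hτ.2.eq_or_lt with rfl | hlt'
  · exact heq.le
  · exact (hlt τ ⟨hτ.1, hτ.2.trans hm.1.1.2⟩ hlt').le

theorem d_le_rise_aux (H : IsLogComparable S k d δ B) (hg : IsArc S k g T) (n : ℕ) :
    ∀ {r s : ℝ}, r ∈ Icc 0 T → s ∈ Icc 0 T → r ≤ s → (∀ τ ∈ Icc r s, δ (g τ) ≤ δ (g s)) →
    δ (g s) ≤ 2 ^ n * δ (g r) → d (g r) (g s) ≤ riseConst B * δ (g s) := by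
  have flat : ∀ {r s : ℝ}, r ∈ Icc 0 T → s ∈ Icc 0 T → r ≤ s →
      (∀ τ ∈ Icc r s, δ (g τ) ≤ δ (g s)) → δ (g s) ≤ 2 * δ (g r) →
      d (g r) (g s) ≤ riseConst B / 2 * δ (g s) := by
    intro r s hr hs hrs hle h2
    have hp := H.pos _ (hg.mem s hs)
    have h3 := H.length_le hg hr hs hrs hle h2 (by linarith)
    have h4 := H.d_le hg hr hs
    have h5 : Real.exp |r - s| ≤ Real.exp (levelConst B) := by
      rw [Real.exp_le_exp, abs_sub_comm, abs_of_nonneg (by linarith)]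
      exact h3
    calc d (g r) (g s) ≤ δ (g r) * Real.exp |r - s| := h4
      _ ≤ δ (g s) * Real.exp (levelConst B) := by
        gcongr
        exact hle r ⟨le_rfl, hrs⟩
      _ = riseConst B / 2 * δ (g s) := by unfold riseConst; ring
  have hC : 0 < riseConst B := by unfold riseConst; positivity
  induction n with
  | zero =>
    intro r s hr hs hrs hle h2
    have h0 := H.pos _ (hg.mem s hs)
    have h1 := H.pos _ (hg.mem r hr)
    have := flat hr hs hrs hle (by linarith)
    nlinarith
  | succ n ih =>
    intro r s hr hs hrs hle h2
    have h0 := H.pos _ (hg.mem s hs)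
    rcases le_total (δ (g s)) (2 * δ (g r)) with h3 | h3
    · have := flat hr hs hrs hle h3
      nlinarith
    · obtain ⟨m, hm, hmh, hmle⟩ := H.exists_first hg (h := δ (g s) / 2) hr hs hrs (by linarith)
        (by linarith)
      have hmT : m ∈ Icc 0 T := ⟨hr.1.trans hm.1, hm.2.trans hs.2⟩
      have h4 := ih hr hmT hm.1 (by rwa [hmh]) (by rw [hmh]; rw [pow_succ] at h2; linarith)
      have h5 := flat hmT hs hm.2 (fun τ hτ => hle τ ⟨hm.1.trans hτ.1, hτ.2⟩) (by linarith)
      have h6 := H.tri _ (hg.mem r hr) _ (hg.mem m hmT) _ (hg.mem s hs)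
      rw [hmh] at h4
      linarith

theorem d_le_rise (H : IsLogComparable S k d δ B) (hg : IsArc S k g T) {r s : ℝ}
    (hr : r ∈ Icc 0 T) (hs : s ∈ Icc 0 T) (hrs : r ≤ s)
    (hle : ∀ τ ∈ Icc r s, δ (g τ) ≤ δ (g s)) : d (g r) (g s) ≤ riseConst B * δ (g s) := by
  obtain ⟨n, hn⟩ := pow_unbounded_of_one_lt (δ (g s) / δ (g r)) (one_lt_two : (1:ℝ) < 2)
  refine H.d_le_rise_aux hg n hr hs hrs hle ?_
  rw [div_lt_iff₀ (H.pos _ (hg.mem r hr))] at hn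
  exact hn.le

theorem d_le_fall (H : IsLogComparable S k d δ B) (hg : IsArc S k g T) {r s : ℝ}
    (hr : r ∈ Icc 0 T) (hs : s ∈ Icc 0 T) (hrs : r ≤ s)
    (hle : ∀ τ ∈ Icc r s, δ (g τ) ≤ δ (g r)) : d (g r) (g s) ≤ riseConst B * δ (g r) := by
  have := H.d_le_rise hg.reverse (r := T - s) (s := T - r) ⟨by linarith [hs.2], by linarith [hs.1]⟩
    ⟨by linarith [hr.2], by linarith [hr.1]⟩ (by linarith) (by
      intro τ hτ
      rw [sub_sub_cancel]
      exact hle _ ⟨by linarith [hτ.2], by linarith [hτ.1]⟩)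
  rw [sub_sub_cancel, sub_sub_cancel, H.symm _ (hg.mem s hs) _ (hg.mem r hr)] at this
  exact this

theorem exists_max (H : IsLogComparable S k d δ B) (hg : IsArc S k g T) {t : ℝ} (ht : 0 ≤ t)
    (htT : t ≤ T) : ∃ σ ∈ Icc 0 t, ∀ τ ∈ Icc 0 t, δ (g τ) ≤ δ (g σ) :=
  isCompact_Icc.exists_isMaxOn ⟨0, le_rfl, ht⟩
    ((H.continuousOn_height hg).mono (Icc_subset_Icc le_rfl htT))

/-- An arc staying below height `h` moves by a bounded multiple of `h`. -/
theorem d_ends_le (H : IsLogComparable S k d δ B) (hg : IsArc S k g T) (hT : 0 ≤ T) {h : ℝ}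
    (hle : ∀ τ ∈ Icc 0 T, δ (g τ) ≤ h) : d (g 0) (g T) ≤ 2 * riseConst B * h := by
  obtain ⟨σ, hσ, hmax⟩ := H.exists_max hg hT le_rfl
  have h0 : (0:ℝ) ∈ Icc 0 T := ⟨le_rfl, hT⟩
  have hT' : T ∈ Icc 0 T := ⟨hT, le_rfl⟩
  have h1 := H.d_le_rise hg h0 hσ hσ.1 fun τ hτ => hmax τ ⟨hτ.1, hτ.2.trans hσ.2⟩
  have h2 := H.d_le_fall hg hσ hT' hσ.2 fun τ hτ => hmax τ ⟨hσ.1.trans hτ.1, hτ.2⟩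
  have h3 := H.tri _ (hg.mem 0 h0) _ (hg.mem σ hσ) _ (hg.mem T hT')
  have hC : 0 < riseConst B := by unfold riseConst; positivity
  have h4 := hle σ hσ
  nlinarith

/-- An arc reaching height `h` first does so within a bounded multiple of `h` of its origin. -/
theorem exists_reach (H : IsLogComparable S k d δ B) (hg : IsArc S k g T) {h t : ℝ} (hh : 0 < h)
    (ht : t ∈ Icc 0 T) (hht : h ≤ δ (g t)) :
    ∃ s ∈ Icc 0 t, h ≤ δ (g s) ∧ δ (g s) ≤ max h (δ (g 0)) ∧
      d (g 0) (g s) ≤ riseConst B * h := by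
  have h0 : (0:ℝ) ∈ Icc 0 T := ⟨le_rfl, ht.1.trans ht.2⟩
  rcases le_total (δ (g 0)) h with h1 | h1
  · obtain ⟨m, hm, hmh, hmle⟩ := H.exists_first hg h0 ht ht.1 h1 hht
    refine ⟨m, hm, hmh.ge, hmh.le.trans (le_max_left _ _), ?_⟩
    have := H.d_le_rise hg h0 ⟨hm.1, hm.2.trans ht.2⟩ hm.1 (by rwa [hmh])
    rwa [hmh] at this
  · refine ⟨0, ⟨le_rfl, ht.1⟩, h1, le_max_right _ _, ?_⟩
    rw [H.self _ (hg.mem 0 h0)]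
    unfold riseConst
    positivity

/-- The height along an arc is controlled by its endpoints. -/
theorem height_le_ends (H : IsLogComparable S k d δ B) (hB : 0 ≤ B) (hg : IsArc S k g T)
    {t : ℝ} (ht : t ∈ Icc 0 T) :
    δ (g t) ≤ (d (g 0) (g T) + δ (g 0) + δ (g T)) *
      Real.exp (4 * Real.log (1 + (2 * riseConst B + 1)) + B) := by
  have hT : 0 ≤ T := ht.1.trans ht.2
  have h0 : (0:ℝ) ∈ Icc 0 T := ⟨le_rfl, hT⟩
  have hT' : T ∈ Icc 0 T := ⟨hT, le_rfl⟩
  set D := d (g 0) (g T) + δ (g 0) + δ (g T) with hD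
  have p0 := H.pos _ (hg.mem 0 h0)
  have pT := H.pos _ (hg.mem T hT')
  have pd := H.nonneg (hg.mem 0 h0) (hg.mem T hT')
  have hDp : 0 < D := by positivity
  have hC : 0 < riseConst B := by unfold riseConst; positivity
  rcases le_total (δ (g t)) D with h1 | h1
  · have : 1 ≤ Real.exp (4 * Real.log (1 + (2 * riseConst B + 1)) + B) := by
      apply Real.one_le_exp
      have : 0 ≤ Real.log (1 + (2 * riseConst B + 1)) := Real.log_nonneg (by linarith)
      positivity
    nlinarith
  · obtain ⟨s, hs, hsh, hsm, hsd⟩ := H.exists_reach hg hDp ht h1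
    obtain ⟨s', hs', hsh', hsm', hsd'⟩ := H.exists_reach hg.reverse (t := T - t) hDp
      ⟨by linarith [ht.2], by linarith [ht.1]⟩ (by rwa [sub_sub_cancel])
    have hu : T - s' ∈ Icc 0 T := ⟨by linarith [hs'.2, ht.1], by linarith [hs'.1]⟩
    have hsT : s ∈ Icc 0 T := ⟨hs.1, hs.2.trans ht.2⟩
    rw [sub_zero] at hsd'
    have hd : d (g s) (g (T - s')) ≤ (2 * riseConst B + 1) * D := by
      have e1 := H.tri _ (hg.mem s hsT) _ (hg.mem 0 h0) _ (hg.mem _ hu)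
      have e2 := H.tri _ (hg.mem 0 h0) _ (hg.mem T hT') _ (hg.mem _ hu)
      rw [H.symm _ (hg.mem s hsT) _ (hg.mem 0 h0)] at e1
      linarith
    have hk := H.upper_of_le (hg.mem s hsT) (hg.mem _ hu) hDp hsh hsh' hd
    have hlt : s ≤ T - s' := by linarith [hs.2, hs'.2]
    rw [hg.dist s hsT _ hu, abs_sub_comm, abs_of_nonneg (by linarith)] at hk
    have hst := H.height_le hg hsT ht
    have hs0 : δ (g s) ≤ D := hsm.trans (max_le le_rfl (by linarith))
    have hexp : |s - t| ≤ 4 * Real.log (1 + (2 * riseConst B + 1)) + B := by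
      rw [abs_sub_comm, abs_of_nonneg (by linarith [hs.2])]
      linarith [hs'.2]
    calc δ (g t) ≤ δ (g s) * Real.exp |s - t| := hst
      _ ≤ _ := by gcongr

/-- Before the top of an arc, the distance to the origin is controlled by the height. -/
theorem d_origin_le (H : IsLogComparable S k d δ B) (hg : IsArc S k g T) {t t₀ : ℝ}
    (ht : 0 ≤ t) (htt : t ≤ t₀) (ht₀ : t₀ ≤ T) (hmax : ∀ τ ∈ Icc 0 t, δ (g τ) ≤ δ (g t₀)) :
    d (g 0) (g t) ≤ (riseConst B + riseConst B / 2) * (riseConst B / 2) * δ (g t) := by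
  have h0 : (0:ℝ) ∈ Icc 0 T := ⟨le_rfl, (ht.trans htt).trans ht₀⟩
  have htT : t ∈ Icc 0 T := ⟨ht, htt.trans ht₀⟩
  have ht₀T : t₀ ∈ Icc 0 T := ⟨ht.trans htt, ht₀⟩
  obtain ⟨σ, hσ, hσmax⟩ := H.exists_max hg ht htT.2
  have hσT : σ ∈ Icc 0 T := ⟨hσ.1, hσ.2.trans htT.2⟩
  obtain ⟨m, hm, hmh, hmle⟩ := H.exists_first hg (h := δ (g σ)) htT ht₀T htt
    (hσmax t ⟨ht, le_rfl⟩) (hmax σ hσ)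
  have hmT : m ∈ Icc 0 T := ⟨ht.trans hm.1, hm.2.trans ht₀⟩
  have hlen := H.length_le hg (h := δ (g σ)) hσT hmT (hσ.2.trans hm.1) (by
    intro τ hτ
    rcases le_total τ t with h | h
    · exact hσmax τ ⟨hσ.1.trans hτ.1, h⟩
    · exact hmle τ ⟨h, hτ.2⟩) (by linarith [H.pos _ (hg.mem σ hσT)])
    (by linarith [H.pos _ (hg.mem σ hσT)])
  have hC : riseConst B / 2 = Real.exp (levelConst B) := by unfold riseConst; ring
  have hCp : 0 < riseConst B := by unfold riseConst; positivity
  have he : Real.exp |t - σ| ≤ riseConst B / 2 := by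
    rw [hC, Real.exp_le_exp, abs_of_nonneg (by linarith [hσ.2])]
    linarith [hm.1]
  have pσ := H.pos _ (hg.mem σ hσT)
  have pt := H.pos _ (hg.mem t htT)
  have e1 : δ (g σ) ≤ riseConst B / 2 * δ (g t) := by
    have := H.height_le hg htT hσT
    nlinarith
  have e2 : d (g σ) (g t) ≤ riseConst B / 2 * δ (g σ) := by
    have := H.d_le hg hσT htT
    rw [abs_sub_comm] at this
    nlinarith
  have e3 := H.d_le_rise hg h0 hσT hσ.1 fun τ hτ => hσmax τ ⟨hτ.1, hτ.2.trans hσ.2⟩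
  have e4 := H.tri _ (hg.mem 0 h0) _ (hg.mem σ hσT) _ (hg.mem t htT)
  calc d (g 0) (g t) ≤ (riseConst B + riseConst B / 2) * δ (g σ) := by linarith
    _ ≤ (riseConst B + riseConst B / 2) * (riseConst B / 2 * δ (g t)) := by gcongr
    _ = _ := by ring

/-- One half of a side of a triangle of arcs lies near the other two sides. -/
theorem exists_thin (H : IsLogComparable S k d δ B) (hB : 0 ≤ B) :
    ∃ Δ : ℝ, 0 ≤ Δ ∧ ∀ (g g₁ g₂ : ℝ → α) (T T₁ T₂ t t₀ : ℝ), IsArc S k g T → IsArc S k g₁ T₁ →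
      IsArc S k g₂ T₂ → 0 ≤ T₁ → 0 ≤ T₂ → g₁ 0 = g 0 → g₂ 0 = g₁ T₁ → g₂ T₂ = g T → 0 ≤ t →
      t ≤ t₀ → t₀ ≤ T → (∀ τ ∈ Icc 0 t, δ (g τ) ≤ δ (g t₀)) →
      ∃ p ∈ g₁ '' Icc 0 T₁ ∪ g₂ '' Icc 0 T₂, k (g t) p ≤ Δ := by
  set C := riseConst B with hCdef
  have hC : 0 < C := by rw [hCdef]; unfold riseConst; positivity
  set M := Real.exp (4 * Real.log (1 + (2 * C + 1)) + B) with hM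
  have hMp : 0 < M := Real.exp_pos _
  set P := (C + C / 2) * (C / 2) with hP
  have hPp : 0 < P := by positivity
  set ε := ((4 * C + 2) * M + 1)⁻¹ with hε
  have hεp : 0 < ε := by positivity
  have hε1 : ε ≤ 1 := inv_le_one_of_one_le₀ (by nlinarith)
  have hεM : (4 * C + 2) * M * ε < 1 := by
    rw [hε, ← div_eq_mul_inv, div_lt_one (by positivity)]
    linarith
  have hlog : 0 ≤ Real.log (1 + (P / ε + 3 * C)) := by
    apply Real.log_nonneg
    have : 0 < P / ε + 3 * C := by positivity
    linarith
  refine ⟨4 * Real.log (1 + (P / ε + 3 * C)) + B, by positivity, ?_⟩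
  intro g g₁ g₂ T T₁ T₂ t t₀ hg hg₁ hg₂ hT₁ hT₂ hx hz hy ht htt ht₀ hmax
  have htT : t ∈ Icc 0 T := ⟨ht, htt.trans ht₀⟩
  have h0 : (0:ℝ) ∈ Icc 0 T := ⟨le_rfl, ht.trans htT.2⟩
  have hTT : T ∈ Icc 0 T := ⟨ht.trans htT.2, le_rfl⟩
  have h0₁ : (0:ℝ) ∈ Icc 0 T₁ := ⟨le_rfl, hT₁⟩
  have hTT₁ : T₁ ∈ Icc 0 T₁ := ⟨hT₁, le_rfl⟩
  have h0₂ : (0:ℝ) ∈ Icc 0 T₂ := ⟨le_rfl, hT₂⟩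
  have hTT₂ : T₂ ∈ Icc 0 T₂ := ⟨hT₂, le_rfl⟩
  have hp := H.pos _ (hg.mem t htT)
  set h := ε * δ (g t) with hh
  have hhp : 0 < h := by positivity
  have hhle : h ≤ δ (g t) := by nlinarith
  have hd0 : d (g 0) (g t) ≤ P * δ (g t) := H.d_origin_le hg ht htt ht₀ hmax
  have hPh : P * δ (g t) = P / ε * h := by rw [hh]; field_simp
  rw [hPh, H.symm _ (hg.mem 0 h0) _ (hg.mem t htT)] at hd0
  have fin : ∀ q ∈ S, h ≤ δ q → d (g 0) q ≤ 3 * C * h →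
      k (g t) q ≤ 4 * Real.log (1 + (P / ε + 3 * C)) + B := by
    intro q hq hqh hqd
    apply H.upper_of_le (hg.mem t htT) hq hhp hhle hqh
    have := H.tri _ (hg.mem t htT) _ (hg.mem 0 h0) _ hq
    linarith
  by_cases hc₁ : ∃ s ∈ Icc 0 T₁, h ≤ δ (g₁ s)
  · obtain ⟨s, hs, hsh⟩ := hc₁
    obtain ⟨m, hm, hmh, -, hmd⟩ := H.exists_reach hg₁ hhp hs hsh
    have hmT : m ∈ Icc 0 T₁ := ⟨hm.1, hm.2.trans hs.2⟩
    refine ⟨g₁ m, Or.inl ⟨m, hmT, rfl⟩, fin _ (hg₁.mem m hmT) hmh ?_⟩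
    rw [← hx]
    nlinarith
  push Not at hc₁
  have hends₁ := H.d_ends_le hg₁ hT₁ fun τ hτ => (hc₁ τ hτ).le
  rw [hx] at hends₁
  by_cases hc₂ : ∃ s ∈ Icc 0 T₂, h ≤ δ (g₂ s)
  · obtain ⟨s, hs, hsh⟩ := hc₂
    obtain ⟨m, hm, hmh, -, hmd⟩ := H.exists_reach hg₂ hhp hs hsh
    have hmT : m ∈ Icc 0 T₂ := ⟨hm.1, hm.2.trans hs.2⟩
    refine ⟨g₂ m, Or.inr ⟨m, hmT, rfl⟩, fin _ (hg₂.mem m hmT) hmh ?_⟩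
    have := H.tri _ (hg.mem 0 h0) _ (hg₁.mem T₁ hTT₁) _ (hg₂.mem m hmT)
    rw [← hz] at this hends₁
    linarith
  push Not at hc₂
  exfalso
  have hends₂ := H.d_ends_le hg₂ hT₂ fun τ hτ => (hc₂ τ hτ).le
  rw [hy, hz] at hends₂
  have htri := H.tri _ (hg.mem 0 h0) _ (hg₁.mem T₁ hTT₁) _ (hg.mem T hTT)
  have hx' := hc₁ 0 h0₁
  have hy' := hc₂ T₂ hTT₂
  rw [hx] at hx'
  rw [hy] at hy'
  have hle := H.height_le_ends hB hg htT
  have h1 : d (g 0) (g T) + δ (g 0) + δ (g T) ≤ (4 * C + 2) * h := by linarith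
  have h2 : δ (g t) ≤ (4 * C + 2) * h * M := hle.trans (by gcongr)
  have h3 : (4 * C + 2) * h * M = ((4 * C + 2) * M * ε) * δ (g t) := by rw [hh]; ring
  rw [h3] at h2
  nlinarith

theorem isGromovHyperbolic (H : IsLogComparable S k d δ B) (hB : 0 ≤ B) :
    IsGromovHyperbolic S k := by
  obtain ⟨Δ, hΔ, thin⟩ := H.exists_thin hB
  refine ⟨Δ, hΔ, ?_⟩
  rintro x hx y hy z hz g g₁ g₂ ⟨gx, gy, gm, gd⟩ ⟨g₁x, g₁z, g₁m, g₁d⟩ ⟨g₂z, g₂y, g₂m, g₂d⟩ t ht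
  have hg : IsArc S k g (k x y) := ⟨gm, gd⟩
  have hg₁ : IsArc S k g₁ (k x z) := ⟨g₁m, g₁d⟩
  have hg₂ : IsArc S k g₂ (k z y) := ⟨g₂m, g₂d⟩
  have hT := H.dist_nonneg hx hy
  have hT₁ := H.dist_nonneg hx hz
  have hT₂ := H.dist_nonneg hz hy
  obtain ⟨t₀, ht₀, hmax⟩ := H.exists_max hg hT le_rfl
  rcases le_total t t₀ with h | h
  · exact thin g g₁ g₂ _ _ _ t t₀ hg hg₁ hg₂ hT₁ hT₂ (g₁x.trans gx.symm) (g₂z.trans g₁z.symm)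
      (g₂y.trans gy.symm) ht.1 h ht₀.2 fun τ hτ => hmax τ ⟨hτ.1, hτ.2.trans ht.2⟩
  · obtain ⟨p, hp, hkp⟩ := thin _ _ _ _ _ _ (k x y - t) (k x y - t₀) hg.reverse hg₂.reverse
      hg₁.reverse hT₂ hT₁ (by simp [g₂y, gy]) (by simp [g₁z, g₂z]) (by simp [g₁x, gx])
      (by linarith [ht.2]) (by linarith) (by linarith [ht₀.1]) (by
        intro τ hτ
        rw [sub_sub_cancel]
        exact hmax _ ⟨by linarith [hτ.2, ht.1], by linarith [hτ.1]⟩)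
    rw [sub_sub_cancel] at hkp
    refine ⟨p, ?_, hkp⟩
    rcases hp with ⟨s, hs, rfl⟩ | ⟨s, hs, rfl⟩
    · exact Or.inr ⟨_, ⟨by linarith [hs.2], by linarith [hs.1]⟩, rfl⟩
    · exact Or.inl ⟨_, ⟨by linarith [hs.2], by linarith [hs.1]⟩, rfl⟩

end IsLogComparable

/-- `γ` is a `C¹` curve in `S`, constant outside `[0, 1]`, joining `x` to `y`, of `ρ`-length at
most `L`. -/
structure IsRestedCurve (S : Set ℂ) (ρ : ℂ → ℝ) (x y : ℂ) (L : ℝ) (γ : ℝ → ℂ) : Prop where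
  contDiff : ContDiff ℝ 1 γ
  source : ∀ t ≤ 0, γ t = x
  target : ∀ t, 1 ≤ t → γ t = y
  mem : ∀ t, γ t ∈ S
  length_le : curveLen ρ γ ≤ L

/-- `x` and `y` are joined in `S` by a resting `C¹` curve of `ρ`-length at most `L`. -/
def Joinable (S : Set ℂ) (ρ : ℂ → ℝ) (x y : ℂ) (L : ℝ) : Prop :=
  ∃ γ, IsRestedCurve S ρ x y L γ

theorem deriv_eq_zero_of_eqOn_Iic {γ : ℝ → ℂ} {a : ℝ} {x : ℂ} (hγ : Differentiable ℝ γ)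
    (h : ∀ t ≤ a, γ t = x) {t : ℝ} (ht : t ≤ a) : deriv γ t = 0 := by
  have h1 : HasDerivWithinAt γ (deriv γ t) (Iic t) t := (hγ t).hasDerivAt.hasDerivWithinAt
  have h2 : HasDerivWithinAt γ 0 (Iic t) t :=
    (hasDerivWithinAt_const t (Iic t) x).congr (fun s hs => h s (le_trans hs ht)) (h t ht)
  exact (uniqueDiffWithinAt_Iic t).eq_deriv _ h1 h2

theorem deriv_eq_zero_of_eqOn_Ici {γ : ℝ → ℂ} {a : ℝ} {x : ℂ} (hγ : Differentiable ℝ γ)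
    (h : ∀ t, a ≤ t → γ t = x) {t : ℝ} (ht : a ≤ t) : deriv γ t = 0 := by
  have h1 : HasDerivWithinAt γ (deriv γ t) (Ici t) t := (hγ t).hasDerivAt.hasDerivWithinAt
  have h2 : HasDerivWithinAt γ 0 (Ici t) t :=
    (hasDerivWithinAt_const t (Ici t) x).congr (fun s hs => h s (le_trans ht hs)) (h t ht)
  exact (uniqueDiffWithinAt_Ici t).eq_deriv _ h1 h2

namespace Joinable

variable {S : Set ℂ} {ρ : ℂ → ℝ} {x y z : ℂ} {L M : ℝ}

theorem mono (h : Joinable S ρ x y L) (hLM : L ≤ M) : Joinable S ρ x y M := by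
  obtain ⟨γ, hγ⟩ := h
  exact ⟨γ, hγ.contDiff, hγ.source, hγ.target, hγ.mem, hγ.length_le.trans hLM⟩

theorem symm (h : Joinable S ρ x y L) : Joinable S ρ y x L := by
  obtain ⟨γ, hγ⟩ := h
  refine ⟨fun t => γ (1 - t), ?_, fun t ht => hγ.target _ (by linarith),
    fun t ht => hγ.source _ (by linarith), fun t => hγ.mem _, ?_⟩
  · exact hγ.contDiff.comp (contDiff_const.sub contDiff_id)
  · have hd : ∀ t, deriv (fun t => γ (1 - t)) t = -deriv γ (1 - t) :=
      fun t => deriv_comp_const_sub γ 1 t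
    refine le_trans (le_of_eq ?_) hγ.length_le
    unfold curveLen
    simp only [hd, norm_neg]
    rw [intervalIntegral.integral_comp_sub_left (fun t => ρ (γ t) * ‖deriv γ t‖)]
    simp

theorem trans (hρ : ContinuousOn ρ S) (h₁ : Joinable S ρ x y L) (h₂ : Joinable S ρ y z M) :
    Joinable S ρ x z (L + M) := by
  obtain ⟨γ₁, h₁⟩ := h₁
  obtain ⟨γ₂, h₂⟩ := h₂
  set γ : ℝ → ℂ := fun t => γ₁ (2 * t) + γ₂ (2 * t - 1) - y with hγ
  have d₁ : Differentiable ℝ γ₁ := h₁.contDiff.differentiable one_ne_zero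
  have d₂ : Differentiable ℝ γ₂ := h₂.contDiff.differentiable one_ne_zero
  have left : ∀ t ≤ 1 / 2, γ t = γ₁ (2 * t) := fun t ht => by
    rw [hγ]
    simp [h₂.source (2 * t - 1) (by linarith)]
  have right : ∀ t, 1 / 2 ≤ t → γ t = γ₂ (2 * t - 1) := fun t ht => by
    rw [hγ]
    simp [h₁.target (2 * t) (by linarith)]
  have hcd : ContDiff ℝ 1 γ :=
    ((h₁.contDiff.comp (contDiff_const.mul contDiff_id)).add
      (h₂.contDiff.comp ((contDiff_const.mul contDiff_id).sub contDiff_const))).sub contDiff_const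
  have hmem : ∀ t, γ t ∈ S := fun t => by
    rcases le_total t (1 / 2) with h | h
    · rw [left t h]
      exact h₁.mem _
    · rw [right t h]
      exact h₂.mem _
  have hder : ∀ t, deriv γ t = 2 * deriv γ₁ (2 * t) + 2 * deriv γ₂ (2 * t - 1) := fun t => by
    have e1 : HasDerivAt (fun t : ℝ => 2 * t) 2 t := by
      simpa using (hasDerivAt_id t).const_mul (2:ℝ)
    have e2 : HasDerivAt (fun t : ℝ => 2 * t - 1) 2 t := e1.sub_const 1
    have f1 := (d₁ (2 * t)).hasDerivAt.scomp t e1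
    have f2 := (d₂ (2 * t - 1)).hasDerivAt.scomp t e2
    have := ((f1.add f2).sub_const y).deriv
    simp only [real_smul, ofReal_ofNat] at this
    exact this
  have hint : ∀ a b : ℝ, IntervalIntegrable (fun t => ρ (γ t) * ‖deriv γ t‖)
      MeasureTheory.volume a b := fun a b => by
    apply Continuous.intervalIntegrable
    exact (hρ.comp_continuous hcd.continuous hmem).mul hcd.continuous_deriv_one.norm
  refine ⟨γ, hcd, fun t ht => ?_, fun t ht => ?_, hmem, ?_⟩
  · rw [left t (by linarith), h₁.source _ (by linarith)]
  · rw [right t (by linarith), h₂.target _ (by linarith)]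
  · have i1 : ∫ t in (0:ℝ)..1 / 2, ρ (γ t) * ‖deriv γ t‖ = curveLen ρ γ₁ := by
      have : ∀ t ∈ uIcc (0:ℝ) (1 / 2), ρ (γ t) * ‖deriv γ t‖ =
          2 * (fun u => ρ (γ₁ u) * ‖deriv γ₁ u‖) (2 * t) := by
        intro t ht
        rw [uIcc_of_le (by norm_num)] at ht
        rw [left t ht.2, hder, deriv_eq_zero_of_eqOn_Iic d₂ h₂.source (t := 2 * t - 1)
          (by linarith [ht.2])]
        simp
        ring
      rw [intervalIntegral.integral_congr this, intervalIntegral.integral_const_mul]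
      exact (intervalIntegral.mul_integral_comp_mul_left
        (f := fun u => ρ (γ₁ u) * ‖deriv γ₁ u‖) (2:ℝ)).trans (by norm_num [curveLen])
    have i2 : ∫ t in (1 / 2:ℝ)..1, ρ (γ t) * ‖deriv γ t‖ = curveLen ρ γ₂ := by
      have : ∀ t ∈ uIcc (1 / 2:ℝ) 1, ρ (γ t) * ‖deriv γ t‖ =
          2 * (fun u => ρ (γ₂ u) * ‖deriv γ₂ u‖) (2 * t - 1) := by
        intro t ht
        rw [uIcc_of_le (by norm_num)] at ht
        rw [right t ht.1, hder, deriv_eq_zero_of_eqOn_Ici d₁ h₁.target (t := 2 * t)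
          (by linarith [ht.1])]
        simp
        ring
      rw [intervalIntegral.integral_congr this, intervalIntegral.integral_const_mul]
      exact (intervalIntegral.mul_integral_comp_mul_sub
        (f := fun u => ρ (γ₂ u) * ‖deriv γ₂ u‖) (2:ℝ) 1).trans (by norm_num [curveLen])
    have := intervalIntegral.integral_add_adjacent_intervals (hint 0 (1 / 2)) (hint (1 / 2) 1)
    rw [i1, i2] at this
    have h3 : curveLen ρ γ = curveLen ρ γ₁ + curveLen ρ γ₂ := this.symm
    rw [h3]
    exact add_le_add h₁.length_le h₂.length_le

/-- A segment moving linearly away from the boundary has logarithmic length. -/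
theorem of_segment (hρ : ContinuousOn ρ S) {p q : ℂ} {m : ℝ} (hm : 0 < m)
    (hS : ∀ s ∈ Icc (0:ℝ) 1, p + s * (q - p) ∈ S)
    (hle : ∀ s ∈ Icc (0:ℝ) 1, ρ (p + s * (q - p)) ≤ ((m + s * ‖q - p‖) / 2)⁻¹) :
    Joinable S ρ p q (2 * Real.log (1 + ‖q - p‖ / m)) := by
  have hcs : ContDiff ℝ 1 Real.smoothTransition :=
    Real.smoothTransition.contDiff (n := 1)
  have hds : ∀ t, HasDerivAt Real.smoothTransition (deriv Real.smoothTransition t) t :=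
    fun t => (hcs.differentiable one_ne_zero t).hasDerivAt
  have hpos : ∀ t, 0 ≤ deriv Real.smoothTransition t := fun t =>
    Real.smoothTransition.monotone.deriv_nonneg
  set γ : ℝ → ℂ := fun t => p + (Real.smoothTransition t : ℂ) * (q - p) with hγ
  have hder : ∀ t, HasDerivAt γ (((deriv Real.smoothTransition t : ℝ) : ℂ) * (q - p)) t := fun t =>
    ((hds t).ofReal_comp.mul_const _).const_add _
  have hcd : ContDiff ℝ 1 γ :=
    contDiff_const.add ((ofRealCLM.contDiff.comp hcs).mul contDiff_const)
  have hI : ∀ t, Real.smoothTransition t ∈ Icc (0:ℝ) 1 := fun t =>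
    ⟨Real.smoothTransition.nonneg t, Real.smoothTransition.le_one t⟩
  have hmem : ∀ t, γ t ∈ S := fun t => hS _ (hI t)
  set R := ‖q - p‖ with hR
  have hRn : 0 ≤ R := norm_nonneg _
  have hden : ∀ t, 0 < m + Real.smoothTransition t * R := fun t => by
    have := (hI t).1
    positivity
  refine ⟨γ, hcd, fun t ht => ?_, fun t ht => ?_, hmem, ?_⟩
  · simp [hγ, Real.smoothTransition.zero_of_nonpos ht]
  · simp [hγ, Real.smoothTransition.one_of_one_le ht]
  · have hF : ∀ t, HasDerivAt (fun t => 2 * Real.log (m + Real.smoothTransition t * R))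
        (2 * ((deriv Real.smoothTransition t * R) / (m + Real.smoothTransition t * R))) t :=
      fun t => ((((hds t).mul_const R).const_add m).log (hden t).ne').const_mul 2
    have hcF : Continuous fun t =>
        2 * ((deriv Real.smoothTransition t * R) / (m + Real.smoothTransition t * R)) := by
      refine continuous_const.mul (Continuous.div ?_ ?_ fun t => (hden t).ne')
      · exact hcs.continuous_deriv_one.mul continuous_const
      · exact continuous_const.add (hcs.continuous.mul continuous_const)
    have hint := intervalIntegral.integral_eq_sub_of_hasDerivAt (a := 0) (b := 1)
      (fun t _ => hF t) (hcF.intervalIntegrable _ _)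
    rw [Real.smoothTransition.zero, Real.smoothTransition.one, zero_mul, one_mul, add_zero] at hint
    have hlog : 2 * Real.log (1 + R / m) = 2 * Real.log (m + R) - 2 * Real.log m := by
      rw [← mul_sub, ← Real.log_div (by positivity) hm.ne']
      congr 2
      field_simp
    rw [hlog, ← hint]
    unfold curveLen
    apply intervalIntegral.integral_mono_on zero_le_one
    · apply Continuous.intervalIntegrable
      exact (hρ.comp_continuous hcd.continuous hmem).mul hcd.continuous_deriv_one.norm
    · exact hcF.intervalIntegrable _ _
    · intro t _
      rw [(hder t).deriv, norm_mul, norm_real, Real.norm_of_nonneg (hpos t), ← hR]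
      have h1 := hle _ (hI t)
      have h2 : 0 ≤ deriv Real.smoothTransition t * R := mul_nonneg (hpos t) hRn
      calc ρ (γ t) * (deriv Real.smoothTransition t * R)
          ≤ ((m + Real.smoothTransition t * R) / 2)⁻¹ * (deriv Real.smoothTransition t * R) := by
            gcongr
        _ = _ := by
          rw [inv_div]
          ring

end Joinable

theorem densityDist_le_of_joinable {S : Set ℂ} {ρ : ℂ → ℝ} (hρ : ∀ z, 0 ≤ ρ z) {x y : ℂ} {L : ℝ}
    (h : Joinable S ρ x y L) : densityDist S ρ x y ≤ L := by
  obtain ⟨γ, hγ⟩ := h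
  refine le_trans (csInf_le ⟨0, ?_⟩ ⟨γ, hγ.contDiff.contDiffOn, hγ.source 0 le_rfl,
    hγ.target 1 le_rfl, fun t _ => hγ.mem t, rfl⟩) hγ.length_le
  rintro _ ⟨γ', -, -, -, -, rfl⟩
  exact intervalIntegral.integral_nonneg zero_le_one fun t _ =>
    mul_nonneg (hρ _) (norm_nonneg _)

theorem infDist_compl_pos {Ω : Set ℂ} (ho : IsOpen Ω) (hne : Ωᶜ.Nonempty) {x : ℂ} (hx : x ∈ Ω) :
    0 < infDist x Ωᶜ :=
  (ho.isClosed_compl.notMem_iff_infDist_pos hne).1 fun h => h hx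

theorem continuousOn_qhDensity {Ω : Set ℂ} (ho : IsOpen Ω) (hne : Ωᶜ.Nonempty) :
    ContinuousOn (qhDensity Ω) Ω :=
  (continuous_infDist_pt _).continuousOn.inv₀ fun _ hx => (infDist_compl_pos ho hne hx).ne'

theorem qhDensity_nonneg (Ω : Set ℂ) (z : ℂ) : 0 ≤ qhDensity Ω z := inv_nonneg.2 infDist_nonneg

/-- The quasihyperbolic length of a curve bounds its Euclidean length logarithmically. -/
theorem exists_length_le_qh {Ω : Set ℂ} (ho : IsOpen Ω) (hne : Ωᶜ.Nonempty) {γ : ℝ → ℂ}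
    (hγ : ContDiffOn ℝ 1 γ (Icc 0 1)) (hmem : ∀ t ∈ Icc (0:ℝ) 1, γ t ∈ Ω) :
    ∃ L : ℝ, infDist (γ 0) Ωᶜ + L ≤ infDist (γ 0) Ωᶜ * Real.exp (curveLen (qhDensity Ω) γ) ∧
      ∀ t ∈ Icc (0:ℝ) 1, ‖γ 0 - γ t‖ + ‖γ t - γ 1‖ ≤ L := by
  set w : ℝ → ℂ := fun t => derivWithin γ (Icc 0 1) (projIcc (0:ℝ) 1 zero_le_one t) with hw
  have hwc : Continuous w :=
    (hγ.continuousOn_derivWithin (uniqueDiffOn_Icc zero_lt_one) le_rfl).comp_continuous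
      (continuous_subtype_val.comp continuous_projIcc) fun t => (projIcc _ _ _ t).2
  have hwd : ∀ t ∈ Ioo (0:ℝ) 1, HasDerivAt γ (w t) t := by
    intro t ht
    have h1 := (hγ.differentiableOn one_ne_zero t (Ioo_subset_Icc_self ht)).hasDerivWithinAt
    rw [hw]
    simp only
    rw [projIcc_of_mem zero_le_one (Ioo_subset_Icc_self ht)]
    exact h1.hasDerivAt (Icc_mem_nhds ht.1 ht.2)
  set ℓ : ℝ → ℝ := fun t => ∫ s in (0:ℝ)..t, ‖w s‖ with hℓ
  have hℓd : ∀ t, HasDerivAt ℓ ‖w t‖ t := fun t =>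
    intervalIntegral.integral_hasDerivAt_right (hwc.norm.intervalIntegrable _ _)
      (hwc.norm.stronglyMeasurableAtFilter _ _) hwc.norm.continuousAt
  have hℓ0 : ℓ 0 = 0 := by simp [hℓ]
  have hℓn : ∀ t, 0 ≤ t → 0 ≤ ℓ t := fun t ht =>
    intervalIntegral.integral_nonneg ht fun s _ => norm_nonneg _
  have hdiff : ∀ s ∈ Icc (0:ℝ) 1, ∀ t ∈ Icc (0:ℝ) 1, s ≤ t → ‖γ t - γ s‖ ≤ ℓ t - ℓ s := by
    intro s hs t ht hst
    have h1 := intervalIntegral.integral_eq_sub_of_hasDerivAt_of_le hst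
      (hγ.continuousOn.mono (Icc_subset_Icc hs.1 ht.2))
      (fun u hu => hwd u ⟨hs.1.trans_lt hu.1, hu.2.trans_le ht.2⟩) (hwc.intervalIntegrable _ _)
    rw [← h1, hℓ]
    simp only
    rw [intervalIntegral.integral_interval_sub_left (hwc.norm.intervalIntegrable _ _)
      (hwc.norm.intervalIntegrable _ _)]
    exact intervalIntegral.norm_integral_le_integral_norm hst
  have h0 : (0:ℝ) ∈ Icc (0:ℝ) 1 := ⟨le_rfl, zero_le_one⟩
  have h1 : (1:ℝ) ∈ Icc (0:ℝ) 1 := ⟨zero_le_one, le_rfl⟩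
  have hpx := infDist_compl_pos ho hne (hmem 0 h0)
  set D := infDist (γ 0) Ωᶜ with hD
  refine ⟨ℓ 1, ?_, fun t ht => ?_⟩
  · have hden : ∀ t ∈ Icc (0:ℝ) 1, 0 < D + ℓ t := fun t ht => by linarith [hℓn t ht.1]
    have hF : ∀ t ∈ uIcc (0:ℝ) 1, HasDerivAt (fun t => Real.log (D + ℓ t))
        (‖w t‖ / (D + ℓ t)) t := fun t ht => by
      rw [uIcc_of_le zero_le_one] at ht
      exact ((hℓd t).const_add D).log (hden t ht).ne'
    have hℓc : Continuous ℓ := continuous_iff_continuousAt.2 fun t => (hℓd t).continuousAt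
    have hcF : IntervalIntegrable (fun t => ‖w t‖ / (D + ℓ t)) MeasureTheory.volume 0 1 := by
      apply ContinuousOn.intervalIntegrable
      rw [uIcc_of_le zero_le_one]
      exact hwc.norm.continuousOn.div (continuous_const.add hℓc).continuousOn
        fun t ht => (hden t ht).ne'
    have hint := intervalIntegral.integral_eq_sub_of_hasDerivAt hF hcF
    have hcl : curveLen (qhDensity Ω) γ = ∫ t in (0:ℝ)..1, qhDensity Ω (γ t) * ‖w t‖ := by
      unfold curveLen
      apply intervalIntegral.integral_congr_uIoo
      intro t ht
      rw [uIoo_of_le zero_le_one] at ht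
      simp only [(hwd t ht).deriv]
    have hle : Real.log (D + ℓ 1) - Real.log D ≤ curveLen (qhDensity Ω) γ := by
      rw [hℓ0, add_zero] at hint
      rw [← hint, hcl]
      apply intervalIntegral.integral_mono_on zero_le_one hcF
      · apply ContinuousOn.intervalIntegrable
        rw [uIcc_of_le zero_le_one]
        exact ((continuousOn_qhDensity ho hne).comp hγ.continuousOn hmem).mul hwc.norm.continuousOn
      · intro t ht
        have e1 : infDist (γ t) Ωᶜ ≤ D + ℓ t := by
          have e2 := infDist_le_infDist_add_dist (s := Ωᶜ) (x := γ t) (y := γ 0)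
          rw [dist_eq_norm] at e2
          have e3 := hdiff 0 h0 t ht ht.1
          rw [hℓ0] at e3
          linarith
        have e4 := infDist_compl_pos ho hne (hmem t ht)
        rw [div_eq_mul_inv, mul_comm]
        unfold qhDensity
        gcongr
    rw [← Real.log_div (hden 1 h1).ne' hpx.ne',
      Real.log_le_iff_le_exp (div_pos (hden 1 h1) hpx), div_le_iff₀ hpx] at hle
    linarith
  · have e1 := hdiff 0 h0 t ht ht.1
    have e2 := hdiff t ht 1 h1 ht.2
    rw [norm_sub_rev] at e1 e2
    linarith

/-- The least Euclidean length of a broken line from `x` to `y` through a real point of `Ω`. -/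
def crossDist (Ω : Set ℂ) (x y : ℂ) : ℝ :=
  sInf ((fun t : ℝ => ‖x - t‖ + ‖(t : ℂ) - y‖) '' {t : ℝ | (t : ℂ) ∈ Ω})

/-- The inner length distance of the complement of a closed subset of the real line. -/
def innerDist (Ω : Set ℂ) (x y : ℂ) : ℝ :=
  if (0 ≤ x.im ↔ 0 ≤ y.im) then ‖x - y‖ else crossDist Ω x y

section CrossDist

variable {Ω : Set ℂ}

theorem crossDist_le (x y : ℂ) {t : ℝ} (ht : (t : ℂ) ∈ Ω) :
    crossDist Ω x y ≤ ‖x - t‖ + ‖(t : ℂ) - y‖ := by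
  refine csInf_le ⟨0, ?_⟩ ⟨t, ht, rfl⟩
  rintro _ ⟨s, -, rfl⟩
  positivity

theorem le_crossDist (hG : ∃ t : ℝ, (t : ℂ) ∈ Ω) {x y : ℂ} {L : ℝ}
    (h : ∀ t : ℝ, (t : ℂ) ∈ Ω → L ≤ ‖x - t‖ + ‖(t : ℂ) - y‖) : L ≤ crossDist Ω x y := by
  obtain ⟨t, ht⟩ := hG
  refine le_csInf ⟨_, t, ht, rfl⟩ ?_
  rintro _ ⟨s, hs, rfl⟩
  exact h s hs

theorem norm_sub_le_crossDist (hG : ∃ t : ℝ, (t : ℂ) ∈ Ω) (x y : ℂ) :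
    ‖x - y‖ ≤ crossDist Ω x y :=
  le_crossDist hG fun t _ => norm_sub_le_norm_sub_add_norm_sub x t y

theorem crossDist_comm (x y : ℂ) : crossDist Ω x y = crossDist Ω y x := by
  unfold crossDist
  congr 1
  apply image_congr
  intro t _
  rw [norm_sub_rev x, norm_sub_rev _ y, add_comm]

theorem crossDist_le_norm_add (hG : ∃ t : ℝ, (t : ℂ) ∈ Ω) (x y z : ℂ) :
    crossDist Ω x z ≤ ‖x - y‖ + crossDist Ω y z := by
  rw [← sub_le_iff_le_add']
  apply le_crossDist hG
  intro t ht
  linarith [crossDist_le x z ht, norm_sub_le_norm_sub_add_norm_sub x y t]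

theorem innerDist_self (x : ℂ) : innerDist Ω x x = 0 := by simp [innerDist]

theorem innerDist_comm (x y : ℂ) : innerDist Ω x y = innerDist Ω y x := by
  unfold innerDist
  by_cases h : 0 ≤ x.im ↔ 0 ≤ y.im
  · rw [if_pos h, if_pos h.symm, norm_sub_rev]
  · rw [if_neg h, if_neg fun h' => h h'.symm, crossDist_comm]

theorem norm_sub_le_innerDist (hG : ∃ t : ℝ, (t : ℂ) ∈ Ω) (x y : ℂ) :
    ‖x - y‖ ≤ innerDist Ω x y := by
  unfold innerDist
  split_ifs
  · exact le_rfl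
  · exact norm_sub_le_crossDist hG x y

theorem innerDist_triangle (hG : ∃ t : ℝ, (t : ℂ) ∈ Ω) (x y z : ℂ) :
    innerDist Ω x z ≤ innerDist Ω x y + innerDist Ω y z := by
  by_cases hxz : 0 ≤ x.im ↔ 0 ≤ z.im
  · have h1 := norm_sub_le_innerDist hG x y
    have h2 := norm_sub_le_innerDist hG y z
    have h3 := norm_sub_le_norm_sub_add_norm_sub x y z
    rw [innerDist, if_pos hxz]
    linarith
  · rw [innerDist, if_neg hxz]
    by_cases hxy : 0 ≤ x.im ↔ 0 ≤ y.im
    · have hyz : ¬(0 ≤ y.im ↔ 0 ≤ z.im) := by tauto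
      rw [innerDist, if_pos hxy, innerDist, if_neg hyz]
      exact crossDist_le_norm_add hG x y z
    · have hyz : 0 ≤ y.im ↔ 0 ≤ z.im := by tauto
      rw [innerDist, if_neg hxy, innerDist, if_pos hyz]
      have := crossDist_le_norm_add hG z y x
      rw [crossDist_comm z x, crossDist_comm y x, norm_sub_rev] at this
      linarith

/-- A curve in `Ω` is at least as long as the inner distance of its endpoints. -/
theorem innerDist_le_of_curve {γ : ℝ → ℂ} (hγ : ContinuousOn γ (Icc 0 1))
    (hmem : ∀ t ∈ Icc (0:ℝ) 1, γ t ∈ Ω) {L : ℝ}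
    (hL : ∀ t ∈ Icc (0:ℝ) 1, ‖γ 0 - γ t‖ + ‖γ t - γ 1‖ ≤ L) : innerDist Ω (γ 0) (γ 1) ≤ L := by
  unfold innerDist
  split_ifs with h
  · simpa using hL 0 ⟨le_rfl, zero_le_one⟩
  · have h0 : (0:ℝ) ∈ uIcc (γ 0).im (γ 1).im := by
      rw [mem_uIcc]
      by_cases h1 : 0 ≤ (γ 0).im
      · have : ¬ 0 ≤ (γ 1).im := by tauto
        exact Or.inr ⟨(not_le.1 this).le, h1⟩
      · have : 0 ≤ (γ 1).im := by tauto
        exact Or.inl ⟨(not_le.1 h1).le, this⟩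
    have hc : ContinuousOn (fun t => (γ t).im) (uIcc 0 1) := by
      rw [uIcc_of_le zero_le_one]
      exact continuous_im.comp_continuousOn hγ
    obtain ⟨t, ht, ht0⟩ := intermediate_value_uIcc hc h0
    rw [uIcc_of_le zero_le_one] at ht
    have ht0' : (γ t).im = 0 := ht0
    have hre : (((γ t).re : ℝ) : ℂ) = γ t := Complex.ext (by simp) (by simp [ht0'])
    have h1 := crossDist_le (Ω := Ω) (γ 0) (γ 1) (t := (γ t).re) (by rw [hre]; exact hmem t ht)
    rw [hre] at h1
    exact h1.trans (hL t ht)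

end CrossDist

section SlitPlane

variable {Ω : Set ℂ}

theorem mem_of_infDist_compl_pos {z : ℂ} (h : 0 < infDist z Ωᶜ) : z ∈ Ω := by
  by_contra hz
  rw [infDist_zero_of_mem (show z ∈ Ωᶜ from hz)] at h
  exact lt_irrefl _ h

theorem joinable_of_segment (ho : IsOpen Ω) (hne : Ωᶜ.Nonempty) {p q : ℂ} {m : ℝ} (hm : 0 < m)
    (hle : ∀ s ∈ Icc (0:ℝ) 1, (m + s * ‖q - p‖) / 2 ≤ infDist (p + s * (q - p)) Ωᶜ) :
    Joinable Ω (qhDensity Ω) p q (2 * Real.log (1 + ‖q - p‖ / m)) := by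
  have hpos : ∀ s ∈ Icc (0:ℝ) 1, 0 < (m + s * ‖q - p‖) / 2 := fun s hs => by
    have := hs.1
    positivity
  refine Joinable.of_segment (continuousOn_qhDensity ho hne) hm
    (fun s hs => mem_of_infDist_compl_pos ((hpos s hs).trans_le (hle s hs))) fun s hs => ?_
  exact inv_anti₀ (hpos s hs) (hle s hs)

theorem le_infDist_of_im (hne : Ωᶜ.Nonempty) (him : ∀ e ∈ Ωᶜ, e.im = 0) {z : ℂ} {u : ℝ}
    (h : u ≤ |z.im|) : u ≤ infDist z Ωᶜ := by
  rw [le_infDist hne]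
  intro e he
  rw [dist_eq_norm]
  have := abs_im_le_norm (z - e)
  rw [sub_im, him e he, sub_zero] at this
  linarith

theorem infDist_le_of_re_im (hne : Ωᶜ.Nonempty) (him : ∀ e ∈ Ωᶜ, e.im = 0) {x z : ℂ}
    (hre : z.re = x.re) (h : |x.im| ≤ |z.im|) : infDist x Ωᶜ ≤ infDist z Ωᶜ := by
  rw [le_infDist hne]
  intro e he
  refine (infDist_le_dist_of_mem he).trans ?_
  rw [dist_eq_norm, dist_eq_norm, norm_def, norm_def]
  apply Real.sqrt_le_sqrt
  rw [normSq_apply, normSq_apply, sub_re, sub_re, sub_im, sub_im, him e he, hre, sub_zero, sub_zero]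
  have := sq_le_sq.2 h
  nlinarith

theorem joinable_vertical (ho : IsOpen Ω) (hne : Ωᶜ.Nonempty) (him : ∀ e ∈ Ωᶜ, e.im = 0)
    {x : ℂ} (hx : x ∈ Ω) {σ R : ℝ} (hσ : |σ| = 1) (hσx : 0 ≤ σ * x.im) (hR : 0 ≤ R) :
    Joinable Ω (qhDensity Ω) x (x + (σ * R : ℝ) * I)
      (2 * Real.log (1 + R / infDist x Ωᶜ)) := by
  have hn : ‖x + (σ * R : ℝ) * I - x‖ = R := by
    rw [add_sub_cancel_left, norm_mul, norm_I, mul_one, norm_real, Real.norm_eq_abs, abs_mul, hσ,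
      one_mul, abs_of_nonneg hR]
  have h := joinable_of_segment ho hne (p := x) (q := x + (σ * R : ℝ) * I)
    (infDist_compl_pos ho hne hx) (by
      intro s hs
      rw [hn, add_sub_cancel_left]
      have hsR : 0 ≤ s * R := mul_nonneg hs.1 hR
      have e1 : (x + s * ((σ * R : ℝ) * I)).re = x.re := by simp
      have e2 : (x + s * ((σ * R : ℝ) * I)).im = x.im + σ * (s * R) := by simp; ring
      have e3 : |x.im + σ * (s * R)| = |x.im| + s * R := by
        rcases (abs_eq zero_le_one).1 hσ with rfl | rfl
        · rw [abs_of_nonneg (by linarith), abs_of_nonneg (by linarith)]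
          ring
        · rw [abs_of_nonpos (by linarith), abs_of_nonpos (by linarith)]
          ring
      have f1 := infDist_le_of_re_im hne him e1 (by rw [e2, e3]; linarith)
      have f2 := le_infDist_of_im hne him (u := s * R) (z := x + s * ((σ * R : ℝ) * I))
        (by rw [e2, e3]; linarith [abs_nonneg x.im])
      linarith)
  rwa [hn] at h

/-- Two points of the same closed half-plane are joined by a short quasihyperbolic curve. -/
theorem joinable_same_side (ho : IsOpen Ω) (hne : Ωᶜ.Nonempty) (him : ∀ e ∈ Ωᶜ, e.im = 0)
    {x y : ℂ} (hx : x ∈ Ω) (hy : y ∈ Ω) {σ : ℝ} (hσ : |σ| = 1) (hσx : 0 ≤ σ * x.im)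
    (hσy : 0 ≤ σ * y.im) :
    Joinable Ω (qhDensity Ω) x y (2 * Real.log (1 + ‖x - y‖ / infDist x Ωᶜ) +
      2 * Real.log (1 + ‖x - y‖ / infDist y Ωᶜ) + 2) := by
  rcases eq_or_ne x y with rfl | hxy
  · have h := joinable_vertical ho hne him hx hσ hσx le_rfl
    rw [mul_zero, ofReal_zero, zero_mul, add_zero] at h
    exact h.mono (by simp)
  have hR : 0 < ‖x - y‖ := norm_pos_iff.2 (sub_ne_zero.2 hxy)
  set R := ‖x - y‖ with hRdef
  have h1 := joinable_vertical ho hne him hx hσ hσx hR.le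
  have h2 := joinable_vertical ho hne him hy hσ hσy hR.le
  have hn : ‖y + (σ * R : ℝ) * I - (x + (σ * R : ℝ) * I)‖ = R := by
    rw [add_sub_add_right_eq_sub, norm_sub_rev]
  have h3 := joinable_of_segment ho hne (p := x + (σ * R : ℝ) * I) (q := y + (σ * R : ℝ) * I) hR
    (by
      intro s hs
      rw [hn]
      have hsR : s * R ≤ R := by nlinarith [hs.2]
      have e1 : (x + (σ * R : ℝ) * I + s * (y + (σ * R : ℝ) * I - (x + (σ * R : ℝ) * I))).im =
          (1 - s) * x.im + s * y.im + σ * R := by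
        simp
        ring
      have e2 : R ≤ |(1 - s) * x.im + s * y.im + σ * R| := by
        have hs0 := hs.1
        have hs1 : 0 ≤ 1 - s := by linarith [hs.2]
        rcases (abs_eq zero_le_one).1 hσ with rfl | rfl
        · have : 0 ≤ (1 - s) * x.im + s * y.im := by
            rw [one_mul] at hσx hσy
            positivity
          exact le_trans (by linarith) (le_abs_self _)
        · have : 0 ≤ (1 - s) * (-1 * x.im) + s * (-1 * y.im) := by positivity
          exact le_trans (by linarith) (neg_le_abs _)
      have := le_infDist_of_im hne him (e1 ▸ e2)
      linarith)
  rw [hn, div_self hR.ne', one_add_one_eq_two] at h3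
  have hρ := continuousOn_qhDensity ho hne
  refine ((h1.trans hρ h3).trans hρ h2.symm).mono ?_
  have : Real.log 2 ≤ 1 := by
    have := Real.log_le_sub_one_of_pos (x := 2) (by norm_num)
    linarith
  linarith

/-- If the gates of `Ω` are relatively large then opposite points are joined by a short
quasihyperbolic curve. -/
theorem joinable_opposite (ho : IsOpen Ω) (hne : Ωᶜ.Nonempty) (him : ∀ e ∈ Ωᶜ, e.im = 0)
    (hG : ∃ t : ℝ, (t : ℂ) ∈ Ω) {K : ℝ} (hK : 0 ≤ K)
    (hgate : ∀ t : ℝ, (t : ℂ) ∈ Ω → ∀ r > 0, ∃ t' : ℝ, |t' - t| ≤ K * r ∧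
      r ≤ infDist (t' : ℂ) Ωᶜ) {x y : ℂ} (hx : x ∈ Ω) (hy : y ∈ Ω) (hxi : 0 ≤ x.im)
    (hyi : y.im < 0) :
    Joinable Ω (qhDensity Ω) x y (2 * Real.log (1 + crossDist Ω x y / infDist x Ωᶜ) +
      2 * Real.log (1 + crossDist Ω x y / infDist y Ωᶜ) + (8 * Real.log (3 + K) + 4)) := by
  have hxy : x ≠ y := by
    rintro rfl
    exact absurd hxi (not_le.2 hyi)
  have hd : 0 < crossDist Ω x y :=
    (norm_pos_iff.2 (sub_ne_zero.2 hxy)).trans_le (norm_sub_le_crossDist hG x y)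
  set D := crossDist Ω x y with hD
  obtain ⟨t₀, ht₀⟩ := hG
  obtain ⟨_, ⟨t, ht, rfl⟩, hlt⟩ := exists_lt_of_csInf_lt (s := (fun t : ℝ =>
    ‖x - t‖ + ‖(t : ℂ) - y‖) '' {t : ℝ | (t : ℂ) ∈ Ω}) ⟨_, t₀, ht₀, rfl⟩
    (show _ < 2 * D by rw [hD] at hd ⊢; unfold crossDist at hd ⊢; linarith)
  obtain ⟨t', htt', hr⟩ := hgate t ht D hd
  have ht'Ω : (t' : ℂ) ∈ Ω := mem_of_infDist_compl_pos (hd.trans_le hr)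
  have hnorm : ‖(t : ℂ) - t'‖ ≤ K * D := by
    rw [← ofReal_sub, norm_real, Real.norm_eq_abs, abs_sub_comm]
    exact htt'
  simp only at hlt
  have hlog : ∀ z ∈ Ω, ‖z - t'‖ ≤ (2 + K) * D →
      2 * Real.log (1 + ‖z - t'‖ / infDist z Ωᶜ) +
        2 * Real.log (1 + ‖z - t'‖ / infDist (t' : ℂ) Ωᶜ) + 2 ≤
      2 * Real.log (1 + D / infDist z Ωᶜ) + (4 * Real.log (3 + K) + 2) := by
    intro z hz hzle
    have hp := infDist_compl_pos ho hne hz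
    have hp' := infDist_compl_pos ho hne ht'Ω
    have e1 : Real.log (1 + ‖z - t'‖ / infDist z Ωᶜ) ≤
        Real.log (3 + K) + Real.log (1 + D / infDist z Ωᶜ) := by
      rw [← Real.log_mul (by positivity) (by positivity)]
      apply Real.log_le_log (by positivity)
      have : ‖z - t'‖ / infDist z Ωᶜ ≤ (2 + K) * (D / infDist z Ωᶜ) := by
        rw [← mul_div_assoc]
        gcongr
      have : 0 ≤ D / infDist z Ωᶜ := by positivity
      nlinarith
    have e2 : Real.log (1 + ‖z - t'‖ / infDist (t' : ℂ) Ωᶜ) ≤ Real.log (3 + K) := by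
      apply Real.log_le_log (by positivity)
      have : ‖z - t'‖ / infDist (t' : ℂ) Ωᶜ ≤ 2 + K := by
        rw [div_le_iff₀ hp']
        nlinarith
      linarith
    linarith
  have hx1 : ‖x - t'‖ ≤ (2 + K) * D := by
    linarith [norm_sub_le_norm_sub_add_norm_sub x t t', norm_nonneg ((t : ℂ) - y)]
  have hy1 : ‖y - t'‖ ≤ (2 + K) * D := by
    have := norm_sub_le_norm_sub_add_norm_sub y t t'
    rw [norm_sub_rev y t] at this
    linarith [norm_nonneg (x - t)]
  have j1 := joinable_same_side ho hne him hx ht'Ω (σ := 1) (by simp) (by simpa) (by simp)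
  have j2 := joinable_same_side ho hne him hy ht'Ω (σ := -1) (by simp) (by simpa using hyi.le)
    (by simp)
  refine (j1.trans (continuousOn_qhDensity ho hne) j2.symm).mono ?_
  linarith [hlog x hx hx1, hlog y hy hy1]

theorem joinable_innerDist (ho : IsOpen Ω) (hne : Ωᶜ.Nonempty) (him : ∀ e ∈ Ωᶜ, e.im = 0)
    (hG : ∃ t : ℝ, (t : ℂ) ∈ Ω) {K : ℝ} (hK : 0 ≤ K)
    (hgate : ∀ t : ℝ, (t : ℂ) ∈ Ω → ∀ r > 0, ∃ t' : ℝ, |t' - t| ≤ K * r ∧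
      r ≤ infDist (t' : ℂ) Ωᶜ) {x y : ℂ} (hx : x ∈ Ω) (hy : y ∈ Ω) :
    Joinable Ω (qhDensity Ω) x y (2 * Real.log (1 + innerDist Ω x y / infDist x Ωᶜ) +
      2 * Real.log (1 + innerDist Ω x y / infDist y Ωᶜ) + (8 * Real.log (3 + K) + 4)) := by
  have hlog : 0 ≤ Real.log (3 + K) := Real.log_nonneg (by linarith)
  unfold innerDist
  split_ifs with h
  · by_cases hxi : 0 ≤ x.im
    · exact (joinable_same_side ho hne him hx hy (σ := 1) (by simp) (by simpa)
        (by simpa using h.1 hxi)).mono (by linarith)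
    · have hyi : ¬ 0 ≤ y.im := fun h' => hxi (h.2 h')
      push Not at hxi hyi
      exact (joinable_same_side ho hne him hx hy (σ := -1) (by simp) (by simpa using hxi.le)
        (by simpa using hyi.le)).mono (by linarith)
  · by_cases hxi : 0 ≤ x.im
    · have hyi : ¬ 0 ≤ y.im := by tauto
      exact joinable_opposite ho hne him hG hK hgate hx hy hxi (not_le.1 hyi)
    · have hyi : 0 ≤ y.im := by tauto
      have := (joinable_opposite ho hne him hG hK hgate hy hx hyi (not_le.1 hxi)).symm
      rw [crossDist_comm] at this
      exact this.mono (by linarith)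

/-- The quasihyperbolic distance of the complement of a closed subset of the real line with
relatively large gates is comparable with the logarithm of the inner distance. -/
theorem isLogComparable_qhDist (ho : IsOpen Ω) (hne : Ωᶜ.Nonempty) (him : ∀ e ∈ Ωᶜ, e.im = 0)
    (hG : ∃ t : ℝ, (t : ℂ) ∈ Ω) {K : ℝ} (hK : 0 ≤ K)
    (hgate : ∀ t : ℝ, (t : ℂ) ∈ Ω → ∀ r > 0, ∃ t' : ℝ, |t' - t| ≤ K * r ∧
      r ≤ infDist (t' : ℂ) Ωᶜ) :
    IsLogComparable Ω (qhDist Ω) (innerDist Ω) (fun z => infDist z Ωᶜ)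
      (8 * Real.log (3 + K) + 4) where
  pos x hx := infDist_compl_pos ho hne hx
  self x _ := innerDist_self x
  symm x _ y _ := innerDist_comm x y
  tri x _ y _ z _ := innerDist_triangle hG x y z
  lip x _ y _ := by
    have h1 := infDist_le_infDist_add_dist (s := Ωᶜ) (x := y) (y := x)
    rw [dist_eq_norm, norm_sub_rev] at h1
    linarith [norm_sub_le_innerDist hG x y]
  lower x hx y hy := by
    have hp := infDist_compl_pos ho hne hx
    have hd : 0 ≤ innerDist Ω x y := (norm_nonneg _).trans (norm_sub_le_innerDist hG x y)
    have hq : 0 < (infDist x Ωᶜ + innerDist Ω x y) / infDist x Ωᶜ := by positivity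
    suffices h : Real.log ((infDist x Ωᶜ + innerDist Ω x y) / infDist x Ωᶜ) ≤ qhDist Ω x y by
      rw [Real.log_le_iff_le_exp hq, div_le_iff₀ hp] at h
      linarith
    obtain ⟨γ₀, hγ₀⟩ := joinable_innerDist ho hne him hG hK hgate hx hy
    refine le_csInf ⟨_, γ₀, hγ₀.contDiff.contDiffOn, hγ₀.source 0 le_rfl, hγ₀.target 1 le_rfl,
      fun t _ => hγ₀.mem t, rfl⟩ ?_
    rintro _ ⟨γ, hγ, rfl, rfl, hmem, rfl⟩
    obtain ⟨L, hL, hLt⟩ := exists_length_le_qh ho hne hγ hmem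
    have := innerDist_le_of_curve hγ.continuousOn hmem hLt
    rw [Real.log_le_iff_le_exp hq, div_le_iff₀ hp]
    linarith
  upper x hx y hy :=
    densityDist_le_of_joinable (qhDensity_nonneg Ω) (joinable_innerDist ho hne him hG hK hgate hx hy)

end SlitPlane

theorem IsDenjoyDomain.im_eq_zero_of_notMem {Ω : Set ℂ} (hΩ : IsDenjoyDomain Ω) {t : ℝ}
    (ht : (t : ℂ) ∈ Ω) {e : ℂ} (he : e ∉ Ω) : e.im = 0 := by
  obtain ⟨ho, -, hfr⟩ := hΩ
  obtain ⟨ε, hε, hball⟩ := Metric.isOpen_iff.1 ho t ht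
  have key : ∀ U : Set ℂ, IsPreconnected U → (∀ z ∈ U, z.im ≠ 0) → e ∈ U →
      ∀ u : ℝ, |u| = 1 → (t + (u * (ε / 2) : ℝ) * I : ℂ) ∉ U := by
    intro U hU him heU u hu hmem
    have hcover : U ⊆ Ω ∪ (closure Ω)ᶜ := fun z hz => by
      by_contra h
      rw [mem_union, not_or, notMem_compl_iff] at h
      exact him z hz (hfr ⟨h.2, fun h' => h.1 (interior_subset h')⟩)
    exact he (hU.subset_left_of_subset_union ho isClosed_closure.isOpen_compl
      (disjoint_compl_right_iff_subset.2 subset_closure) hcover ⟨_, hmem, hball (by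
      rw [mem_ball, dist_eq_norm, add_sub_cancel_left, norm_mul, norm_I, mul_one, norm_real,
        Real.norm_eq_abs, abs_mul, hu, one_mul, abs_of_pos (by positivity)]
      linarith)⟩ heU)
  rcases lt_trichotomy e.im 0 with h | h | h
  · refine absurd ?_ (key {z | z.im < 0} (convex_halfSpace_im_lt 0).isPreconnected
      (fun z hz => ne_of_lt hz) h (-1) (by simp))
    simpa using hε
  · exact h
  · refine absurd ?_ (key {z | 0 < z.im} (convex_halfSpace_im_gt 0).isPreconnected
      (fun z hz => ne_of_gt hz) h 1 (by simp))
    simpa using hε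

theorem exists_pos_forall_le_of_eventually {u : ℕ → ℝ} (hu : ∀ n, 0 < u n)
    (h : ∃ c > 0, ∀ᶠ n in atTop, c ≤ u n) : ∃ c > 0, ∀ n, c ≤ u n := by
  obtain ⟨c, hc, h⟩ := h
  obtain ⟨N, hN⟩ := eventually_atTop.1 h
  induction N generalizing c with
  | zero => exact ⟨c, hc, fun n => hN n n.zero_le⟩
  | succ N ih =>
    have hmin : ∀ n ≥ N, min c (u N) ≤ u n := fun n hn => by
      rcases hn.eq_or_lt with rfl | hlt
      · exact min_le_right _ _
      · exact (min_le_left _ _).trans (hN n hlt)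
    exact ih _ (lt_min hc (hu N)) (eventually_atTop.2 ⟨N, hmin⟩) hmin

/-- Near any real point of the domain there is, at every scale `r`, a real point at distance at
least `r` from the complement. -/
theorem exists_gate {Ω : Set ℂ} {a b : ℕ → ℝ} (hne : Ωᶜ.Nonempty) (him : ∀ e ∈ Ωᶜ, e.im = 0)
    (hapos : ∀ n, 0 < a n) (hre : (fun x : ℝ => (x : ℂ)) ⁻¹' Ω = Iio 0 ∪ ⋃ n, Ioo (a n) (b n))
    {c : ℝ} (hc : 0 < c) (hcab : ∀ n, c ≤ (b n - a n) / a n) {t : ℝ} (ht : (t : ℂ) ∈ Ω) {r : ℝ}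
    (hr : 0 < r) : ∃ t' : ℝ, |t' - t| ≤ (3 + 2 / c) * r ∧ r ≤ infDist (t' : ℂ) Ωᶜ := by
  have hmem : ∀ s : ℝ, (s : ℂ) ∈ Ω ↔ s < 0 ∨ ∃ n, s ∈ Ioo (a n) (b n) := fun s => by
    have : s ∈ (fun x : ℝ => (x : ℂ)) ⁻¹' Ω ↔ s ∈ Iio 0 ∪ ⋃ n, Ioo (a n) (b n) := by rw [hre]
    simpa using this
  have hfar : ∀ s : ℝ, (∀ u : ℝ, |s - u| < r → (u : ℂ) ∈ Ω) → r ≤ infDist (s : ℂ) Ωᶜ := by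
    intro s hs
    rw [le_infDist hne]
    intro e he
    have hee : ((e.re : ℝ) : ℂ) = e := Complex.ext (by simp) (by simp [him e he])
    by_contra! hlt
    rw [← hee, dist_eq_norm, ← ofReal_sub, norm_real, Real.norm_eq_abs] at hlt
    have := hs _ hlt
    rw [hee] at this
    exact he this
  have hneg : ∀ s : ℝ, s ≤ -r → r ≤ infDist (s : ℂ) Ωᶜ := fun s hs => hfar s fun u hu =>
    (hmem u).2 (Or.inl (by linarith [(abs_lt.1 hu).1]))
  have hcr : 0 < 2 / c * r := by positivity
  rcases (hmem t).1 ht with h | ⟨n, hn⟩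
  · refine ⟨t - r, ?_, hneg _ (by linarith)⟩
    rw [sub_sub_cancel_left, abs_neg, abs_of_pos hr]
    linarith
  · have hcn := hcab n
    rw [le_div_iff₀ (hapos n)] at hcn
    rcases le_or_gt r ((b n - a n) / 2) with hle | hlt
    · have hin : ∀ s : ℝ, a n + r ≤ s → s ≤ b n - r → r ≤ infDist (s : ℂ) Ωᶜ :=
        fun s h1 h2 => hfar s fun u hu => (hmem u).2 (Or.inr ⟨n, by
          constructor <;> linarith [(abs_lt.1 hu).1, (abs_lt.1 hu).2]⟩)
      refine ⟨max (a n + r) (min t (b n - r)), ?_, hin _ (le_max_left _ _)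
        (max_le (by linarith) (min_le_right _ _))⟩
      have h1 : max (a n + r) (min t (b n - r)) ≤ t + r :=
        max_le (by linarith [hn.1]) ((min_le_left _ _).trans (by linarith))
      have h2 : t - r ≤ max (a n + r) (min t (b n - r)) :=
        le_max_of_le_right (le_min (by linarith) (by linarith [hn.2]))
      rw [abs_le]
      constructor <;> linarith
    · refine ⟨-r, ?_, hneg _ le_rfl⟩
      have han : a n ≤ 2 / c * r := by
        rw [div_mul_eq_mul_div, le_div_iff₀ hc]
        linarith
      have hapn := hapos n
      rw [abs_le]
      constructor <;> linarith [hn.1, hn.2]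

/-- Theorem 1.1(1), quasihyperbolic case: if `liminf (bₙ - aₙ)/aₙ > 0` then `(Ω, k_Ω)` is
Gromov hyperbolic. -/
theorem denjoy_qh_hyperbolic_of_liminf_pos
    (Ω : Set ℂ) (a b : ℕ → ℝ)
    (hΩ : IsDenjoyDomain Ω)
    (hapos : ∀ n, 0 < a n)
    (hab : ∀ n, a n < b n)
    (hba : ∀ n, b n ≤ a (n + 1))
    (hlim : Filter.Tendsto a Filter.atTop Filter.atTop)
    (hre : (fun x : ℝ => (x : ℂ)) ⁻¹' Ω = Iio 0 ∪ ⋃ n, Ioo (a n) (b n))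
    (hliminf : ∃ c > 0, ∀ᶠ n in Filter.atTop, c ≤ (b n - a n) / a n) :
    IsGromovHyperbolic Ω (qhDist Ω) := by
  obtain ⟨c, hc, hcab⟩ := exists_pos_forall_le_of_eventually
    (fun n => div_pos (sub_pos.2 (hab n)) (hapos n)) hliminf
  have hG : ((-1 : ℝ) : ℂ) ∈ Ω := by
    have : (-1 : ℝ) ∈ (fun x : ℝ => (x : ℂ)) ⁻¹' Ω := by
      rw [hre]
      exact Or.inl (by simp)
    exact this
  have h0 : ((0 : ℝ) : ℂ) ∈ Ωᶜ := by
    intro h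
    have h' : (0 : ℝ) ∈ (fun x : ℝ => (x : ℂ)) ⁻¹' Ω := h
    rw [hre] at h'
    rcases h' with h' | h'
    · exact lt_irrefl (0:ℝ) h'
    · obtain ⟨n, hn⟩ := mem_iUnion.1 h'
      exact lt_asymm hn.1 (hapos n)
  have him : ∀ e ∈ Ωᶜ, e.im = 0 := fun e he => hΩ.im_eq_zero_of_notMem hG he
  have hK : 0 ≤ 3 + 2 / c := by positivity
  have hlog : 0 ≤ Real.log (3 + (3 + 2 / c)) := Real.log_nonneg (by linarith)
  exact (isLogComparable_qhDist hΩ.1 ⟨_, h0⟩ him ⟨_, hG⟩ hK fun t ht r hr =>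
    exists_gate ⟨_, h0⟩ him hapos hre hc hcab ht hr).isGromovHyperbolic (by positivity)

end
end

section
/- Let Ω ⊆ ℂ be a Denjoy domain with Ω ∩ ℝ = (−∞, 0) ∪ ⋃_{n=1}^∞ (a_n, b_n), where 0 < a_n < b_n ≤ a_{n+1} for every n ≥ 1 and lim_{n→∞} a_n = ∞. If liminf_{n→∞} (b_n − a_n)/a_n > 0, then the metric space (Ω, h_Ω) with the Poincaré metric is Gromov hyperbolic. -/
open Set Metric Filter Complex

/-- The four-point form of Gromov hyperbolicity on a set, as a dichotomy. -/
def FourPointOn {α : Type*} (S : Set α) (d : α → α → ℝ) (k : ℝ) : Prop :=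
  ∀ x ∈ S, ∀ y ∈ S, ∀ z ∈ S, ∀ w ∈ S,
    d x y + d z w ≤ d x z + d y w + k ∨ d x y + d z w ≤ d x w + d y z + k

theorem FourPointOn.thin {α : Type*} {S : Set α} {d : α → α → ℝ} {k : ℝ}
    (h4 : FourPointOn S d k) (hsymm : ∀ x ∈ S, ∀ y ∈ S, d x y = d y x)
    {x y z : α} (hx : x ∈ S) (hy : y ∈ S) (hz : z ∈ S) {w p : α} (hw : w ∈ S) (hp : p ∈ S)
    {t : ℝ} (hxw : d x w = t) (hwy : d w y = d x y - t) (hxp : d x p = t)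
    (hpz : d p z = d x z - t) (ht : 2 * t ≤ d x y + d x z - d y z) (hk : 0 ≤ k) :
    d w p ≤ 2 * k := by
  have e1 := hsymm x hx w hw
  have e2 := hsymm p hp y hy
  have e3 := hsymm x hx p hp
  have e4 := hsymm x hx y hy
  have e5 := hsymm z hz y hy
  have hpy : d p y ≤ d x y - t + k := by
    rcases h4 p hp y hy x hx z hz with h | h <;> linarith [hsymm z hz y hy, hsymm p hp x hx]
  rcases h4 w hw p hp x hx y hy with h | h <;> linarith [hsymm w hw x hx, hsymm p hp x hx]

theorem FourPointOn.isGromovHyperbolic {α : Type*} {S : Set α} {d : α → α → ℝ} {k : ℝ}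
    (h4 : FourPointOn S d k) (hk : 0 ≤ k) (hsymm : ∀ x ∈ S, ∀ y ∈ S, d x y = d y x)
    (htri : ∀ x ∈ S, ∀ y ∈ S, ∀ z ∈ S, d x z ≤ d x y + d y z) :
    IsGromovHyperbolic S d := by
  refine ⟨2 * k, by linarith, ?_⟩
  rintro x hx y hy z hz gxy gxz gzy ⟨a1, a2, a3, a4⟩ ⟨b1, b2, b3, b4⟩ ⟨c1, c2, c3, c4⟩ t ht
  have hxy0 : 0 ≤ d x y := ht.1.trans ht.2
  have hw := a3 t ht
  have hxw : d x (gxy t) = t := by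
    have := a4 0 ⟨le_rfl, hxy0⟩ t ht
    rwa [a1, zero_sub, abs_neg, abs_of_nonneg ht.1] at this
  have hwy : d (gxy t) y = d x y - t := by
    have := a4 t ht (d x y) ⟨hxy0, le_rfl⟩
    rwa [a2, abs_sub_comm, abs_of_nonneg (by linarith [ht.2])] at this
  have h1 := htri x hx z hz y hy
  have h2 := htri y hy x hx z hz
  have h3 := htri x hx y hy z hz
  rw [hsymm y hy x hx] at h2
  have e5 := hsymm z hz y hy
  rcases le_total (2 * t) (d x y + d x z - d y z) with hc | hc
  · have ht' : t ∈ Icc (0:ℝ) (d x z) := ⟨ht.1, by linarith⟩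
    refine ⟨gxz t, Or.inl ⟨t, ht', rfl⟩, ?_⟩
    have hz0 : 0 ≤ d x z := ht'.1.trans ht'.2
    refine h4.thin hsymm hx hy hz hw (b3 t ht') hxw hwy ?_ ?_ hc hk
    · have := b4 0 ⟨le_rfl, hz0⟩ t ht'
      rwa [b1, zero_sub, abs_neg, abs_of_nonneg ht.1] at this
    · have := b4 t ht' (d x z) ⟨hz0, le_rfl⟩
      rwa [b2, abs_sub_comm, abs_of_nonneg (by linarith [ht'.2])] at this
  · set r := d z y - (d x y - t) with hr
    have hr' : r ∈ Icc (0:ℝ) (d z y) := ⟨by linarith, by linarith [ht.2]⟩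
    refine ⟨gzy r, Or.inr ⟨r, hr', rfl⟩, ?_⟩
    have hz0 : 0 ≤ d z y := hr'.1.trans hr'.2
    have hp := c3 r hr'
    refine h4.thin (t := d x y - t) hsymm hy hx hz hw hp ?_ ?_ ?_ ?_ ?_ hk
    · rw [hsymm y hy _ hw, hwy]
    · rw [hsymm _ hw x hx, hxw, hsymm y hy x hx]; ring
    · rw [hsymm y hy _ hp]
      have := c4 r hr' (d z y) ⟨hz0, le_rfl⟩
      rw [c2, abs_sub_comm, abs_of_nonneg (by linarith [hr'.2])] at this
      rw [this]; ring
    · have := c4 0 ⟨le_rfl, hz0⟩ r hr'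
      rw [c1, zero_sub, abs_neg, abs_of_nonneg hr'.1] at this
      rw [hsymm _ hp z hz, this, ← e5]
    · rw [hsymm y hy x hx]; linarith

/-- The distance on the double of `X`: points on the same sheet have distance `δ`, points on
different sheets have distance `D`. -/
def doubleDist {X : Type*} (δ D : X → X → ℝ) (x y : Bool × X) : ℝ :=
  if x.1 = y.1 then δ x.2 y.2 else D x.2 y.2

/-- A hyperbolic space doubled along a quasiconvex subset `G` is hyperbolic. Here `n` is a nearly
nearest-point projection to `G`, and `D` is the distance between opposite sheets. -/
theorem fourPointOn_doubleDist {X : Type*} {δ D : X → X → ℝ} {G : Set X} {n : X → X} {k c : ℝ}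
    (hk : 0 ≤ k) (hc : 0 ≤ c)
    (hsymm : ∀ x y, δ x y = δ y x)
    (htri : ∀ x y z, δ x z ≤ δ x y + δ y z) (h4 : FourPointOn univ δ k)
    (hnG : ∀ x, n x ∈ G) (hn : ∀ x, ∀ m ∈ G, δ x (n x) ≤ δ x m + 1)
    (hqc : ∀ q ∈ G, ∀ q' ∈ G, ∀ x, 2 * δ x (n x) ≤ δ x q + δ x q' - δ q q' + c)
    (hD : ∀ x y, ∀ q ∈ G, D x y ≤ δ x q + δ q y)
    (hD' : ∀ x y, ∃ q ∈ G, δ x q + δ q y ≤ D x y + 1) :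
    FourPointOn univ (doubleDist δ D) (10 * (k + c + 3)) := by
  have P : ∀ x, ∀ q ∈ G, δ x (n x) + δ (n x) q ≤ δ x q + c := fun x q hq => by
    linarith [hqc (n x) (hnG x) q hq x]
  have K2 : ∀ x y, 2 * δ (n x) (n y) ≤ k + 2 * c ∨
      δ x (n x) + δ (n x) (n y) + δ (n y) y ≤ δ x y + k + 2 * c := fun x y => by
    have p1 := P x (n y) (hnG y)
    have p2 := P y (n x) (hnG x)
    have s1 := hsymm (n y) (n x)
    have s2 := hsymm (n y) y
    have s3 := hsymm (n x) x
    have s4 := hsymm (n x) y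
    rcases h4 x trivial (n y) trivial y trivial (n x) trivial with h | h
    · exact Or.inr (by linarith [hsymm (n y) (n x)])
    · exact Or.inl (by linarith)
  have dD : ∀ x y, δ x y ≤ D x y + 1 := fun x y => by
    obtain ⟨q, _, h⟩ := hD' x y
    linarith [htri x q y]
  have uD : ∀ x y, δ x (n x) + δ y (n y) ≤ D x y + 3 := fun x y => by
    obtain ⟨q, hq, h⟩ := hD' x y
    linarith [hn x q hq, hn y q hq, hsymm q y]
  have K3 : ∀ x y, δ x (n y) + δ (n y) y ≤ D x y + (k + 2 * c + 3) := fun x y => by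
    have t := htri x (n x) (n y)
    rcases K2 x y with h | h
    · linarith [uD x y, hsymm (n y) y]
    · linarith [dD x y]
  have Dsymm : ∀ x y, D x y ≤ D y x + 1 := fun x y => by
    obtain ⟨q, hq, h⟩ := hD' y x
    linarith [hD x y q hq, hsymm q y, hsymm x q]
  have K4 : ∀ x y, δ (n x) y + δ x (n x) ≤ D x y + (k + 2 * c + 4) := fun x y => by
    linarith [K3 y x, Dsymm y x, hsymm (n x) x, hsymm y (n x)]
  have D4 : ∀ x y, D x y ≤ δ (n x) y + δ x (n x) := fun x y => by
    linarith [hD x y (n x) (hnG x)]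
  have D3 : ∀ x y, D x y ≤ δ x (n y) + δ (n y) y := fun x y => hD x y (n y) (hnG y)
  -- opposite pairs `{x, y}` and `{z, w}` on different sheets
  have mixed : ∀ x y z w, D x z + D y w ≤ δ x y + δ z w + 6 * (k + c + 3) ∨
      D x z + D y w ≤ D x w + D y z + 6 * (k + c + 3) := fun x y z w => by
    have a1 := D3 x z
    have a2 := D3 y w
    have b1 := K3 x w
    have b2 := K3 y z
    rcases K2 z w with hzw | hzw
    · right
      have := htri x (n w) (n z)
      have := htri y (n z) (n w)
      have := hsymm (n w) (n z)
      linarith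
    · rcases h4 x trivial (n z) trivial y trivial (n w) trivial with h | h
      · left; linarith [hsymm (n z) z]
      · right; linarith [hsymm (n z) y]
  rintro ⟨i, x⟩ - ⟨j, y⟩ - ⟨l, z⟩ - ⟨m, w⟩ -
  have A4 : ∀ x y z w, δ x y + δ z w ≤ δ x z + δ y w + k ∨ δ x y + δ z w ≤ δ x w + δ y z + k :=
    fun x y z w => h4 x trivial y trivial z trivial w trivial
  have side : i = j ∧ j = l ∧ l = m ∨ i = !j ∧ j = l ∧ l = m ∨ j = !i ∧ i = l ∧ l = m ∨
      l = !i ∧ i = j ∧ j = m ∨ m = !i ∧ i = j ∧ j = l ∨ i = j ∧ l = !i ∧ m = !i ∨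
      i = l ∧ j = !i ∧ m = !i ∨ i = m ∧ j = !i ∧ l = !i := by
    revert i j l m; decide
  rcases side with ⟨rfl, rfl, rfl⟩ | ⟨rfl, rfl, rfl⟩ | ⟨rfl, rfl, rfl⟩ | ⟨rfl, rfl, rfl⟩ |
    ⟨rfl, rfl, rfl⟩ | ⟨rfl, rfl, rfl⟩ | ⟨rfl, rfl, rfl⟩ | ⟨rfl, rfl, rfl⟩ <;>
    simp only [doubleDist, if_true, Bool.not_eq_self, Bool.eq_not_self, if_false]
  · rcases A4 x y z w with h | h
    · left; linarith
    · right; linarith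
  · rcases A4 (n x) y z w with h | h
    · left; linarith [K4 x z, D4 x y]
    · right; linarith [K4 x w, D4 x y]
  · rcases A4 x (n y) z w with h | h
    · left; linarith [K4 y w, D3 x y, hsymm y (n y)]
    · right; linarith [K4 y z, D3 x y, hsymm y (n y)]
  · rcases A4 x y (n z) w with h | h
    · left; linarith [K3 x z, D4 z w, hsymm z (n z)]
    · right; linarith [K3 y z, D4 z w, hsymm z (n z)]
  · rcases A4 x y z (n w) with h | h
    · left; linarith [K3 y w, D3 z w]
    · right; linarith [K3 x w, D3 z w]
  · rcases A4 x y z w with h | h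
    · left; linarith [dD x z, dD y w]
    · right; linarith [dD x w, dD y z]
  · rcases mixed x z y w with h | h
    · left; linarith
    · right; linarith [Dsymm z y]
  · rcases mixed x w y z with h | h
    · right; linarith [hsymm x w, Dsymm w z, Dsymm z w]
    · left; linarith [Dsymm w y, Dsymm z w]

open scoped ComplexConjugate

noncomputable section

/-- The automorphism of the unit disk taking `0` to `a`. -/
def moebius (a z : ℂ) : ℂ := (z + a) / (1 + conj a * z)

/-- The Poincaré distance of the unit disk. -/
def diskDist (z w : ℂ) : ℝ :=
  2 * Real.arsinh (‖z - w‖ / (√(1 - ‖z‖ ^ 2) * √(1 - ‖w‖ ^ 2)))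

theorem one_sub_sq_norm_pos {z : ℂ} (hz : z ∈ ball (0 : ℂ) 1) : 0 < 1 - ‖z‖ ^ 2 := by
  rw [mem_ball_zero_iff] at hz
  nlinarith [norm_nonneg z]

theorem moebius_denom_ne_zero {a z : ℂ} (ha : a ∈ ball (0 : ℂ) 1) (hz : z ∈ ball (0 : ℂ) 1) :
    1 + conj a * z ≠ 0 := by
  rw [mem_ball_zero_iff] at ha hz
  intro h
  have h1 : ‖conj a * z‖ = 1 := by
    rw [eq_neg_of_add_eq_zero_right h]; simp
  rw [norm_mul, RCLike.norm_conj] at h1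
  nlinarith [norm_nonneg a, norm_nonneg z]

theorem sq_norm_one_add_sub (a z : ℂ) :
    ‖1 + conj a * z‖ ^ 2 - ‖z + a‖ ^ 2 = (1 - ‖a‖ ^ 2) * (1 - ‖z‖ ^ 2) := by
  simp only [← Complex.normSq_eq_norm_sq, Complex.normSq_apply]
  simp
  ring

theorem one_sub_sq_norm_moebius {a z : ℂ} (ha : a ∈ ball (0 : ℂ) 1) (hz : z ∈ ball (0 : ℂ) 1) :
    1 - ‖moebius a z‖ ^ 2 = (1 - ‖a‖ ^ 2) * (1 - ‖z‖ ^ 2) / ‖1 + conj a * z‖ ^ 2 := by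
  have h : ‖1 + conj a * z‖ ≠ 0 := norm_ne_zero_iff.2 (moebius_denom_ne_zero ha hz)
  rw [← sq_norm_one_add_sub, moebius, norm_div, div_pow, sub_div,
    div_self (pow_ne_zero 2 h)]

theorem moebius_mem_ball {a z : ℂ} (ha : a ∈ ball (0 : ℂ) 1) (hz : z ∈ ball (0 : ℂ) 1) :
    moebius a z ∈ ball (0 : ℂ) 1 := by
  have h := one_sub_sq_norm_moebius ha hz
  have h1 : 0 < 1 - ‖moebius a z‖ ^ 2 := by
    rw [h]
    have := norm_pos_iff.2 (moebius_denom_ne_zero ha hz)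
    have := one_sub_sq_norm_pos ha
    have := one_sub_sq_norm_pos hz
    positivity
  rw [mem_ball_zero_iff]
  nlinarith [norm_nonneg (moebius a z)]

theorem neg_mem_unitBall {a : ℂ} (ha : a ∈ ball (0 : ℂ) 1) : -a ∈ ball (0 : ℂ) 1 := by
  simpa using ha

theorem one_sub_conj_mul_ne_zero {a : ℂ} (ha : a ∈ ball (0 : ℂ) 1) : 1 - conj a * a ≠ 0 := by
  have := moebius_denom_ne_zero (neg_mem_unitBall ha) ha
  simpa [sub_eq_add_neg] using this

theorem moebius_neg_moebius {a z : ℂ} (ha : a ∈ ball (0 : ℂ) 1) (hz : z ∈ ball (0 : ℂ) 1) :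
    moebius (-a) (moebius a z) = z := by
  have h := moebius_denom_ne_zero ha hz
  have h2 := one_sub_conj_mul_ne_zero ha
  have h3 : moebius (-a) (moebius a z) =
      (z * (1 - conj a * a)) / (1 - conj a * a) := by
    unfold moebius
    have h5 : 1 + z * conj a ≠ 0 := by rwa [mul_comm z]
    have h6 : 1 - a * conj a ≠ 0 := by rwa [mul_comm a]
    have h4 : 1 + conj (-a) * ((z + a) / (1 + conj a * z)) =
      (1 - conj a * a) / (1 + conj a * z) := by
      rw [map_neg]; field_simp; ring
    rw [h4]
    field_simp
    ring
  rw [h3, mul_div_cancel_right₀ _ h2]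

theorem moebius_moebius_neg {a z : ℂ} (ha : a ∈ ball (0 : ℂ) 1) (hz : z ∈ ball (0 : ℂ) 1) :
    moebius a (moebius (-a) z) = z := by
  simpa using moebius_neg_moebius (neg_mem_unitBall ha) hz

theorem moebius_zero (a : ℂ) : moebius a 0 = a := by simp [moebius]

theorem moebius_neg_self (a : ℂ) : moebius (-a) a = 0 := by simp [moebius]

theorem moebius_sub_moebius {a z w : ℂ} (ha : a ∈ ball (0 : ℂ) 1) (hz : z ∈ ball (0 : ℂ) 1)
    (hw : w ∈ ball (0 : ℂ) 1) :
    moebius a z - moebius a w =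
      (1 - conj a * a) * (z - w) / ((1 + conj a * z) * (1 + conj a * w)) := by
  have h := moebius_denom_ne_zero ha hz
  have h' := moebius_denom_ne_zero ha hw
  unfold moebius
  rw [div_sub_div _ _ h h']
  congr 1
  ring

theorem norm_one_sub_conj_mul {a : ℂ} (ha : a ∈ ball (0 : ℂ) 1) :
    ‖1 - conj a * a‖ = 1 - ‖a‖ ^ 2 := by
  have : (1 - conj a * a : ℂ) = ((1 - ‖a‖ ^ 2 : ℝ) : ℂ) := by
    rw [mul_comm, Complex.mul_conj, Complex.normSq_eq_norm_sq]; push_cast; ring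
  rw [this, Complex.norm_real, Real.norm_of_nonneg (one_sub_sq_norm_pos ha).le]

theorem diskDist_moebius {a z w : ℂ} (ha : a ∈ ball (0 : ℂ) 1) (hz : z ∈ ball (0 : ℂ) 1)
    (hw : w ∈ ball (0 : ℂ) 1) : diskDist (moebius a z) (moebius a w) = diskDist z w := by
  have hA := one_sub_sq_norm_pos ha
  have hZ := norm_pos_iff.2 (moebius_denom_ne_zero ha hz)
  have hW := norm_pos_iff.2 (moebius_denom_ne_zero ha hw)
  have hz' := Real.sqrt_pos.2 (one_sub_sq_norm_pos hz)
  have hw' := Real.sqrt_pos.2 (one_sub_sq_norm_pos hw)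
  unfold diskDist
  rw [one_sub_sq_norm_moebius ha hz, one_sub_sq_norm_moebius ha hw, moebius_sub_moebius ha hz hw,
    Real.sqrt_div (mul_nonneg hA.le (one_sub_sq_norm_pos hz).le),
    Real.sqrt_div (mul_nonneg hA.le (one_sub_sq_norm_pos hw).le),
    Real.sqrt_sq hZ.le, Real.sqrt_sq hW.le, Real.sqrt_mul hA.le, Real.sqrt_mul hA.le,
    norm_div, norm_mul, norm_mul, norm_one_sub_conj_mul ha]
  congr 2
  have hA' := Real.sqrt_pos.2 hA
  generalize ‖1 + conj a * z‖ = u at *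
  generalize ‖1 + conj a * w‖ = v at *
  nth_rewrite 1 [← Real.sq_sqrt hA.le]
  field_simp

theorem hasDerivAt_moebius {a z : ℂ} (ha : a ∈ ball (0 : ℂ) 1) (hz : z ∈ ball (0 : ℂ) 1) :
    HasDerivAt (moebius a) ((1 - conj a * a) / (1 + conj a * z) ^ 2) z := by
  have h := moebius_denom_ne_zero ha hz
  have h1 : HasDerivAt (fun z : ℂ => z + a) 1 z := (hasDerivAt_id z).add_const a
  have h2 : HasDerivAt (fun z : ℂ => 1 + conj a * z) (conj a) z := by
    simpa using ((hasDerivAt_id z).const_mul (conj a)).const_add 1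
  have h3 := h1.div h2 h
  rwa [show 1 * (1 + conj a * z) - (z + a) * conj a = 1 - conj a * a by ring] at h3

theorem diskDist_nonneg (z w : ℂ) : 0 ≤ diskDist z w := by
  unfold diskDist
  have : 0 ≤ Real.arsinh (‖z - w‖ / (√(1 - ‖z‖ ^ 2) * √(1 - ‖w‖ ^ 2))) :=
    Real.arsinh_nonneg_iff.2 (by positivity)
  positivity

theorem diskDist_comm (z w : ℂ) : diskDist z w = diskDist w z := by
  unfold diskDist
  rw [norm_sub_rev, mul_comm (√_)]

theorem sinh_half_diskDist (z w : ℂ) :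
    Real.sinh (diskDist z w / 2) = ‖z - w‖ / (√(1 - ‖z‖ ^ 2) * √(1 - ‖w‖ ^ 2)) := by
  rw [diskDist, mul_div_cancel_left₀ _ two_ne_zero, Real.sinh_arsinh]

theorem cosh_half_diskDist {z w : ℂ} (hz : z ∈ ball (0 : ℂ) 1) (hw : w ∈ ball (0 : ℂ) 1) :
    Real.cosh (diskDist z w / 2) = ‖1 - conj w * z‖ / (√(1 - ‖z‖ ^ 2) * √(1 - ‖w‖ ^ 2)) := by
  have hz' := one_sub_sq_norm_pos hz
  have hw' := one_sub_sq_norm_pos hw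
  rw [← abs_of_pos (Real.cosh_pos (diskDist z w / 2)), ← abs_of_nonneg
    (show 0 ≤ ‖1 - conj w * z‖ / (√(1 - ‖z‖ ^ 2) * √(1 - ‖w‖ ^ 2)) by positivity),
    ← sq_eq_sq_iff_abs_eq_abs, Real.cosh_sq, sinh_half_diskDist, div_pow, div_pow, mul_pow,
    Real.sq_sqrt hz'.le, Real.sq_sqrt hw'.le]
  have := sq_norm_one_add_sub (-w) z
  rw [map_neg, neg_mul, ← sub_eq_add_neg, ← sub_eq_add_neg, norm_neg] at this
  have h1 := mul_pos hz' hw'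
  rw [eq_div_iff h1.ne', add_mul, div_mul_cancel₀ _ h1.ne']
  linarith

theorem diskDist_zero_left_lt_aux {w : ℂ} (hw : w ∈ ball (0 : ℂ) 1) :
    Real.cosh (diskDist 0 w / 2) = 1 / √(1 - ‖w‖ ^ 2) ∧
    Real.sinh (diskDist 0 w / 2) = ‖w‖ / √(1 - ‖w‖ ^ 2) := by
  rw [cosh_half_diskDist (by simp) hw, sinh_half_diskDist]
  simp

theorem diskDist_zero_left {w : ℂ} (hw : w ∈ ball (0 : ℂ) 1) :
    diskDist 0 w = Real.log ((1 + ‖w‖) / (1 - ‖w‖)) := by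
  have hw' := one_sub_sq_norm_pos hw
  obtain ⟨h1, h2⟩ := diskDist_zero_left_lt_aux hw
  rw [mem_ball_zero_iff] at hw
  have h3 : Real.exp (diskDist 0 w / 2) = (1 + ‖w‖) / √(1 - ‖w‖ ^ 2) := by
    rw [← Real.cosh_add_sinh, h1, h2, add_div]
  have h4 : Real.exp (diskDist 0 w) = (1 + ‖w‖) / (1 - ‖w‖) := by
    rw [show diskDist 0 w = diskDist 0 w / 2 + diskDist 0 w / 2 by ring, Real.exp_add, h3,
      ← sq, div_pow, Real.sq_sqrt hw'.le]
    have : 1 - ‖w‖ ≠ 0 := by linarith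
    field_simp
    ring
  rw [← h4, Real.log_exp]

theorem half_diskDist_le_iff {z w : ℂ} {r : ℝ} : 
    diskDist z w ≤ r ↔ Real.sinh (diskDist z w / 2) ≤ Real.sinh (r / 2) := by
  rw [Real.sinh_le_sinh]
  constructor <;> intro h <;> linarith

theorem diskDist_zero_left_mono {z w : ℂ} (hw : w ∈ ball (0 : ℂ) 1) (h : ‖z‖ ≤ ‖w‖) :
    diskDist 0 z ≤ diskDist 0 w := by
  have hw' := one_sub_sq_norm_pos hw
  rw [half_diskDist_le_iff, sinh_half_diskDist, sinh_half_diskDist]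
  have : ‖z‖ ^ 2 ≤ ‖w‖ ^ 2 := by gcongr
  simp only [zero_sub, norm_neg, norm_zero]
  gcongr

theorem diskDist_le_add_zero {z w : ℂ} (hz : z ∈ ball (0 : ℂ) 1) (hw : w ∈ ball (0 : ℂ) 1) :
    diskDist z w ≤ diskDist z 0 + diskDist 0 w := by
  have hz' := Real.sqrt_pos.2 (one_sub_sq_norm_pos hz)
  have hw' := Real.sqrt_pos.2 (one_sub_sq_norm_pos hw)
  obtain ⟨h1, h2⟩ := diskDist_zero_left_lt_aux hz
  obtain ⟨h3, h4⟩ := diskDist_zero_left_lt_aux hw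
  rw [half_diskDist_le_iff, add_div, Real.sinh_add, diskDist_comm z 0, h1, h2, h3, h4,
    sinh_half_diskDist, div_mul_div_comm, div_mul_div_comm, ← add_div]
  gcongr
  simpa using norm_sub_le z w

theorem diskDist_triangle {x y z : ℂ} (hx : x ∈ ball (0 : ℂ) 1) (hy : y ∈ ball (0 : ℂ) 1)
    (hz : z ∈ ball (0 : ℂ) 1) : diskDist x z ≤ diskDist x y + diskDist y z := by
  have h := neg_mem_unitBall hy
  have := diskDist_le_add_zero (moebius_mem_ball h hx) (moebius_mem_ball h hz)
  rwa [← moebius_neg_self y, diskDist_moebius h hx hz, diskDist_moebius h hx hy,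
    diskDist_moebius h hy hz] at this

theorem diskDist_radial {w : ℂ} (hw : w ∈ ball (0 : ℂ) 1) {t : ℝ} (ht : t ∈ Icc (0:ℝ) 1) :
    diskDist (t * w) w = diskDist 0 w - diskDist 0 (t * w) := by
  have htw : (t * w : ℂ) ∈ ball (0 : ℂ) 1 := by
    rw [mem_ball_zero_iff] at hw ⊢
    rw [norm_mul, Complex.norm_real, Real.norm_of_nonneg ht.1]
    nlinarith [norm_nonneg w, ht.2]
  have hz' := Real.sqrt_pos.2 (one_sub_sq_norm_pos htw)
  have hw' := Real.sqrt_pos.2 (one_sub_sq_norm_pos hw)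
  obtain ⟨h1, h2⟩ := diskDist_zero_left_lt_aux htw
  obtain ⟨h3, h4⟩ := diskDist_zero_left_lt_aux hw
  have : Real.sinh (diskDist (t * w) w / 2) =
      Real.sinh ((diskDist 0 w - diskDist 0 (t * w)) / 2) := by
    rw [sub_div, Real.sinh_sub, h1, h2, h3, h4, sinh_half_diskDist, div_mul_div_comm,
      div_mul_div_comm, mul_comm (√(1 - ‖w‖ ^ 2)), ← sub_div]
    congr 1
    rw [show (t * w - w : ℂ) = ((t - 1 : ℝ) : ℂ) * w by push_cast; ring, norm_mul, norm_mul,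
      Complex.norm_real, Complex.norm_real, Real.norm_of_nonneg ht.1,
      Real.norm_of_nonpos (by linarith [ht.2])]
    ring
  have := Real.sinh_injective this
  linarith

theorem fourPointOn_diskDist : FourPointOn (ball (0 : ℂ) 1) diskDist (2 * Real.log 8) := by
  intro x hx y hy z hz w hw
  have hx' := Real.sqrt_pos.2 (one_sub_sq_norm_pos hx)
  have hy' := Real.sqrt_pos.2 (one_sub_sq_norm_pos hy)
  have hz' := Real.sqrt_pos.2 (one_sub_sq_norm_pos hz)
  have hw' := Real.sqrt_pos.2 (one_sub_sq_norm_pos hw)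
  set C : ℂ → ℂ → ℝ := fun a b => Real.cosh (diskDist a b / 2) with hC
  have hCle : ∀ a b, C a b ≤ Real.exp (diskDist a b / 2) := fun a b => by
    rw [← Real.cosh_add_sinh]
    linarith [Real.sinh_nonneg_iff.2 (div_nonneg (diskDist_nonneg a b) zero_le_two)]
  have hCge : ∀ a b, Real.exp (diskDist a b / 2) ≤ 2 * C a b := fun a b => by
    simp only [hC]
    rw [Real.cosh_eq]
    linarith [Real.exp_pos (-(diskDist a b / 2))]
  have hpt : C x y * C z w ≤ C x z * C y w + C x w * C y z := by
    have key : ‖x - z‖ * ‖y - w‖ + ‖1 - conj w * x‖ * ‖1 - conj z * y‖ ≥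
        ‖1 - conj y * x‖ * ‖1 - conj w * z‖ := by
      have e1 : ‖1 - conj z * y‖ = ‖1 - conj y * z‖ := by
        rw [← RCLike.norm_conj]; simp [mul_comm]
      have e2 : ‖y - w‖ = ‖conj w - conj y‖ := by
        rw [← map_sub, RCLike.norm_conj, norm_sub_rev]
      rw [e1, e2, ← norm_mul, ← norm_mul, ← norm_mul]
      calc _ = ‖(x - z) * (conj w - conj y) + (1 - conj w * x) * (1 - conj y * z)‖ := by
              congr 1; ring
        _ ≤ _ := norm_add_le _ _
    have h1 : ‖x - z‖ * ‖y - w‖ / (√(1 - ‖x‖ ^ 2) * √(1 - ‖z‖ ^ 2) *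
        (√(1 - ‖y‖ ^ 2) * √(1 - ‖w‖ ^ 2))) ≤ C x z * C y w := by
      rw [← div_mul_div_comm, ← sinh_half_diskDist, ← sinh_half_diskDist]
      have := (Real.sinh_lt_cosh (diskDist x z / 2)).le
      have := (Real.sinh_lt_cosh (diskDist y w / 2)).le
      have := Real.sinh_nonneg_iff.2 (div_nonneg (diskDist_nonneg y w) zero_le_two)
      have := (Real.cosh_pos (diskDist x z / 2)).le
      simp only [hC]
      gcongr
    refine le_trans ?_ (add_le_add_left h1 _)
    simp only [hC]
    rw [cosh_half_diskDist hx hy, cosh_half_diskDist hz hw, cosh_half_diskDist hx hw,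
      cosh_half_diskDist hy hz]
    rw [div_mul_div_comm, div_mul_div_comm]
    rw [show √(1 - ‖x‖ ^ 2) * √(1 - ‖z‖ ^ 2) * (√(1 - ‖y‖ ^ 2) * √(1 - ‖w‖ ^ 2)) =
        √(1 - ‖x‖ ^ 2) * √(1 - ‖y‖ ^ 2) * (√(1 - ‖z‖ ^ 2) * √(1 - ‖w‖ ^ 2)) by ring,
      show √(1 - ‖x‖ ^ 2) * √(1 - ‖w‖ ^ 2) * (√(1 - ‖y‖ ^ 2) * √(1 - ‖z‖ ^ 2)) =
        √(1 - ‖x‖ ^ 2) * √(1 - ‖y‖ ^ 2) * (√(1 - ‖z‖ ^ 2) * √(1 - ‖w‖ ^ 2)) by ring,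
      ← add_div]
    gcongr
  have hpos : ∀ a b, 0 < C a b := fun a b => Real.cosh_pos _
  have hL : Real.exp ((diskDist x y + diskDist z w) / 2) ≤ 4 * (C x y * C z w) := by
    rw [add_div, Real.exp_add]
    calc _ ≤ (2 * C x y) * (2 * C z w) := by
          exact mul_le_mul (hCge x y) (hCge z w) (Real.exp_pos _).le
            (by have := hpos x y; positivity)
      _ = _ := by ring
  have fin : ∀ a b c d : ℂ, C x y * C z w ≤ 2 * (C a b * C c d) →
      diskDist x y + diskDist z w ≤ diskDist a b + diskDist c d + 2 * Real.log 8 := by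
    intro a b c d h
    have : Real.exp ((diskDist x y + diskDist z w) / 2) ≤
        Real.exp ((diskDist a b + diskDist c d) / 2 + Real.log 8) := by
      rw [Real.exp_add, Real.exp_log (by norm_num), add_div (diskDist a b), Real.exp_add]
      have : C a b * C c d ≤ Real.exp (diskDist a b / 2) * Real.exp (diskDist c d / 2) :=
        mul_le_mul (hCle a b) (hCle c d) (hpos c d).le (Real.exp_pos _).le
      linarith
    have := Real.exp_le_exp.1 this
    linarith
  rcases le_total (C x w * C y z) (C x z * C y w) with h | h
  · exact Or.inl (fin _ _ _ _ (by linarith))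
  · exact Or.inr (fin _ _ _ _ (by linarith))


end

open scoped ComplexConjugate Topology

noncomputable section

/-- `p` is a holomorphic covering map of `Ω` by the unit disk along which the density `lam` pulls
back to the Poincaré density of the disk. -/
structure IsPoincareCover (Ω : Set ℂ) (lam : ℂ → ℝ) (p : ℂ → ℂ) : Prop where
  differentiableAt : ∀ z ∈ ball (0 : ℂ) 1, DifferentiableAt ℂ p z
  image_eq : p '' ball (0 : ℂ) 1 = Ω
  isCoveringMapOn : IsCoveringMapOn (fun z : ball (0 : ℂ) 1 => p z) Ω
  density : ∀ z ∈ ball (0 : ℂ) 1, lam (p z) * ‖deriv p z‖ = 2 / (1 - ‖z‖ ^ 2)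

/-- The automorphism `moebius a` of the disk, as a homeomorphism. -/
def moebiusHomeomorph (a : ℂ) (ha : a ∈ ball (0 : ℂ) 1) : ball (0 : ℂ) 1 ≃ₜ ball (0 : ℂ) 1 where
  toFun z := ⟨moebius a z, moebius_mem_ball ha z.2⟩
  invFun z := ⟨moebius (-a) z, moebius_mem_ball (neg_mem_unitBall ha) z.2⟩
  left_inv z := Subtype.ext (moebius_neg_moebius ha z.2)
  right_inv z := Subtype.ext (moebius_moebius_neg ha z.2)
  continuous_toFun := by
    refine Continuous.subtype_mk ?_ _
    exact continuous_iff_continuousAt.2 fun z => ContinuousAt.comp (g := moebius a)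
      (hasDerivAt_moebius ha z.2).continuousAt continuous_subtype_val.continuousAt
  continuous_invFun := by
    refine Continuous.subtype_mk ?_ _
    exact continuous_iff_continuousAt.2 fun z => ContinuousAt.comp (g := moebius (-a))
      (hasDerivAt_moebius (neg_mem_unitBall ha) z.2).continuousAt
      continuous_subtype_val.continuousAt

theorem zero_mem_unitBall : (0 : ℂ) ∈ ball (0 : ℂ) 1 := mem_ball_self one_pos

theorem conj_mem_unitBall {z : ℂ} (hz : z ∈ ball (0 : ℂ) 1) : conj z ∈ ball (0 : ℂ) 1 := by
  rw [mem_ball_zero_iff] at hz ⊢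
  rwa [RCLike.norm_conj]

namespace IsPoincareCover

variable {Ω : Set ℂ} {lam : ℂ → ℝ} {p : ℂ → ℂ}

theorem mem (hp : IsPoincareCover Ω lam p) {z : ℂ} (hz : z ∈ ball (0 : ℂ) 1) : p z ∈ Ω :=
  hp.image_eq ▸ mem_image_of_mem p hz

theorem density_pos (hp : IsPoincareCover Ω lam p) {z : ℂ} (hz : z ∈ ball (0 : ℂ) 1) :
    0 < lam (p z) ∧ 0 < ‖deriv p z‖ := by
  have h := hp.density z hz
  have h1 : 0 < lam (p z) * ‖deriv p z‖ := h ▸ div_pos two_pos (one_sub_sq_norm_pos hz)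
  have h2 : 0 < ‖deriv p z‖ := (norm_nonneg _).lt_of_ne fun h0 => by simp [← h0] at h1
  exact ⟨pos_of_mul_pos_left h1 h2.le, h2⟩

theorem lam_pos (hp : IsPoincareCover Ω lam p) {x : ℂ} (hx : x ∈ Ω) : 0 < lam x := by
  rw [← hp.image_eq] at hx
  obtain ⟨z, hz, rfl⟩ := hx
  exact (hp.density_pos hz).1

theorem deriv_ne_zero (hp : IsPoincareCover Ω lam p) {z : ℂ} (hz : z ∈ ball (0 : ℂ) 1) :
    deriv p z ≠ 0 := norm_pos_iff.1 (hp.density_pos hz).2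

theorem lam_eq (hp : IsPoincareCover Ω lam p) {z : ℂ} (hz : z ∈ ball (0 : ℂ) 1) :
    lam (p z) = 2 / (1 - ‖z‖ ^ 2) / ‖deriv p z‖ :=
  eq_div_of_mul_eq (hp.density_pos hz).2.ne' (hp.density z hz)

theorem differentiableOn (hp : IsPoincareCover Ω lam p) :
    DifferentiableOn ℂ p (ball 0 1) :=
  fun z hz => (hp.differentiableAt z hz).differentiableWithinAt

theorem comp_moebius (hp : IsPoincareCover Ω lam p) {a : ℂ} (ha : a ∈ ball (0 : ℂ) 1) :
    IsPoincareCover Ω lam (p ∘ moebius a) where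
  differentiableAt z hz := (hp.differentiableAt _ (moebius_mem_ball ha hz)).comp z
    (hasDerivAt_moebius ha hz).differentiableAt
  image_eq := by
    refine Subset.antisymm ?_ ?_
    · rintro _ ⟨z, hz, rfl⟩
      exact hp.mem (moebius_mem_ball ha hz)
    · rw [← hp.image_eq]
      rintro _ ⟨z, hz, rfl⟩
      exact ⟨moebius (-a) z, moebius_mem_ball (neg_mem_unitBall ha) hz, by
        simp [moebius_moebius_neg ha hz]⟩
  isCoveringMapOn := hp.isCoveringMapOn.comp_homeomorph (moebiusHomeomorph a ha)
  density z hz := by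
    have h1 := (hp.differentiableAt _ (moebius_mem_ball ha hz)).hasDerivAt.comp z
      (hasDerivAt_moebius ha hz)
    have h2 := hp.density _ (moebius_mem_ball ha hz)
    have h3 := norm_pos_iff.2 (moebius_denom_ne_zero ha hz)
    have h4 := one_sub_sq_norm_pos ha
    have h5 := one_sub_sq_norm_pos hz
    rw [h1.deriv, norm_mul, ← mul_assoc, Function.comp_apply, h2, one_sub_sq_norm_moebius ha hz,
      norm_div, norm_one_sub_conj_mul ha, norm_pow]
    generalize ‖1 + conj a * z‖ = u at *
    field_simp

theorem exists_normalized (hp : IsPoincareCover Ω lam p) {x : ℂ} (hx : x ∈ Ω) :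
    ∃ p', IsPoincareCover Ω lam p' ∧ p' 0 = x := by
  rw [← hp.image_eq] at hx
  obtain ⟨a, ha, rfl⟩ := hx
  exact ⟨_, hp.comp_moebius ha, by simp [moebius_zero]⟩

theorem exists_localInverse (hp : IsPoincareCover Ω lam p) {z : ℂ} (hz : z ∈ ball (0 : ℂ) 1) :
    ∃ q : ℂ → ℂ, HasStrictDerivAt q (deriv p z)⁻¹ (p z) ∧ (∀ᶠ w in 𝓝 z, q (p w) = w) ∧
      ∀ᶠ y in 𝓝 (p z), p (q y) = y := by
  have h : HasStrictDerivAt p (deriv p z) z :=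
    (hp.differentiableOn.analyticAt (isOpen_ball.mem_nhds hz)).hasStrictDerivAt
  exact ⟨_, h.to_localInverse (hp.deriv_ne_zero hz), h.eventually_left_inverse (hp.deriv_ne_zero hz),
    h.eventually_right_inverse (hp.deriv_ne_zero hz)⟩

theorem continuousOn_lam_comp (hp : IsPoincareCover Ω lam p) :
    ContinuousOn (fun z => lam (p z)) (ball 0 1) := by
  have h : ContinuousOn (fun z => 2 / (1 - ‖z‖ ^ 2) / ‖deriv p z‖) (ball 0 1) :=
    (continuousOn_const.div (by fun_prop) fun z hz => (one_sub_sq_norm_pos hz).ne').div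
      (hp.differentiableOn.deriv isOpen_ball).continuousOn.norm
      fun z hz => (hp.density_pos hz).2.ne'
  exact h.congr fun z hz => hp.lam_eq hz

theorem continuousOn_lam (hp : IsPoincareCover Ω lam p) : ContinuousOn lam Ω := by
  intro y hy
  rw [← hp.image_eq] at hy
  obtain ⟨z, hz, rfl⟩ := hy
  obtain ⟨q, hq, hqz, hqp⟩ := hp.exists_localInverse hz
  have h1 : ContinuousAt (fun z => lam (p z)) (q (p z)) := by
    rw [hqz.self_of_nhds]
    exact hp.continuousOn_lam_comp.continuousAt (isOpen_ball.mem_nhds hz)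
  have h2 : ContinuousAt (fun y => lam (p (q y))) (p z) :=
    ContinuousAt.comp (g := fun z => lam (p z)) h1 hq.hasDerivAt.continuousAt
  exact (h2.congr (hqp.mono fun y h => congrArg lam h)).continuousWithinAt

theorem exists_lift (hp : IsPoincareCover Ω lam p) {S : Set ℂ} [SimplyConnectedSpace S]
    [LocallyPathConnectedSpace S] {f : ℂ → ℂ} (hf : ContinuousOn f S) (hm : MapsTo f S Ω)
    {a : ℂ} (ha : a ∈ S) {z : ℂ} (hz : z ∈ ball (0 : ℂ) 1) (hpz : p z = f a) :
    ∃ g : ℂ → ℂ, ContinuousOn g S ∧ MapsTo g S (ball 0 1) ∧ g a = z ∧ ∀ w ∈ S, p (g w) = f w := by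
  obtain ⟨F, ⟨h0, h1⟩, -⟩ := hp.isCoveringMapOn.existsUnique_continuousMap_lifts
    (f := ⟨S.domRestrict f, continuousOn_iff_continuous_domRestrict.1 hf⟩)
    (a₀ := ⟨a, ha⟩) (e₀ := ⟨z, hz⟩) hpz (fun w => hm w.2)
  classical
  refine ⟨fun w => if h : w ∈ S then F ⟨w, h⟩ else 0, ?_, ?_, ?_, ?_⟩
  · rw [continuousOn_iff_continuous_domRestrict]
    convert continuous_subtype_val.comp F.continuous using 1
    ext w
    simp
  · intro w hw
    simp only [hw, dif_pos]
    exact (F ⟨w, hw⟩).2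
  · simp [ha, h0]
  · intro w hw
    simp only [hw, dif_pos]
    exact congrFun h1 ⟨w, hw⟩

theorem eqOn_of_lift (hp : IsPoincareCover Ω lam p) {A : Type*} [TopologicalSpace A] {S : Set A}
    (hS : IsPreconnected S)
    {g g' : A → ℂ} (hg : ContinuousOn g S) (hg' : ContinuousOn g' S) (hm : MapsTo g S (ball 0 1))
    (hm' : MapsTo g' S (ball 0 1)) (he : ∀ w ∈ S, p (g w) = p (g' w)) {a : A} (ha : a ∈ S)
    (hga : g a = g' a) : EqOn g g' S := by
  have : PreconnectedSpace S := isPreconnected_iff_preconnectedSpace.1 hS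
  have hc : IsLocallyInjective (fun z : ball (0 : ℂ) 1 => p z) := by
    intro z
    obtain ⟨q, -, hq, -⟩ := hp.exists_localInverse z.2
    obtain ⟨U, hU, hUo, hzU⟩ := _root_.eventually_nhds_iff.1 hq
    refine ⟨Subtype.val ⁻¹' U, hUo.preimage continuous_subtype_val, hzU, ?_⟩
    intro x hx y hy hxy
    exact Subtype.ext (by rw [← hU x hx, ← hU y hy]; exact congrArg q hxy)
  have hs : IsSeparatedMap (fun z : ball (0 : ℂ) 1 => p z) := T2Space.isSeparatedMap _
  have := hs.eq_of_comp_eq hc (g₁ := fun w : S => (⟨g w, hm w.2⟩ : ball (0 : ℂ) 1))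
    (g₂ := fun w : S => (⟨g' w, hm' w.2⟩ : ball (0 : ℂ) 1))
    (Continuous.subtype_mk (continuousOn_iff_continuous_domRestrict.1 hg) _)
    (Continuous.subtype_mk (continuousOn_iff_continuous_domRestrict.1 hg') _)
    (funext fun w => he w w.2) ⟨a, ha⟩ (Subtype.ext hga)
  intro w hw
  exact congrArg Subtype.val (congrFun this ⟨w, hw⟩)

theorem exists_holomorphic_lift (hp : IsPoincareCover Ω lam p) {f : ℂ → ℂ}
    (hf : DifferentiableOn ℂ f (ball 0 1)) (hm : MapsTo f (ball 0 1) Ω) (h0 : f 0 = p 0) :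
    ∃ g : ℂ → ℂ, DifferentiableOn ℂ g (ball 0 1) ∧ MapsTo g (ball 0 1) (ball 0 1) ∧ g 0 = 0 ∧
      ∀ z ∈ ball (0 : ℂ) 1, p (g z) = f z := by
  have : ContractibleSpace (ball (0 : ℂ) 1) :=
    (convex_ball (0 : ℂ) 1).contractibleSpace ⟨0, zero_mem_unitBall⟩
  have : LocallyPathConnectedSpace (ball (0 : ℂ) 1) := isOpen_ball.locallyPathConnectedSpace
  obtain ⟨g, hg, hgm, hg0, hpg⟩ :=
    hp.exists_lift hf.continuousOn hm zero_mem_unitBall zero_mem_unitBall h0.symm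
  refine ⟨g, fun z hz => ?_, hgm, hg0, hpg⟩
  obtain ⟨q, hq, hqp, -⟩ := hp.exists_localInverse (hgm hz)
  have hz' := isOpen_ball.mem_nhds hz
  have h1 : ∀ᶠ w in 𝓝 z, q (f w) = g w := by
    filter_upwards [(hg.continuousAt hz').eventually hqp, hz'] with w h2 h3
    rw [← hpg w h3, h2]
  rw [hpg z hz] at hq
  have h2 : DifferentiableAt ℂ (q ∘ f) z :=
    hq.hasDerivAt.differentiableAt.comp z (hf.differentiableAt hz')
  exact (h2.congr_of_eventuallyEq (h1.mono fun w h => h.symm)).differentiableWithinAt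

end IsPoincareCover

end

open scoped ComplexConjugate Topology

noncomputable section

/-- `γ` is a C¹ curve in `S` from `x` to `y`, parametrized by `[0, 1]`. -/
structure IsCurveIn (S : Set ℂ) (γ : ℝ → ℂ) (x y : ℂ) : Prop where
  contDiffOn : ContDiffOn ℝ 1 γ (Icc 0 1)
  source : γ 0 = x
  target : γ 1 = y
  mem : ∀ t ∈ Icc (0 : ℝ) 1, γ t ∈ S

section curves

variable {S : Set ℂ} {ρ : ℂ → ℝ} {γ : ℝ → ℂ} {x y : ℂ}

theorem IsCurveIn.continuousOn (h : IsCurveIn S γ x y) : ContinuousOn γ (Icc 0 1) :=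
  h.contDiffOn.continuousOn

theorem curveLen_nonneg (hρ : ∀ x ∈ S, 0 ≤ ρ x) (h : IsCurveIn S γ x y) : 0 ≤ curveLen ρ γ :=
  intervalIntegral.integral_nonneg zero_le_one fun t ht =>
    mul_nonneg (hρ _ (h.mem t ht)) (norm_nonneg _)

theorem densityDist_le (hρ : ∀ x ∈ S, 0 ≤ ρ x) (h : IsCurveIn S γ x y) :
    densityDist S ρ x y ≤ curveLen ρ γ := by
  refine csInf_le ⟨0, ?_⟩ ⟨γ, h.1, h.2, h.3, h.4, rfl⟩
  rintro _ ⟨γ', h1, h2, h3, h4, rfl⟩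
  exact curveLen_nonneg hρ ⟨h1, h2, h3, h4⟩

theorem le_densityDist {c : ℝ} (hne : ∃ γ, IsCurveIn S γ x y)
    (hc : ∀ γ, IsCurveIn S γ x y → c ≤ curveLen ρ γ) : c ≤ densityDist S ρ x y := by
  obtain ⟨γ, h⟩ := hne
  refine le_csInf ⟨_, γ, h.1, h.2, h.3, h.4, rfl⟩ ?_
  rintro _ ⟨γ', h1, h2, h3, h4, rfl⟩
  exact hc γ' ⟨h1, h2, h3, h4⟩

theorem exists_curveLen_lt {c : ℝ} (hne : ∃ γ, IsCurveIn S γ x y)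
    (hc : densityDist S ρ x y < c) : ∃ γ, IsCurveIn S γ x y ∧ curveLen ρ γ < c := by
  by_contra! h
  have : c ≤ densityDist S ρ x y := le_densityDist hne h
  linarith

theorem deriv_eq_derivWithin_Icc {t : ℝ} (ht : t ∈ Ioo (0 : ℝ) 1) :
    deriv γ t = derivWithin γ (Icc 0 1) t :=
  (derivWithin_of_mem_nhds (Icc_mem_nhds ht.1 ht.2)).symm

theorem IsCurveIn.continuousOn_derivWithin (h : IsCurveIn S γ x y) :
    ContinuousOn (fun t => ‖derivWithin γ (Icc 0 1) t‖) (Icc 0 1) :=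
  (h.contDiffOn.continuousOn_derivWithin (uniqueDiffOn_Icc zero_lt_one) le_rfl).norm

theorem IsCurveIn.intervalIntegrable (hρ : ContinuousOn ρ S) (h : IsCurveIn S γ x y) {a b : ℝ}
    (ha : a ∈ Icc (0 : ℝ) 1) (hb : b ∈ Icc (0 : ℝ) 1) :
    IntervalIntegrable (fun t => ρ (γ t) * ‖deriv γ t‖) MeasureTheory.volume a b := by
  have h1 : ContinuousOn (fun t => ρ (γ t) * ‖derivWithin γ (Icc 0 1) t‖) (Icc 0 1) :=
    (hρ.comp h.continuousOn h.mem).mul h.continuousOn_derivWithin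
  have h2 : IntervalIntegrable (fun t => ρ (γ t) * ‖derivWithin γ (Icc 0 1) t‖)
      MeasureTheory.volume 0 1 := by
    apply ContinuousOn.intervalIntegrable
    rwa [uIcc_of_le zero_le_one]
  have h3 : IntervalIntegrable (fun t => ρ (γ t) * ‖deriv γ t‖) MeasureTheory.volume 0 1 := by
    rw [intervalIntegrable_iff_integrableOn_Ioo_of_le zero_le_one] at h2 ⊢
    exact h2.congr_fun (fun t ht => by simp only [deriv_eq_derivWithin_Icc ht]) measurableSet_Ioo
  refine h3.mono_set ?_
  rw [uIcc_of_le zero_le_one]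
  exact uIcc_subset_Icc ha hb

theorem curveLen_eq_integral_derivWithin :
    curveLen ρ γ = ∫ t in (0:ℝ)..1, ρ (γ t) * ‖derivWithin γ (Icc 0 1) t‖ := by
  unfold curveLen
  rw [intervalIntegral.integral_of_le zero_le_one, intervalIntegral.integral_of_le zero_le_one,
    MeasureTheory.integral_Ioc_eq_integral_Ioo, MeasureTheory.integral_Ioc_eq_integral_Ioo]
  exact MeasureTheory.setIntegral_congr_fun measurableSet_Ioo fun t ht => by
    simp only [deriv_eq_derivWithin_Icc ht]

theorem IsCurveIn.comp_affine (h : IsCurveIn S γ x y) {a c : ℝ} (ha : a ∈ Icc (0 : ℝ) 1)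
    (hac : a + c ∈ Icc (0 : ℝ) 1) : IsCurveIn S (fun t => γ (a + c * t)) (γ a) (γ (a + c)) where
  contDiffOn := by
    refine h.contDiffOn.comp (by fun_prop) fun t ht => ?_
    constructor <;> nlinarith [ht.1, ht.2, ha.1, ha.2, hac.1, hac.2]
  source := by simp
  target := by simp
  mem t ht := h.mem _ (by
    constructor <;> nlinarith [ht.1, ht.2, ha.1, ha.2, hac.1, hac.2])

theorem curveLen_comp_affine {a c : ℝ} (hc : 0 ≤ c) :
    curveLen ρ (fun t => γ (a + c * t)) = ∫ t in a..(a + c), ρ (γ t) * ‖deriv γ t‖ := by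
  have h1 : ∀ t, deriv (fun t => γ (a + c * t)) t = c • deriv γ (a + c * t) := fun t => by
    rw [deriv_comp_mul_left c (fun s => γ (a + s)), deriv_comp_const_add]
  have h2 := intervalIntegral.smul_integral_comp_add_mul (a := 0) (b := 1)
    (fun t => ρ (γ t) * ‖deriv γ t‖) c a
  simp only [mul_zero, add_zero, mul_one] at h2
  rw [← h2, smul_eq_mul, ← intervalIntegral.integral_const_mul]
  refine intervalIntegral.integral_congr fun t _ => ?_
  simp only [h1, norm_smul, Real.norm_of_nonneg hc]
  ring

theorem IsCurveIn.curveLen_split (hρ : ContinuousOn ρ S) (h : IsCurveIn S γ x y) {τ : ℝ}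
    (hτ : τ ∈ Icc (0 : ℝ) 1) :
    curveLen ρ (fun t => γ (0 + τ * t)) + curveLen ρ (fun t => γ (τ + (1 - τ) * t)) =
      curveLen ρ γ := by
  rw [curveLen_comp_affine hτ.1, curveLen_comp_affine (sub_nonneg.2 hτ.2), zero_add,
    add_sub_cancel]
  exact intervalIntegral.integral_add_adjacent_intervals
    (h.intervalIntegrable hρ ⟨le_rfl, zero_le_one⟩ hτ)
    (h.intervalIntegrable hρ hτ ⟨zero_le_one, le_rfl⟩)

/-- A curve joining two points can be cut at a parameter into two curves whose lengths bound the
corresponding distances. -/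
theorem IsCurveIn.densityDist_add_le (hρ : ContinuousOn ρ S) (hρ0 : ∀ x ∈ S, 0 ≤ ρ x)
    (h : IsCurveIn S γ x y) {τ : ℝ} (hτ : τ ∈ Icc (0 : ℝ) 1) :
    densityDist S ρ x (γ τ) + densityDist S ρ (γ τ) y ≤ curveLen ρ γ := by
  rw [← h.curveLen_split hρ hτ]
  have h1 := h.comp_affine (a := 0) (c := τ) ⟨le_rfl, zero_le_one⟩ (by simpa using hτ)
  have h2 := h.comp_affine (a := τ) (c := 1 - τ) hτ (by simp)
  rw [h.source, zero_add] at h1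
  rw [add_sub_cancel, h.target] at h2
  exact add_le_add (densityDist_le hρ0 h1) (densityDist_le hρ0 h2)

theorem IsCurveIn.conj (hS : ∀ x ∈ S, conj x ∈ S) (h : IsCurveIn S γ x y) :
    IsCurveIn S (fun t => conj (γ t)) (conj x) (conj y) where
  contDiffOn := (Complex.conjCLE.contDiff (n := 1)).comp_contDiffOn h.contDiffOn
  source := by rw [h.source]
  target := by rw [h.target]
  mem t ht := hS _ (h.mem t ht)

theorem curveLen_conj (hS : ∀ x ∈ S, ρ (conj x) = ρ x) (h : IsCurveIn S γ x y) :
    curveLen ρ (fun t => conj (γ t)) = curveLen ρ γ := by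
  refine intervalIntegral.integral_congr fun t ht => ?_
  rw [uIcc_of_le zero_le_one] at ht
  have h1 : deriv (fun t => conj (γ t)) t = conj (deriv γ t) := deriv.star
  simp only [h1, RCLike.norm_conj, hS _ (h.mem t ht)]

theorem densityDist_conj_le (hρ0 : ∀ x ∈ S, 0 ≤ ρ x) (hS : ∀ x ∈ S, conj x ∈ S)
    (hρ : ∀ x ∈ S, ρ (conj x) = ρ x) (hne : ∃ γ, IsCurveIn S γ x y) :
    densityDist S ρ (conj x) (conj y) ≤ densityDist S ρ x y :=
  le_densityDist hne fun _ h => (densityDist_le hρ0 (h.conj hS)).trans_eq (curveLen_conj hρ h)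

end curves

end

open scoped ComplexConjugate Topology

noncomputable section

namespace IsPoincareCover

variable {Ω : Set ℂ} {lam : ℂ → ℝ} {p : ℂ → ℂ}

theorem ofReal_mul_mem_unitBall {w : ℂ} (hw : w ∈ ball (0 : ℂ) 1) {t : ℝ}
    (ht : t ∈ Icc (0 : ℝ) 1) : (t * w : ℂ) ∈ ball (0 : ℂ) 1 := by
  rw [mem_ball_zero_iff] at hw ⊢
  rw [norm_mul, Complex.norm_real, Real.norm_of_nonneg ht.1]
  nlinarith [norm_nonneg w, ht.2]

theorem isCurveIn_radial (hp : IsPoincareCover Ω lam p) {w : ℂ} (hw : w ∈ ball (0 : ℂ) 1) :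
    IsCurveIn Ω (fun t : ℝ => p (t * w)) (p 0) (p w) where
  contDiffOn := by
    have h1 : ContDiffOn ℝ 1 p (ball 0 1) :=
      (hp.differentiableOn.contDiffOn isOpen_ball).restrict_scalars ℝ
    have h2 : ContDiff ℝ 1 (fun t : ℝ => (t * w : ℂ)) :=
      (Complex.ofRealCLM.contDiff).mul contDiff_const
    exact h1.comp h2.contDiffOn fun t ht => ofReal_mul_mem_unitBall hw ht
  source := by simp
  target := by simp
  mem t ht := hp.mem (ofReal_mul_mem_unitBall hw ht)

theorem curveLen_radial (hp : IsPoincareCover Ω lam p) {w : ℂ} (hw : w ∈ ball (0 : ℂ) 1) :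
    curveLen lam (fun t : ℝ => p (t * w)) = diskDist 0 w := by
  have hr : ‖w‖ < 1 := mem_ball_zero_iff.1 hw
  have hr0 := norm_nonneg w
  have hb : ∀ t ∈ Icc (0 : ℝ) 1, 0 < 1 + t * ‖w‖ ∧ 0 < 1 - t * ‖w‖ := fun t ht => by
    constructor <;> nlinarith [ht.1, ht.2]
  have h1 : ∀ t ∈ Icc (0 : ℝ) 1, lam (p (t * w)) * ‖deriv (fun t : ℝ => p (t * w)) t‖ =
      ‖w‖ / (1 + t * ‖w‖) + ‖w‖ / (1 - t * ‖w‖) := fun t ht => by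
    have htw := ofReal_mul_mem_unitBall hw ht
    have h2 : HasDerivAt (fun t : ℝ => (t * w : ℂ)) w t := by
      simpa using (Complex.ofRealCLM.hasDerivAt (x := t)).mul_const w
    have h3 : HasDerivAt (fun t : ℝ => p (t * w)) (deriv p (t * w) * w) t :=
      HasDerivAt.comp t (h₂ := p) (hp.differentiableAt _ htw).hasDerivAt h2
    have h4 := hb t ht
    have h5 := one_sub_sq_norm_pos htw
    rw [h3.deriv, norm_mul, ← mul_assoc, hp.density _ htw]
    have h6 : ‖(t * w : ℂ)‖ = t * ‖w‖ := by
      rw [norm_mul, Complex.norm_real, Real.norm_of_nonneg ht.1]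
    rw [h6] at h5 ⊢
    rw [div_add_div _ _ h4.1.ne' h4.2.ne', div_mul_eq_mul_div]
    congr 1 <;> ring
  have h2 : curveLen lam (fun t : ℝ => p (t * w)) =
      ∫ t in (0 : ℝ)..1, (‖w‖ / (1 + t * ‖w‖) + ‖w‖ / (1 - t * ‖w‖)) :=
    intervalIntegral.integral_congr fun t ht => h1 t (by rwa [uIcc_of_le zero_le_one] at ht)
  rw [h2, intervalIntegral.integral_eq_sub_of_hasDerivAt
    (f := fun t => Real.log (1 + t * ‖w‖) - Real.log (1 - t * ‖w‖))]
  · rw [diskDist_zero_left hw, Real.log_div (by linarith) (by linarith)]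
    simp
  · intro t ht
    rw [uIcc_of_le zero_le_one] at ht
    have h4 := hb t ht
    have h5 : HasDerivAt (fun t : ℝ => 1 + t * ‖w‖) ‖w‖ t := by
      simpa using ((hasDerivAt_id t).mul_const ‖w‖).const_add 1
    have h6 : HasDerivAt (fun t : ℝ => 1 - t * ‖w‖) (-‖w‖) t := by
      simpa using ((hasDerivAt_id t).mul_const ‖w‖).const_sub 1
    have h7 := (h5.log h4.1.ne').sub (h6.log h4.2.ne')
    rwa [neg_div, sub_neg_eq_add] at h7
  · apply ContinuousOn.intervalIntegrable
    rw [uIcc_of_le zero_le_one]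
    exact (continuousOn_const.div (by fun_prop) fun t ht => (hb t ht).1.ne').add
      (continuousOn_const.div (by fun_prop) fun t ht => (hb t ht).2.ne')

theorem lam_nonneg (hp : IsPoincareCover Ω lam p) : ∀ x ∈ Ω, 0 ≤ lam x :=
  fun _ hx => (hp.lam_pos hx).le

theorem exists_isCurveIn (hp : IsPoincareCover Ω lam p) {x y : ℂ} (hx : x ∈ Ω) (hy : y ∈ Ω) :
    ∃ γ, IsCurveIn Ω γ x y := by
  obtain ⟨p', hp', rfl⟩ := hp.exists_normalized hx
  rw [← hp'.image_eq] at hy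
  obtain ⟨w, hw, rfl⟩ := hy
  exact ⟨_, hp'.isCurveIn_radial hw⟩

theorem densityDist_zero_le (hp : IsPoincareCover Ω lam p) {w : ℂ} (hw : w ∈ ball (0 : ℂ) 1) :
    densityDist Ω lam (p 0) (p w) ≤ diskDist 0 w :=
  (densityDist_le hp.lam_nonneg (hp.isCurveIn_radial hw)).trans_eq (hp.curveLen_radial hw)

/-- Covering maps do not increase the Poincaré distance. -/
theorem densityDist_map_le (hp : IsPoincareCover Ω lam p) {z w : ℂ} (hz : z ∈ ball (0 : ℂ) 1)
    (hw : w ∈ ball (0 : ℂ) 1) : densityDist Ω lam (p z) (p w) ≤ diskDist z w := by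
  have hz' := neg_mem_unitBall hz
  have h := (hp.comp_moebius hz).densityDist_zero_le (moebius_mem_ball hz' hw)
  rwa [Function.comp_apply, moebius_zero, Function.comp_apply, moebius_moebius_neg hz hw,
    ← moebius_neg_self z, diskDist_moebius hz' hz hw] at h

/-- Lipschitz bound along a covering map for the function comparing the Poincaré metric of the
disk with its projection to a diameter. -/
theorem exists_hasFDerivAt_log (hp : IsPoincareCover Ω lam p) {z u : ℂ}
    (hz : z ∈ ball (0 : ℂ) 1) (hu : ‖u‖ = 1) :
    ∃ (q : ℂ → ℂ) (L : ℂ →L[ℝ] ℝ), (∀ᶠ w in 𝓝 z, q (p w) = w) ∧ ‖L‖ ≤ lam (p z) ∧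
      HasFDerivAt (fun y => Real.log (1 + (u * q y).re) - Real.log (1 - (u * q y).re)) L (p z) := by
  obtain ⟨q, hq, hqp, -⟩ := hp.exists_localInverse hz
  have hqz : q (p z) = z := hqp.self_of_nhds
  have hz1 : ‖z‖ < 1 := mem_ball_zero_iff.1 hz
  set s := (u * z).re with hs
  have hsz : |s| ≤ ‖z‖ := (Complex.abs_re_le_norm _).trans_eq (by rw [norm_mul, hu, one_mul])
  have hs1 := abs_lt.1 (hsz.trans_lt hz1)
  have h1 : HasDerivAt (fun s => Real.log (1 + s) - Real.log (1 - s)) (2 / (1 - s ^ 2)) s := by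
    have h5 : HasDerivAt (fun t : ℝ => 1 + t) 1 s := (hasDerivAt_id s).const_add 1
    have h6 : HasDerivAt (fun t : ℝ => 1 - t) (-1) s := (hasDerivAt_id s).const_sub 1
    have h7 : 1 + s ≠ 0 := by linarith
    have h8 : 1 - s ≠ 0 := by linarith
    have h9 := (h5.log h7).sub (h6.log h8)
    have h10 : 1 / (1 + s) - -1 / (1 - s) = 2 / (1 - s ^ 2) := by
      rw [show 1 - s ^ 2 = (1 + s) * (1 - s) by ring]
      field_simp
      ring
    rwa [h10] at h9
  set A : ℂ →L[ℝ] ℝ := Complex.reCLM.comp (ContinuousLinearMap.mul ℝ ℂ u) with hA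
  have hAn : ‖A‖ ≤ 1 := by
    refine ContinuousLinearMap.opNorm_le_bound _ zero_le_one fun v => ?_
    simp only [hA, ContinuousLinearMap.comp_apply, Complex.reCLM_apply,
      ContinuousLinearMap.mul_apply', one_mul, Real.norm_eq_abs]
    exact (Complex.abs_re_le_norm _).trans_eq (by rw [norm_mul, hu, one_mul])
  have hq' := hq.hasDerivAt.complexToReal_fderiv
  have h2 : HasFDerivAt (fun y => (u * q y).re) (A.comp ((deriv p z)⁻¹ • (1 : ℂ →L[ℝ] ℂ))) (p z) :=
    A.hasFDerivAt.comp (p z) hq'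
  have h3 : HasDerivAt (fun s => Real.log (1 + s) - Real.log (1 - s)) (2 / (1 - s ^ 2))
      ((u * q (p z)).re) := by rwa [hqz]
  refine ⟨q, _, hqp, ?_, h3.comp_hasFDerivAt (h₂ := fun s => Real.log (1 + s) - Real.log (1 - s)) (p z) h2⟩
  have h4 := one_sub_sq_norm_pos hz
  have h5 : s ^ 2 ≤ ‖z‖ ^ 2 := sq_le_sq' (by linarith [(abs_le.1 hsz).1]) (abs_le.1 hsz).2
  have h6 : ‖(deriv p z)⁻¹ • (1 : ℂ →L[ℝ] ℂ)‖ ≤ ‖deriv p z‖⁻¹ := by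
    rw [norm_smul, norm_inv]
    exact mul_le_of_le_one_right (by positivity) ContinuousLinearMap.norm_id_le
  have h7 : ‖A.comp ((deriv p z)⁻¹ • (1 : ℂ →L[ℝ] ℂ))‖ ≤ ‖deriv p z‖⁻¹ := by
    refine (ContinuousLinearMap.opNorm_comp_le _ _).trans ?_
    have := mul_le_mul hAn h6 (norm_nonneg _) zero_le_one
    rwa [one_mul] at this
  rw [norm_smul, hp.lam_eq hz, div_eq_mul_inv _ ‖deriv p z‖,
    Real.norm_of_nonneg (div_nonneg zero_le_two (by linarith))]
  gcongr

/-- A lift that is dominated by `γ` through `p` is no longer than `γ`. -/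
theorem diskDist_le_curveLen (hp : IsPoincareCover Ω lam p) {x y : ℂ} {γ z : ℝ → ℂ}
    (hγ : IsCurveIn Ω γ x y) (hz : ContinuousOn z (Icc 0 1)) (hzm : MapsTo z (Icc 0 1) (ball 0 1))
    (h0 : z 0 = 0)
    (hlip : ∀ s ∈ Icc (0 : ℝ) 1, ∀ t ∈ Icc (0 : ℝ) 1, ‖p (z s) - p (z t)‖ ≤ ‖γ s - γ t‖)
    (hlam : ∀ t ∈ Icc (0 : ℝ) 1, lam (p (z t)) = lam (γ t)) :
    diskDist 0 (z 1) ≤ curveLen lam γ := by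
  have m0 : (0 : ℝ) ∈ Icc (0 : ℝ) 1 := ⟨le_rfl, zero_le_one⟩
  have m1 : (1 : ℝ) ∈ Icc (0 : ℝ) 1 := ⟨zero_le_one, le_rfl⟩
  obtain ⟨u, hu, huz⟩ : ∃ u : ℂ, ‖u‖ = 1 ∧ (u * z 1).re = ‖z 1‖ := by
    rcases eq_or_ne (z 1) 0 with h | h
    · exact ⟨1, by simp, by simp [h]⟩
    · refine ⟨conj (z 1) / ‖z 1‖, ?_, ?_⟩
      · simp [h]
      · rw [div_mul_eq_mul_div, mul_comm, Complex.mul_conj, Complex.normSq_eq_norm_sq]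
        norm_cast
        have := norm_ne_zero_iff.2 h
        field_simp
  have hbd : ∀ w ∈ ball (0 : ℂ) 1, -1 < (u * w).re ∧ (u * w).re < 1 := fun w hw =>
    abs_lt.1 (((Complex.abs_re_le_norm _).trans_eq (by rw [norm_mul, hu, one_mul])).trans_lt
      (mem_ball_zero_iff.1 hw))
  set f : ℝ → ℝ := fun t => Real.log (1 + (u * z t).re) - Real.log (1 - (u * z t).re) with hf
  set ψ : ℝ → ℝ := fun t => lam (γ t) * ‖derivWithin γ (Icc 0 1) t‖ with hψ
  have hψc : ContinuousOn ψ (Icc 0 1) :=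
    (hp.continuousOn_lam.comp hγ.continuousOn hγ.mem).mul hγ.continuousOn_derivWithin
  set Ψ : ℝ → ℝ := fun t => ψ (max 0 (min 1 t)) with hΨ
  have hΨc : Continuous Ψ := hψc.comp_continuous (by fun_prop) fun t =>
    ⟨le_max_left _ _, max_le zero_le_one (min_le_left _ _)⟩
  have hΨψ : ∀ t ∈ Icc (0 : ℝ) 1, Ψ t = ψ t := fun t ht => by
    simp only [hΨ, min_eq_right ht.2, max_eq_right ht.1]
  set B : ℝ → ℝ := fun t => ∫ s in (0:ℝ)..t, Ψ s with hB
  have hBd : ∀ t, HasDerivAt B (Ψ t) t := fun t => hΨc.integral_hasStrictDerivAt 0 t |>.hasDerivAt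
  have hre : ContinuousOn (fun t => (u * z t).re) (Icc 0 1) :=
    Complex.continuous_re.comp_continuousOn (continuousOn_const.mul hz)
  have hfc : ContinuousOn f (Icc 0 1) :=
    ((continuousOn_const.add hre).log fun t ht =>
      (neg_lt_iff_pos_add'.1 (hbd _ (hzm ht)).1).ne').sub
    ((continuousOn_const.sub hre).log fun t ht => (sub_pos.2 (hbd _ (hzm ht)).2).ne')
  have key : ∀ ⦃t⦄, t ∈ Icc (0 : ℝ) 1 → f t ≤ B t := by
    refine image_le_of_liminf_slope_right_le_deriv_boundary hfc (by simp [hf, hB, h0])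
      (fun t _ => (hBd t).continuousAt.continuousWithinAt) (fun t _ => (hBd t).hasDerivWithinAt) ?_
    intro t ht r hr
    have ht' : t ∈ Icc (0 : ℝ) 1 := ⟨ht.1, ht.2.le⟩
    rw [hΨψ t ht'] at hr
    obtain ⟨q, L, hqp, hL, hd⟩ := hp.exists_hasFDerivAt_log (hzm ht') hu
    rw [hlam t ht'] at hL
    set N := ‖derivWithin γ (Icc 0 1) t‖ with hN
    have hl0 : 0 ≤ lam (γ t) := hp.lam_nonneg _ (hγ.mem t ht')
    obtain ⟨ε, hε, hεr⟩ : ∃ ε > 0, (lam (γ t) + ε) * (N + ε) < r := by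
      have hc : ContinuousAt (fun ε => (lam (γ t) + ε) * (N + ε)) 0 := by fun_prop
      have := hc.eventually_lt (continuousAt_const (y := r)) (by simpa using hr)
      have h3 := (this.filter_mono nhdsWithin_le_nhds).and (self_mem_nhdsWithin (s := Ioi (0 : ℝ)))
      obtain ⟨ε, h1, h2⟩ := h3.exists
      exact ⟨ε, h2, h1⟩
    apply Eventually.frequently
    have hIcc : 𝓝[>] t ≤ 𝓝[Icc 0 1] t := by
      rw [← nhdsWithin_Ioc_eq_nhdsGT ht.2]
      exact nhdsWithin_mono _ fun s hs => ⟨ht.1.trans hs.1.le, hs.2⟩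
    have hzt : Tendsto z (𝓝[>] t) (𝓝 (z t)) := (hz t ht').mono_left hIcc
    have hpt : Tendsto (fun s => p (z s)) (𝓝[>] t) (𝓝 (p (z t))) :=
      (hp.differentiableAt _ (hzm ht')).continuousAt.tendsto.comp hzt
    have hγd : HasDerivWithinAt γ (derivWithin γ (Icc 0 1) t) (Icc 0 1) t :=
      ((hγ.contDiffOn.differentiableOn one_ne_zero) t ht').hasDerivWithinAt
    have e1 := hzt.eventually hqp
    have e2 := hpt.eventually (hd.isLittleO.def hε)
    have e3 := (hγd.limsup_norm_slope_le (r := N + ε) (by linarith)).filter_mono hIcc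
    have e4 : ∀ᶠ s in 𝓝[>] t, s ∈ Icc (0 : ℝ) 1 := hIcc self_mem_nhdsWithin
    filter_upwards [e1, e2, e3, e4, self_mem_nhdsWithin] with s h1 h2 h3 h4 h5
    have hst : 0 < s - t := sub_pos.2 h5
    simp only [h1, hqp.self_of_nhds] at h2
    rw [Real.norm_of_nonneg hst.le, inv_mul_eq_div, div_lt_iff₀ hst] at h3
    have h6 := hlip s h4 t ht'
    have h7 : f s - f t ≤ (lam (γ t) + ε) * ‖p (z s) - p (z t)‖ := by
      have h8 := (le_abs_self _).trans h2
      have h9 := (le_abs_self _).trans (L.le_opNorm (p (z s) - p (z t)))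
      have h10 := mul_le_mul_of_nonneg_right hL (norm_nonneg (p (z s) - p (z t)))
      simp only [hf]
      linarith
    rw [slope_def_field, div_lt_iff₀ hst]
    calc f s - f t ≤ (lam (γ t) + ε) * ‖p (z s) - p (z t)‖ := h7
      _ ≤ (lam (γ t) + ε) * ((N + ε) * (s - t)) := by gcongr; linarith
      _ = (lam (γ t) + ε) * (N + ε) * (s - t) := by ring
      _ < r * (s - t) := by gcongr
  have h1 := key m1
  have h2 : B 1 = curveLen lam γ := by
    rw [curveLen_eq_integral_derivWithin]
    exact intervalIntegral.integral_congr fun t ht => hΨψ t (by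
      rwa [uIcc_of_le zero_le_one] at ht)
  have h3 : f 1 = diskDist 0 (z 1) := by
    have h4 := mem_ball_zero_iff.1 (hzm m1)
    have h5 := norm_nonneg (z 1)
    rw [diskDist_zero_left (hzm m1), Real.log_div (by linarith) (by linarith)]
    simp only [hf, huz]
  linarith

end IsPoincareCover

end

open scoped ComplexConjugate Topology

noncomputable section

namespace IsPoincareCover

variable {Ω : Set ℂ} {lam : ℂ → ℝ} {p p₁ : ℂ → ℂ}

theorem exists_conj_lift (hp : IsPoincareCover Ω lam p) (hp₁ : IsPoincareCover Ω lam p₁)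
    (hc : ∀ x ∈ Ω, conj x ∈ Ω) (h0 : p₁ 0 = conj (p 0)) :
    ∃ g : ℂ → ℂ, DifferentiableOn ℂ g (ball 0 1) ∧ MapsTo g (ball 0 1) (ball 0 1) ∧ g 0 = 0 ∧
      ∀ z ∈ ball (0 : ℂ) 1, p₁ (g z) = conj (p (conj z)) := by
  refine hp₁.exists_holomorphic_lift (f := fun z => conj (p (conj z))) ?_ ?_ (by simp [h0])
  · intro z hz
    have := (hp.differentiableAt _ (conj_mem_unitBall hz)).conj_conj
    rw [Complex.conj_conj] at this
    exact this.differentiableWithinAt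
  · exact fun z hz => hc _ (hp.mem (conj_mem_unitBall hz))

theorem norm_le_of_holomorphic {g : ℂ → ℂ} (hg : DifferentiableOn ℂ g (ball 0 1))
    (hm : MapsTo g (ball 0 1) (ball 0 1)) (h0 : g 0 = 0) {z : ℂ} (hz : z ∈ ball (0 : ℂ) 1) :
    ‖g z‖ ≤ ‖z‖ :=
  Complex.norm_le_norm_of_mapsTo_ball hg (hm.mono_right ball_subset_closedBall) h0
    (mem_ball_zero_iff.1 hz)

theorem lam_conj_le (hp : IsPoincareCover Ω lam p) (hc : ∀ x ∈ Ω, conj x ∈ Ω) {x : ℂ}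
    (hx : x ∈ Ω) : lam (conj x) ≤ lam x := by
  obtain ⟨p, hp, rfl⟩ := hp.exists_normalized hx
  obtain ⟨p₁, hp₁, h1⟩ := hp.exists_normalized (hc _ hx)
  obtain ⟨g, hg, hgm, hg0, hpg⟩ := hp.exists_conj_lift hp₁ hc h1
  have hg1 : ‖deriv g 0‖ ≤ 1 := Complex.norm_deriv_le_one_of_mapsTo_ball hg
    (by rw [hg0]; exact hgm.mono_right ball_subset_closedBall) one_pos
  have hnhds : ball (0 : ℂ) 1 ∈ 𝓝 0 := isOpen_ball.mem_nhds zero_mem_unitBall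
  have h2 : HasDerivAt (fun z => p₁ (g z)) (deriv p₁ 0 * deriv g 0) 0 := by
    have h3 : HasDerivAt p₁ (deriv p₁ 0) (g 0) := by
      rw [hg0]; exact (hp₁.differentiableAt 0 zero_mem_unitBall).hasDerivAt
    exact h3.comp 0 (hg.differentiableAt hnhds).hasDerivAt
  have h4 : HasDerivAt (fun z => p₁ (g z)) (conj (deriv p 0)) 0 := by
    have := (hp.differentiableAt 0 zero_mem_unitBall).hasDerivAt.conj_conj
    rw [map_zero] at this
    exact this.congr_of_eventuallyEq (by filter_upwards [hnhds] with z hz using hpg z hz)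
  have h5 := congrArg norm (h2.unique h4)
  rw [norm_mul, RCLike.norm_conj] at h5
  rw [← h1, hp.lam_eq zero_mem_unitBall, hp₁.lam_eq zero_mem_unitBall]
  have h6 := norm_pos_iff.2 (hp.deriv_ne_zero zero_mem_unitBall)
  have h7 : ‖deriv p 0‖ ≤ ‖deriv p₁ 0‖ := by
    rw [← h5]; exact mul_le_of_le_one_right (norm_nonneg _) hg1
  have h8 : (0 : ℝ) ≤ 2 / (1 - ‖(0 : ℂ)‖ ^ 2) := by simp
  gcongr

theorem lam_conj (hp : IsPoincareCover Ω lam p) (hc : ∀ x ∈ Ω, conj x ∈ Ω) :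
    ∀ x ∈ Ω, lam (conj x) = lam x := fun x hx =>
  le_antisymm (hp.lam_conj_le hc hx) (by simpa using hp.lam_conj_le hc (hc x hx))

theorem densityDist_conj (hp : IsPoincareCover Ω lam p) (hc : ∀ x ∈ Ω, conj x ∈ Ω) {x y : ℂ}
    (hx : x ∈ Ω) (hy : y ∈ Ω) :
    densityDist Ω lam (conj x) (conj y) = densityDist Ω lam x y := by
  refine le_antisymm
    (densityDist_conj_le hp.lam_nonneg hc (hp.lam_conj hc) (hp.exists_isCurveIn hx hy)) ?_
  simpa using densityDist_conj_le hp.lam_nonneg hc (hp.lam_conj hc)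
    (hp.exists_isCurveIn (hc _ hx) (hc _ hy))

end IsPoincareCover

/-- The part of `Ω` in the closed upper half plane. -/
def upperPart (Ω : Set ℂ) : Set ℂ := {z ∈ Ω | 0 ≤ z.im}

/-- The part of `Ω` on the real axis. -/
def realTrace (Ω : Set ℂ) : Set ℂ := {z ∈ Ω | z.im = 0}

/-- Reflection of the lower half plane into the upper half plane. -/
def fold (z : ℂ) : ℂ := ⟨z.re, |z.im|⟩

theorem continuous_fold : Continuous fold := by
  have : fold = fun z : ℂ => (z.re : ℂ) + (|z.im| : ℝ) * I := by
    funext z; exact Complex.mk_eq_add_mul_I _ _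
  rw [this]
  fun_prop

theorem norm_fold_sub_fold_le (z w : ℂ) : ‖fold z - fold w‖ ≤ ‖z - w‖ := by
  rw [← sq_le_sq₀ (norm_nonneg _) (norm_nonneg _), ← Complex.normSq_eq_norm_sq,
    ← Complex.normSq_eq_norm_sq, Complex.normSq_apply, Complex.normSq_apply]
  have h1 : (|z.im| - |w.im|) * (|z.im| - |w.im|) ≤ (z.im - w.im) * (z.im - w.im) :=
    abs_le_iff_mul_self_le.1 (abs_abs_sub_abs_le_abs_sub _ _)
  simp only [fold, Complex.sub_re, Complex.sub_im]
  linarith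

theorem fold_of_nonneg {z : ℂ} (h : 0 ≤ z.im) : fold z = z := by
  apply Complex.ext <;> simp [fold, abs_of_nonneg h]

theorem fold_of_nonpos {z : ℂ} (h : z.im ≤ 0) : fold z = conj z := by
  apply Complex.ext <;> simp [fold, abs_of_nonpos h]

section halfPlane

variable {Ω : Set ℂ}

theorem conj_mem_of_im_ne_zero (hΩ : ∀ z : ℂ, z.im ≠ 0 → z ∈ Ω) : ∀ x ∈ Ω, conj x ∈ Ω := by
  intro x hx
  by_cases h : x.im = 0
  · rwa [Complex.conj_eq_iff_im.2 h]
  · exact hΩ _ (by simpa using h)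

theorem fold_mem_upperPart (hΩ : ∀ z : ℂ, z.im ≠ 0 → z ∈ Ω) {x : ℂ} (hx : x ∈ Ω) :
    fold x ∈ upperPart Ω := by
  refine ⟨?_, abs_nonneg _⟩
  rcases le_total 0 x.im with h | h
  · rwa [fold_of_nonneg h]
  · rw [fold_of_nonpos h]; exact conj_mem_of_im_ne_zero hΩ _ hx

theorem starConvex_upperPart_inter (hΩ : ∀ z : ℂ, z.im ≠ 0 → z ∈ Ω) {K : Set ℂ}
    (hK : Convex ℝ K) {c : ℂ} (hc : 0 < c.im) (hcK : c ∈ K) :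
    StarConvex ℝ c (upperPart Ω ∩ K) := by
  intro y hy s t hs ht hst
  refine ⟨?_, hK hcK hy.2 hs ht hst⟩
  rcases hs.eq_or_lt with rfl | hs
  · obtain rfl : t = 1 := by linarith
    simpa using hy.1
  · have h : 0 < (s • c + t • y).im := by
      have h1 := mul_pos hs hc
      have h2 := mul_nonneg ht hy.1.2
      simp
      linarith
    exact ⟨hΩ _ h.ne', h.le⟩

theorem simplyConnectedSpace_upperPart (hΩ : ∀ z : ℂ, z.im ≠ 0 → z ∈ Ω) :
    SimplyConnectedSpace (upperPart Ω) := by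
  have h := starConvex_upperPart_inter hΩ convex_univ (c := I) (by simp) (mem_univ _)
  rw [inter_univ] at h
  have := h.contractibleSpace ⟨I, hΩ _ (by simp), by simp⟩
  infer_instance

theorem locallyPathConnectedSpace_upperPart (hΩ : ∀ z : ℂ, z.im ≠ 0 → z ∈ Ω) :
    LocallyPathConnectedSpace (upperPart Ω) := by
  refine LocallyPathConnectedSpace.of_bases (fun x => nhds_basis_ball (x := x)) fun x r hr => ?_
  rw [Topology.IsInducing.subtypeVal.isPathConnected_iff, Subtype.image_ball, inter_comm]
  have hr' : (0 : ℝ) < r := hr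
  have h1 : 0 < ((x : ℂ) + (r / 2 : ℝ) * I).im := by
    have := x.2.2
    simp only [Complex.add_im, Complex.mul_im, Complex.ofReal_re, Complex.I_im,
      Complex.ofReal_im, Complex.I_re]
    linarith
  have h2 : (x : ℂ) + (r / 2 : ℝ) * I ∈ ball (x : ℂ) r := by
    rw [mem_ball_iff_norm, add_sub_cancel_left, norm_mul, Complex.norm_I, Complex.norm_real,
      Real.norm_of_nonneg (by linarith)]
    linarith
  exact (starConvex_upperPart_inter hΩ (convex_ball _ _) h1 h2).isPathConnected
    ⟨⟨hΩ _ h1.ne', h1.le⟩, h2⟩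

end halfPlane

/-- A continuous section over the closed upper half plane part of `Ω` of a covering. -/
structure IsUpperSection (Ω : Set ℂ) (p s : ℂ → ℂ) : Prop where
  continuousOn : ContinuousOn s (upperPart Ω)
  mapsTo : MapsTo s (upperPart Ω) (ball 0 1)
  map_eq : ∀ x ∈ upperPart Ω, p (s x) = x

namespace IsPoincareCover

variable {Ω : Set ℂ} {lam : ℂ → ℝ} {p : ℂ → ℂ}

theorem exists_section (hp : IsPoincareCover Ω lam p) (hΩ : ∀ z : ℂ, z.im ≠ 0 → z ∈ Ω) {z : ℂ}
    (hz : z ∈ ball (0 : ℂ) 1) (hpz : p z ∈ upperPart Ω) :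
    ∃ s, IsUpperSection Ω p s ∧ s (p z) = z := by
  have := simplyConnectedSpace_upperPart hΩ
  have := locallyPathConnectedSpace_upperPart hΩ
  obtain ⟨s, h1, h2, h3, h4⟩ := hp.exists_lift (f := id) continuousOn_id
    (fun x (hx : x ∈ upperPart Ω) => hx.1) hpz hz rfl
  exact ⟨s, ⟨h1, h2, h4⟩, h3⟩

/-- On the closed upper half plane the Poincaré distance is the distance of the lifted points. -/
theorem densityDist_eq_of_section (hp : IsPoincareCover Ω lam p)
    (hΩ : ∀ z : ℂ, z.im ≠ 0 → z ∈ Ω) {s : ℂ → ℂ} (hs : IsUpperSection Ω p s) {x y : ℂ}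
    (hx : x ∈ upperPart Ω) (hy : y ∈ upperPart Ω) :
    densityDist Ω lam x y = diskDist (s x) (s y) := by
  have hsx := hs.mapsTo hx
  have hsx' := neg_mem_unitBall hsx
  have hsy := hs.mapsTo hy
  apply le_antisymm
  · have := hp.densityDist_map_le hsx hsy
    rwa [hs.map_eq x hx, hs.map_eq y hy] at this
  · refine le_densityDist (hp.exists_isCurveIn hx.1 hy.1) fun γ hγ => ?_
    have hmem : ∀ t ∈ Icc (0 : ℝ) 1, fold (γ t) ∈ upperPart Ω := fun t ht =>
      fold_mem_upperPart hΩ (hγ.mem t ht)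
    have hpz : ∀ t ∈ Icc (0 : ℝ) 1,
        (p ∘ moebius (s x)) (moebius (-s x) (s (fold (γ t)))) = fold (γ t) := fun t ht => by
      rw [Function.comp_apply, moebius_moebius_neg hsx (hs.mapsTo (hmem t ht)),
        hs.map_eq _ (hmem t ht)]
    have h := (hp.comp_moebius hsx).diskDist_le_curveLen hγ
      (z := fun t => moebius (-s x) (s (fold (γ t)))) ?_ ?_ ?_ ?_ ?_
    · rwa [hγ.target, fold_of_nonneg hy.2, ← moebius_neg_self (s x),
        diskDist_moebius hsx' hsx hsy] at h
    · have h1 : ContinuousOn (moebius (-s x)) (ball 0 1) := fun z hz =>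
        (hasDerivAt_moebius hsx' hz).continuousAt.continuousWithinAt
      exact h1.comp (hs.continuousOn.comp
        (continuous_fold.comp_continuousOn hγ.continuousOn) hmem)
        fun t ht => hs.mapsTo (hmem t ht)
    · exact fun t ht => moebius_mem_ball hsx' (hs.mapsTo (hmem t ht))
    · simp only [hγ.source, fold_of_nonneg hx.2, moebius_neg_self]
    · intro t ht t' ht'
      rw [hpz t ht, hpz t' ht']
      exact norm_fold_sub_fold_le _ _
    · intro t ht
      rw [hpz t ht]
      rcases le_total 0 (γ t).im with h | h
      · rw [fold_of_nonneg h]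
      · rw [fold_of_nonpos h, hp.lam_conj (conj_mem_of_im_ne_zero hΩ) _ (hγ.mem t ht)]

end IsPoincareCover

end

open scoped ComplexConjugate Topology

noncomputable section

theorem realTrace_subset_upperPart (Ω : Set ℂ) : realTrace Ω ⊆ upperPart Ω :=
  fun _ hx => ⟨hx.1, hx.2.ge⟩

theorem conj_eq_of_mem_realTrace {Ω : Set ℂ} {x : ℂ} (hx : x ∈ realTrace Ω) : conj x = x :=
  Complex.conj_eq_iff_im.2 hx.2

theorem exists_diskDist_zero_ofReal_mul_eq {w : ℂ} (hw : w ∈ ball (0 : ℂ) 1) {r : ℝ}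
    (hr : r ∈ Icc 0 (diskDist 0 w)) : ∃ t ∈ Icc (0 : ℝ) 1, diskDist 0 (t * w) = r := by
  have h1 : ContinuousOn (fun t : ℝ => diskDist 0 (t * w)) (Icc 0 1) := by
    have h2 : ContinuousOn (fun t : ℝ => Real.log ((1 + ‖(t * w : ℂ)‖) / (1 - ‖(t * w : ℂ)‖)))
        (Icc 0 1) := by
      have h3 : ∀ t ∈ Icc (0 : ℝ) 1, 0 < 1 - ‖(t * w : ℂ)‖ := fun t ht =>
        sub_pos.2 (mem_ball_zero_iff.1 (IsPoincareCover.ofReal_mul_mem_unitBall hw ht))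
      refine ((Continuous.continuousOn (by fun_prop)).div (Continuous.continuousOn (by fun_prop))
        fun t ht => (h3 t ht).ne').log fun t ht => ?_
      exact (div_pos (by positivity) (h3 t ht)).ne'
    exact h2.congr fun t ht =>
      diskDist_zero_left (IsPoincareCover.ofReal_mul_mem_unitBall hw ht)
  have h0 : diskDist 0 0 = 0 := by rw [diskDist_zero_left zero_mem_unitBall]; simp
  have := intermediate_value_Icc zero_le_one h1
  simp only [Complex.ofReal_zero, zero_mul, h0, Complex.ofReal_one, one_mul] at this
  exact this hr

namespace IsPoincareCover

variable {Ω : Set ℂ} {lam : ℂ → ℝ} {p : ℂ → ℂ}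

theorem densityDist_conj_right_le (hp : IsPoincareCover Ω lam p)
    (hΩ : ∀ z : ℂ, z.im ≠ 0 → z ∈ Ω) {x y q : ℂ} (hx : x ∈ upperPart Ω) (hy : y ∈ upperPart Ω)
    (hq : q ∈ realTrace Ω) :
    densityDist Ω lam x (conj y) ≤ densityDist Ω lam x q + densityDist Ω lam q y := by
  have hqc := conj_eq_of_mem_realTrace hq
  have hqu := realTrace_subset_upperPart Ω hq
  obtain ⟨p, hp, rfl⟩ := hp.exists_normalized hq.1
  obtain ⟨s, hs, hs0⟩ := hp.exists_section hΩ zero_mem_unitBall hqu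
  obtain ⟨g, hg, hgm, hg0, hpg⟩ := hp.exists_conj_lift hp (conj_mem_of_im_ne_zero hΩ) hqc.symm
  have hsx := hs.mapsTo hx
  have hsy := hs.mapsTo hy
  have hw := hgm (conj_mem_unitBall hsy)
  have h1 := hp.densityDist_map_le hsx hw
  rw [hs.map_eq x hx, hpg _ (conj_mem_unitBall hsy), Complex.conj_conj, hs.map_eq y hy] at h1
  rw [hp.densityDist_eq_of_section hΩ hs hx hqu, hp.densityDist_eq_of_section hΩ hs hqu hy, hs0]
  refine h1.trans ((diskDist_triangle hsx zero_mem_unitBall hw).trans ?_)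
  gcongr
  refine diskDist_zero_left_mono hsy ((norm_le_of_holomorphic hg hgm hg0
    (conj_mem_unitBall hsy)).trans_eq ?_)
  rw [RCLike.norm_conj]

theorem exists_densityDist_add_le (hp : IsPoincareCover Ω lam p)
    (hΩ : ∀ z : ℂ, z.im ≠ 0 → z ∈ Ω) {x y : ℂ} (hx : x ∈ upperPart Ω) (hy : y ∈ upperPart Ω)
    {ε : ℝ} (hε : 0 < ε) : ∃ q ∈ realTrace Ω,
      densityDist Ω lam x q + densityDist Ω lam q y ≤ densityDist Ω lam x (conj y) + ε := by
  have hc := conj_mem_of_im_ne_zero hΩ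
  obtain ⟨γ, hγ, hl⟩ := exists_curveLen_lt (hp.exists_isCurveIn hx.1 (hc y hy.1))
    (lt_add_of_pos_right (densityDist Ω lam x (conj y)) hε)
  have h1 : ContinuousOn (fun t => (γ t).im) (Icc 0 1) :=
    Complex.continuous_im.comp_continuousOn hγ.continuousOn
  obtain ⟨τ, hτ, h0⟩ := intermediate_value_Icc' zero_le_one h1
    (show (0 : ℝ) ∈ Icc (γ 1).im (γ 0).im from
      ⟨by rw [hγ.target]; simpa using hy.2, by rw [hγ.source]; exact hx.2⟩)
  have hq : γ τ ∈ realTrace Ω := ⟨hγ.mem τ hτ, h0⟩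
  refine ⟨γ τ, hq, ?_⟩
  have h2 := hγ.densityDist_add_le hp.continuousOn_lam hp.lam_nonneg hτ
  rw [← hp.densityDist_conj hc hq.1 (hc y hy.1), Complex.conj_conj,
    conj_eq_of_mem_realTrace hq] at h2
  exact h2.trans hl.le

/-- Points joined by a real segment in `Ω` are joined by a geodesic of real points. -/
theorem exists_mem_realTrace_between (hp : IsPoincareCover Ω lam p)
    (hΩ : ∀ z : ℂ, z.im ≠ 0 → z ∈ Ω) {q q' : ℂ} (hqq : segment ℝ q q' ⊆ realTrace Ω) {r : ℝ}
    (hr : r ∈ Icc 0 (densityDist Ω lam q q')) :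
    ∃ m ∈ realTrace Ω, densityDist Ω lam q m ≤ r ∧
      densityDist Ω lam m q' ≤ densityDist Ω lam q q' - r := by
  have hq := hqq (left_mem_segment ℝ q q')
  have hq' := hqq (right_mem_segment ℝ q q')
  have hqc := conj_eq_of_mem_realTrace hq
  have hqu := realTrace_subset_upperPart Ω hq
  have hqu' := realTrace_subset_upperPart Ω hq'
  obtain ⟨p, hp, rfl⟩ := hp.exists_normalized hq.1
  obtain ⟨s, hs, hs0⟩ := hp.exists_section hΩ zero_mem_unitBall hqu
  obtain ⟨g, hg, hgm, hg0, hpg⟩ := hp.exists_conj_lift hp (conj_mem_of_im_ne_zero hΩ) hqc.symm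
  set w := s q' with hwdef
  have hw : w ∈ ball (0 : ℂ) 1 := hs.mapsTo hqu'
  have hsu : segment ℝ (p 0) q' ⊆ upperPart Ω := hqq.trans (realTrace_subset_upperPart Ω)
  have hgw : g (conj w) = w := by
    have hm : MapsTo (fun u => conj (s u)) (segment ℝ (p 0) q') (ball 0 1) := fun u hu =>
      conj_mem_unitBall (hs.mapsTo (hsu hu))
    have := hp.eqOn_of_lift (convex_segment (𝕜 := ℝ) (p 0) q').isPreconnected
      (g := fun u => g (conj (s u))) (g' := s)
      (hg.continuousOn.comp (Complex.continuous_conj.comp_continuousOn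
        (hs.continuousOn.mono hsu)) hm) (hs.continuousOn.mono hsu)
      (fun u hu => hgm (hm hu)) (hs.mapsTo.mono_left hsu)
      (fun u hu => by
        rw [hpg _ (hm hu), Complex.conj_conj, hs.map_eq u (hsu hu),
          conj_eq_of_mem_realTrace (hqq hu)])
      (left_mem_segment ℝ (p 0) q') (by simp [hs0, hg0])
    exact this (right_mem_segment ℝ (p 0) q')
  have hgt : ∀ t ∈ Icc (0 : ℝ) 1, g (conj (t * w)) = t * w := fun t ht => by
    rcases eq_or_ne w 0 with h | h
    · simp [h, hg0]
    have hcw : conj w ≠ 0 := by simpa using h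
    have hds : dslope g 0 (conj w) = w / conj w := by
      rw [dslope_of_ne _ hcw, slope_def_field, hg0, hgw, sub_zero, sub_zero]
    have := Complex.affine_of_mapsTo_ball_of_norm_dslope_eq_div (R₂ := 1) hg
      (by rw [hg0]; exact hgm.mono_right ball_subset_closedBall) (conj_mem_unitBall hw)
      (by rw [hds, norm_div, RCLike.norm_conj, div_one, div_self (norm_ne_zero_iff.2 h)])
      (conj_mem_unitBall (ofReal_mul_mem_unitBall hw ht))
    rw [this]
    simp only [hds, hg0, map_mul, Complex.conj_ofReal, smul_eq_mul, zero_add, sub_zero]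
    field_simp
  rw [hp.densityDist_eq_of_section hΩ hs hqu hqu', hs0] at hr ⊢
  obtain ⟨t, ht, rfl⟩ := exists_diskDist_zero_ofReal_mul_eq hw hr
  have htw := ofReal_mul_mem_unitBall hw ht
  refine ⟨p (t * w), ⟨hp.mem htw, ?_⟩, hp.densityDist_zero_le htw, ?_⟩
  · rw [← Complex.conj_eq_iff_im]
    have := hpg _ (conj_mem_unitBall htw)
    rw [hgt t ht, Complex.conj_conj] at this
    exact this.symm
  · have := hp.densityDist_map_le htw hw
    rwa [hs.map_eq q' hqu', diskDist_radial hw ht] at this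

end IsPoincareCover

end

open scoped ComplexConjugate Topology

noncomputable section

theorem cayley_re_pos {z : ℂ} (hz : z ∈ ball (0 : ℂ) 1) : 0 < ((1 + z) / (1 - z)).re := by
  have h1 : 1 - z ≠ 0 := by
    rintro h
    rw [← sub_eq_zero.1 h] at hz
    simp at hz
  have h2 := one_sub_sq_norm_pos hz
  have h3 : ((1 + z) / (1 - z)).re = (1 - ‖z‖ ^ 2) / Complex.normSq (1 - z) := by
    rw [Complex.div_re, ← add_div, ← Complex.normSq_eq_norm_sq, Complex.normSq_apply z]
    congr 1
    simp
    ring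
  rw [h3]
  exact div_pos h2 (Complex.normSq_pos.2 h1)

/-- The image of the disk under the covering map of a round annulus lies in the annulus. -/
theorem norm_annulus_map_mem {a b : ℝ} (ha : 0 < a) (hab : a < b) {z : ℂ}
    (hz : z ∈ ball (0 : ℂ) 1) :
    ‖-(√(a * b) : ℂ) * cexp (I * (Real.log (b / a) / Real.pi : ℝ) * log ((1 + z) / (1 - z)))‖ ∈
      Ioo a b := by
  have hb := ha.trans hab
  set v := (1 + z) / (1 - z) with hv
  have h1 : |v.arg| < Real.pi / 2 :=
    Complex.abs_arg_lt_pi_div_two_iff.2 (Or.inl (cayley_re_pos hz))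
  have h2 : 0 < Real.log (b / a) := Real.log_pos ((one_lt_div ha).2 hab)
  have hr : 0 < √(a * b) := Real.sqrt_pos.2 (mul_pos ha hb)
  have h3 : (I * (Real.log (b / a) / Real.pi : ℝ) * log v).re =
      -(Real.log (b / a) / Real.pi * v.arg) := by
    rw [mul_assoc, Complex.I_mul_re, Complex.im_ofReal_mul, Complex.log_im]
  rw [norm_mul, norm_neg, Complex.norm_real, Real.norm_of_nonneg hr.le, Complex.norm_exp, h3]
  have h4 : |Real.log (b / a) / Real.pi * v.arg| < Real.log (b / a) / 2 := by
    rw [abs_mul, abs_of_pos (div_pos h2 Real.pi_pos), div_mul_eq_mul_div,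
      div_lt_div_iff₀ Real.pi_pos two_pos]
    nlinarith
  have h5 : √(a * b) = Real.exp ((Real.log a + Real.log b) / 2) := by
    rw [Real.sqrt_eq_rpow, ← Real.log_mul ha.ne' hb.ne', Real.rpow_def_of_pos (mul_pos ha hb)]
    congr 1
    ring
  rw [Real.log_div hb.ne' ha.ne'] at h4
  rw [h5, ← Real.exp_add, Real.log_div hb.ne' ha.ne']
  have h6 := abs_lt.1 h4
  constructor
  · nth_rewrite 1 [← Real.exp_log ha]
    exact Real.exp_lt_exp.2 (by linarith)
  · nth_rewrite 3 [← Real.exp_log hb]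
    exact Real.exp_lt_exp.2 (by linarith)

theorem exists_diskDist_zero_eq (L : ℝ) (hL : 0 ≤ L) : ∃ t : ℝ, (t : ℂ) ∈ ball (0 : ℂ) 1 ∧
    diskDist 0 t = L ∧ log ((1 + t) / (1 - t)) = L := by
  have h1 : 1 ≤ Real.exp L := Real.one_le_exp hL
  set t := (Real.exp L - 1) / (Real.exp L + 1) with ht
  have ht0 : 0 ≤ t := div_nonneg (by linarith) (by linarith)
  have ht1 : t < 1 := (div_lt_one (by linarith)).2 (by linarith)
  have hn : ‖(t : ℂ)‖ = t := by rw [Complex.norm_real, Real.norm_of_nonneg ht0]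
  have hm : (t : ℂ) ∈ ball (0 : ℂ) 1 := by rwa [mem_ball_zero_iff, hn]
  have h2 : (1 + t) / (1 - t) = Real.exp L := by
    rw [div_eq_iff (by linarith), ht]
    field_simp
    ring
  refine ⟨t, hm, ?_, ?_⟩
  · rw [diskDist_zero_left hm, hn, h2, Real.log_exp]
  · have h3 : (1 + t : ℂ) / (1 - t) = (Real.exp L : ℝ) := by rw [← h2]; push_cast; rfl
    rw [h3, ← Complex.ofReal_log (Real.exp_pos L).le, Real.log_exp]

namespace IsPoincareCover

variable {Ω : Set ℂ} {lam : ℂ → ℝ} {p : ℂ → ℂ}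

/-- The distance between opposite points of the core curve of a round annulus in `Ω`. -/
theorem densityDist_neg_sqrt_le (hp : IsPoincareCover Ω lam p) {a b : ℝ} (ha : 0 < a)
    (hab : a < b) (hA : ∀ z : ℂ, ‖z‖ ∈ Ioo a b → z ∈ Ω) :
    densityDist Ω lam (-(√(a * b) : ℝ)) (√(a * b) : ℝ) ≤ Real.pi ^ 2 / Real.log (b / a) := by
  have h2 : 0 < Real.log (b / a) := Real.log_pos ((one_lt_div ha).2 hab)
  set f : ℂ → ℂ := fun z =>
    -(√(a * b) : ℂ) * cexp (I * (Real.log (b / a) / Real.pi : ℝ) * log ((1 + z) / (1 - z)))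
    with hf
  have hfm : MapsTo f (ball 0 1) Ω := fun z hz => hA _ (norm_annulus_map_mem ha hab hz)
  have hf0 : f 0 = -(√(a * b) : ℝ) := by simp [hf]
  have hfd : DifferentiableOn ℂ f (ball 0 1) := fun z hz => by
    have h1 : 1 - z ≠ 0 := by
      intro h
      have := cayley_re_pos hz
      simp [h] at this
    have h3 : (1 + z) / (1 - z) ∈ slitPlane := Or.inl (cayley_re_pos hz)
    have h4 : DifferentiableAt ℂ (fun z : ℂ => (1 + z) / (1 - z)) z := by fun_prop (disch := exact h1)
    exact ((((h4.clog h3).const_mul _).cexp).const_mul _).differentiableWithinAt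
  have hL : 0 ≤ Real.pi ^ 2 / Real.log (b / a) := by positivity
  obtain ⟨t, ht, htd, htl⟩ := exists_diskDist_zero_eq _ hL
  have hft : f t = (√(a * b) : ℝ) := by
    have h5 : I * (Real.log (b / a) / Real.pi : ℝ) * (Real.pi ^ 2 / Real.log (b / a) : ℝ) =
        Real.pi * I := by
      rw [mul_assoc, ← Complex.ofReal_mul, mul_comm]
      congr 2
      have := Real.pi_ne_zero
      field_simp
    simp only [hf, htl, h5, Complex.exp_pi_mul_I]
    ring
  obtain ⟨p', hp', h0⟩ := hp.exists_normalized (hfm zero_mem_unitBall)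
  obtain ⟨g, hg, hgm, hg0, hpg⟩ := hp'.exists_holomorphic_lift hfd hfm h0.symm
  have h6 := hp'.densityDist_zero_le (hgm ht)
  rw [hpg t ht, h0, hf0, hft] at h6
  rw [← htd]
  exact h6.trans (diskDist_zero_left_mono ht (norm_le_of_holomorphic hg hgm hg0 ht))

end IsPoincareCover

end

open scoped ComplexConjugate Topology

noncomputable section

section double

variable {X : Type*} {δ D : X → X → ℝ} {G : Set X}

theorem doubleDist_comm (hsymm : ∀ x y, δ x y = δ y x)
    (hD : ∀ x y, ∀ q ∈ G, D x y ≤ δ x q + δ q y)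
    (hD' : ∀ x y, ∀ ε > 0, ∃ q ∈ G, δ x q + δ q y ≤ D x y + ε) (x y : Bool × X) :
    doubleDist δ D x y = doubleDist δ D y x := by
  have h : ∀ x y, D x y ≤ D y x := fun x y => le_of_forall_pos_le_add fun ε hε => by
    obtain ⟨q, hq, h1⟩ := hD' y x ε hε
    linarith [hD x y q hq, hsymm x q, hsymm q y]
  simp only [doubleDist, eq_comm (a := x.1), hsymm x.2 y.2, (h x.2 y.2).antisymm (h y.2 x.2)]

theorem doubleDist_triangle (htri : ∀ x y z, δ x z ≤ δ x y + δ y z)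
    (hD : ∀ x y, ∀ q ∈ G, D x y ≤ δ x q + δ q y)
    (hD' : ∀ x y, ∀ ε > 0, ∃ q ∈ G, δ x q + δ q y ≤ D x y + ε) (x y z : Bool × X) :
    doubleDist δ D x z ≤ doubleDist δ D x y + doubleDist δ D y z := by
  obtain ⟨i, x⟩ := x
  obtain ⟨j, y⟩ := y
  obtain ⟨l, z⟩ := z
  have h1 : D x z ≤ δ x y + D y z := le_of_forall_pos_le_add fun ε hε => by
    obtain ⟨q, hq, h1⟩ := hD' y z ε hε
    linarith [hD x z q hq, htri x y q]
  have h2 : D x z ≤ D x y + δ y z := le_of_forall_pos_le_add fun ε hε => by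
    obtain ⟨q, hq, h1⟩ := hD' x y ε hε
    linarith [hD x z q hq, htri q y z]
  have h3 : δ x z ≤ D x y + D y z := le_of_forall_pos_le_add fun ε hε => by
    obtain ⟨q, hq, h1⟩ := hD' x y (ε / 2) (half_pos hε)
    obtain ⟨q', hq', h2⟩ := hD' y z (ε / 2) (half_pos hε)
    linarith [htri x q z, htri q y z, htri y q' z]
  have h4 := htri x y z
  cases i <;> cases j <;> cases l <;> simpa [doubleDist]

end double

section chain

variable {X : Type*} {δ : X → X → ℝ} {n : X → X} {G : Set X} {k : ℝ}

/-- Every geodesic from `q` to `q'` stays far from a point `x` on the scale of `δ x (n x)`, in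
terms of Gromov products. -/
def IsAvoiding (δ : X → X → ℝ) (n : X → X) (c : ℝ) (q q' : X) : Prop :=
  ∀ x, 2 * δ x (n x) ≤ δ x q + δ x q' - δ q q' + c

theorem IsAvoiding.mono {c c' : ℝ} {q q' : X} (h : IsAvoiding δ n c q q') (hc : c ≤ c') :
    IsAvoiding δ n c' q q' := fun x => (h x).trans (by gcongr)

theorem IsAvoiding.symm {c : ℝ} {q q' : X} (h : IsAvoiding δ n c q q')
    (hsymm : ∀ x y, δ x y = δ y x) : IsAvoiding δ n c q' q := fun x => by
  linarith [h x, hsymm q q']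

theorem IsAvoiding.trans {c c' : ℝ} {q q' q'' : X} (h : IsAvoiding δ n c q q')
    (h' : IsAvoiding δ n c' q' q'') (hsymm : ∀ x y, δ x y = δ y x) (h4 : FourPointOn univ δ k) :
    IsAvoiding δ n (max c c' + k) q q'' := fun x => by
  rcases h4 x trivial q' trivial q trivial q'' trivial with h1 | h1
  · linarith [h' x, le_max_right c c']
  · linarith [h x, le_max_left c c', hsymm q' q]

theorem isAvoiding_of_le {c : ℝ} (hn : ∀ x, ∀ m ∈ G, δ x (n x) ≤ δ x m + 1) {q q' : X}
    (hq : q ∈ G) (hq' : q' ∈ G) (h : δ q q' ≤ c) : IsAvoiding δ n (c + 2) q q' := fun x => by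
  linarith [hn x q hq, hn x q' hq']

theorem isAvoiding_of_exists_between (hsymm : ∀ x y, δ x y = δ y x)
    (htri : ∀ x y z, δ x z ≤ δ x y + δ y z) (h4 : FourPointOn univ δ k)
    (hn : ∀ x, ∀ m ∈ G, δ x (n x) ≤ δ x m + 1) {q q' : X}
    (h : ∀ r ∈ Icc 0 (δ q q'), ∃ m ∈ G, δ q m ≤ r ∧ δ m q' ≤ δ q q' - r) :
    IsAvoiding δ n (2 * k + 2) q q' := fun x => by
  obtain ⟨m, hm, h1, h2⟩ := h ((δ x q + δ q q' - δ x q') / 2)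
    ⟨by linarith [htri x q q'], by linarith [htri x q' q, hsymm q q']⟩
  have h3 := hn x m hm
  have h5 := hsymm q m
  rcases h4 x trivial m trivial q trivial q' trivial with h | h <;> linarith

end chain

end

open scoped ComplexConjugate Topology

noncomputable section

namespace IsPoincareCover

variable {Ω : Set ℂ} {lam : ℂ → ℝ} {p : ℂ → ℂ}

/-- A symmetric domain whose real points all avoid each other uniformly, as seen from the upper
half plane, is Gromov hyperbolic. -/
theorem isGromovHyperbolic_of_isAvoiding (hp : IsPoincareCover Ω lam p)
    (hΩ : ∀ z : ℂ, z.im ≠ 0 → z ∈ Ω) {δ : upperPart Ω → upperPart Ω → ℝ}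
    (hδ : ∀ x y, δ x y = densityDist Ω lam x y)
    {n : upperPart Ω → upperPart Ω} {k c : ℝ} (hk : 0 ≤ k) (hc : 0 ≤ c)
    (hsymm : ∀ x y, δ x y = δ y x) (htri : ∀ x y z, δ x z ≤ δ x y + δ y z)
    (h4 : FourPointOn univ δ k) (hnG : ∀ x, (n x : ℂ) ∈ realTrace Ω)
    (hn : ∀ x, ∀ m : upperPart Ω, (m : ℂ) ∈ realTrace Ω → δ x (n x) ≤ δ x m + 1)
    (hqc : ∀ q q' : upperPart Ω, (q : ℂ) ∈ realTrace Ω → (q' : ℂ) ∈ realTrace Ω → IsAvoiding δ n c q q') :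
    IsGromovHyperbolic Ω (densityDist Ω lam) := by
  have hconj := conj_mem_of_im_ne_zero hΩ
  set D : upperPart Ω → upperPart Ω → ℝ := fun x y => densityDist Ω lam x (conj (y : ℂ)) with hDdef
  set G : Set (upperPart Ω) := {q | (q : ℂ) ∈ realTrace Ω} with hG
  have hD : ∀ x y, ∀ q ∈ G, D x y ≤ δ x q + δ q y := fun x y q hq => by
    rw [hδ, hδ]
    exact hp.densityDist_conj_right_le hΩ x.2 y.2 hq
  have hD' : ∀ x y, ∀ ε > 0, ∃ q ∈ G, δ x q + δ q y ≤ D x y + ε := fun x y ε hε => by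
    obtain ⟨q, hq, h⟩ := hp.exists_densityDist_add_le hΩ x.2 y.2 hε
    refine ⟨⟨q, realTrace_subset_upperPart Ω hq⟩, hq, ?_⟩
    rwa [hδ, hδ]
  have hdouble := fourPointOn_doubleDist hk hc hsymm htri h4 (G := G) hnG
    (fun x m hm => hn x m hm) (fun q hq q' hq' => hqc q q' hq hq') hD
    (fun x y => hD' x y 1 one_pos)
  have key : ∀ x : Ω, ∃ x' : Bool × upperPart Ω, (x : ℂ) = cond x'.1 (x'.2 : ℂ) (conj (x'.2 : ℂ)) :=
    fun x => by
      rcases le_total 0 (x : ℂ).im with h | h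
      · exact ⟨(true, ⟨x, x.2, h⟩), rfl⟩
      · exact ⟨(false, ⟨conj (x : ℂ), hconj _ x.2, by simpa using h⟩), by simp⟩
  choose φ hφ using key
  have hd : ∀ x y : Ω, densityDist Ω lam x y = doubleDist δ D (φ x) (φ y) := fun x y => by
    rw [hφ x, hφ y]
    obtain ⟨i, u⟩ := φ x
    obtain ⟨j, v⟩ := φ y
    cases i <;> cases j
    · simpa [doubleDist, hδ] using hp.densityDist_conj hconj u.2.1 v.2.1
    · simpa [doubleDist, hDdef] using (hp.densityDist_conj hconj (hconj u u.2.1) v.2.1).symm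
    · simp [doubleDist, hDdef]
    · simp [doubleDist, hδ]
  refine FourPointOn.isGromovHyperbolic (k := 10 * (k + c + 3)) ?_ (by positivity) ?_ ?_
  · intro x hx y hy z hz w hw
    lift x to Ω using hx
    lift y to Ω using hy
    lift z to Ω using hz
    lift w to Ω using hw
    simp only [hd]
    exact hdouble _ trivial _ trivial _ trivial _ trivial
  · intro x hx y hy
    lift x to Ω using hx
    lift y to Ω using hy
    simp only [hd]
    exact doubleDist_comm hsymm hD hD' _ _
  · intro x hx y hy z hz
    lift x to Ω using hx
    lift y to Ω using hy
    lift z to Ω using hz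
    simp only [hd]
    exact doubleDist_triangle htri hD hD' _ _ _

/-- A domain containing all nonreal points, whose real trace is the union of the negative axis and
of intervals `(a i, b i)` with `b i / a i` bounded away from `1`, is Gromov hyperbolic. -/
theorem isGromovHyperbolic_of_gaps (hp : IsPoincareCover Ω lam p)
    (hΩ : ∀ z : ℂ, z.im ≠ 0 → z ∈ Ω) {ι : Type*} {a b : ι → ℝ} (ha : ∀ i, 0 < a i)
    (hab : ∀ i, a i < b i)
    (hre : (fun x : ℝ => (x : ℂ)) ⁻¹' Ω = Iio 0 ∪ ⋃ i, Ioo (a i) (b i)) {C : ℝ} (hC : 0 ≤ C)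
    (hCb : ∀ i, Real.pi ^ 2 / Real.log (b i / a i) ≤ C) :
    IsGromovHyperbolic Ω (densityDist Ω lam) := by
  have hneg : ∀ x < (0 : ℝ), (x : ℂ) ∈ Ω := fun x hx => by
    change x ∈ (fun x : ℝ => (x : ℂ)) ⁻¹' Ω
    rw [hre]; exact Or.inl hx
  have hpos : ∀ i, ∀ x ∈ Ioo (a i) (b i), (x : ℂ) ∈ Ω := fun i x hx => by
    change x ∈ (fun x : ℝ => (x : ℂ)) ⁻¹' Ω
    rw [hre]; exact Or.inr (mem_iUnion.2 ⟨i, hx⟩)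
  have hseg : ∀ {s : Set ℝ}, Convex ℝ s → (∀ x ∈ s, (x : ℂ) ∈ Ω) → ∀ {u v : ℝ}, u ∈ s → v ∈ s →
      segment ℝ (u : ℂ) v ⊆ realTrace Ω := by
    rintro s hs hsΩ u v hu hv z ⟨α, β, hα, hβ, hαβ, rfl⟩
    have h := hsΩ _ (hs hu hv hα hβ hαβ)
    exact ⟨by simpa using h, by simp⟩
  have hupper : ∀ {x : ℝ}, (x : ℂ) ∈ Ω → (x : ℂ) ∈ upperPart Ω := fun h => ⟨h, by simp⟩
  obtain ⟨p, hp, hp0⟩ := hp.exists_normalized (hΩ I (by simp))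
  obtain ⟨s, hs, -⟩ := hp.exists_section hΩ zero_mem_unitBall
    (by rw [hp0]; exact ⟨hΩ I (by simp), by simp⟩)
  set δ : upperPart Ω → upperPart Ω → ℝ := fun x y => densityDist Ω lam x y with hδdef
  have hδ : ∀ x y : upperPart Ω, δ x y = diskDist (s x) (s y) := fun x y =>
    hp.densityDist_eq_of_section hΩ hs x.2 y.2
  have hsm : ∀ x : upperPart Ω, s x ∈ ball (0 : ℂ) 1 := fun x => hs.mapsTo x.2
  have h0 : ∀ x y, 0 ≤ δ x y := fun x y => by rw [hδ]; exact diskDist_nonneg _ _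
  have hsymm : ∀ x y, δ x y = δ y x := fun x y => by rw [hδ, hδ, diskDist_comm]
  have htri : ∀ x y z, δ x z ≤ δ x y + δ y z := fun x y z => by
    rw [hδ, hδ, hδ]
    exact diskDist_triangle (hsm x) (hsm y) (hsm z)
  set k := 2 * Real.log 8
  have hk : 0 ≤ k := mul_nonneg zero_le_two (Real.log_nonneg (by norm_num))
  have h4 : FourPointOn univ δ k := fun x _ y _ z _ w _ => by
    simp only [hδ]
    exact fourPointOn_diskDist _ (hsm x) _ (hsm y) _ (hsm z) _ (hsm w)
  set G : Set (upperPart Ω) := {q | (q : ℂ) ∈ realTrace Ω}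
  set e : upperPart Ω := ⟨(-1 : ℝ), hupper (hneg (-1) (by simp))⟩ with he
  have heG : e ∈ G := ⟨e.2.1, by simp [he]⟩
  have hnear : ∀ x, ∃ q ∈ G, ∀ m ∈ G, δ x q ≤ δ x m + 1 := fun x => by
    obtain ⟨_, ⟨q, hq, rfl⟩, h⟩ := Real.lt_sInf_add_pos (s := δ x '' G) ⟨_, e, heG, rfl⟩ one_pos
    have hbdd : BddBelow (δ x '' G) := ⟨0, by rintro _ ⟨m, -, rfl⟩; exact h0 x m⟩
    exact ⟨q, hq, fun m hm => h.le.trans (by gcongr; exact csInf_le hbdd ⟨m, hm, rfl⟩)⟩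
  choose n hnG hn using hnear
  set c := max (2 * k + 2) (C + 2) with hc
  have hsegment : ∀ q q' : upperPart Ω, segment ℝ (q : ℂ) q' ⊆ realTrace Ω →
      IsAvoiding δ n c q q' := fun q q' hqq => by
    refine (isAvoiding_of_exists_between (G := G) hsymm htri h4 hn fun r hr => ?_).mono
      (le_max_left _ _)
    obtain ⟨m, hm, h1, h2⟩ := hp.exists_mem_realTrace_between hΩ hqq hr
    exact ⟨⟨m, realTrace_subset_upperPart Ω hm⟩, hm, h1, h2⟩
  have hbase : ∀ q ∈ G, IsAvoiding δ n (c + 2 * k) q e := by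
    rintro ⟨q, hqu⟩ ⟨hqΩ, hq0⟩
    obtain ⟨x, rfl⟩ : ∃ x : ℝ, q = x := ⟨q.re, (Complex.ext rfl (by simpa using hq0))⟩
    have hx : x ∈ (fun x : ℝ => (x : ℂ)) ⁻¹' Ω := hqΩ
    rw [hre] at hx
    rcases hx with hx | hx
    · exact (hsegment _ _ (hseg (convex_Iio 0) hneg hx (by simp))).mono (by linarith)
    · obtain ⟨i, hx⟩ := mem_iUnion.1 hx
      have hai := ha i
      have hbi := hai.trans (hab i)
      have hr : √(a i * b i) ∈ Ioo (a i) (b i) := by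
        constructor
        · exact Real.lt_sqrt_of_sq_lt (by nlinarith [hab i])
        · rw [Real.sqrt_lt' hbi]
          nlinarith [hab i]
      have hrn : -√(a i * b i) < 0 := neg_lt_zero.2 (hai.trans hr.1)
      set r : upperPart Ω := ⟨(√(a i * b i) : ℝ), hupper (hpos i _ hr)⟩ with hrdef
      set r' : upperPart Ω := ⟨(-√(a i * b i) : ℝ), hupper (hneg _ hrn)⟩ with hrdef'
      have hrG : r ∈ G := ⟨r.2.1, by simp [hrdef]⟩
      have hrG' : r' ∈ G := ⟨r'.2.1, by simp [hrdef']⟩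
      have hA : ∀ z : ℂ, ‖z‖ ∈ Ioo (a i) (b i) → z ∈ Ω := fun z hz => by
        by_cases hz0 : z.im = 0
        · obtain ⟨y, rfl⟩ : ∃ y : ℝ, z = y := ⟨z.re, (Complex.ext rfl (by simpa using hz0))⟩
          rw [Complex.norm_real, Real.norm_eq_abs] at hz
          rcases lt_or_ge y 0 with hy | hy
          · exact hneg y hy
          · rw [abs_of_nonneg hy] at hz
            exact hpos i y hz
        · exact hΩ z hz0
      have h1 : IsAvoiding δ n c ⟨x, hqu⟩ r := hsegment _ _ (hseg (convex_Ioo _ _) (hpos i) hx hr)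
      have h2 : IsAvoiding δ n c r' r := by
        refine (isAvoiding_of_le hn hrG' hrG ?_).mono (le_max_right _ _)
        have := hp.densityDist_neg_sqrt_le hai (hab i) hA
        refine le_trans (le_of_eq ?_) (this.trans (hCb i))
        simp [hδdef, hrdef, hrdef']
      have h3 : IsAvoiding δ n c r' e := hsegment _ _ (hseg (convex_Iio 0) hneg hrn (by simp))
      refine ((h1.trans (h2.symm hsymm) hsymm h4).trans h3 hsymm h4).mono ?_
      rw [max_self, max_eq_left (by linarith)]
      linarith
  refine hp.isGromovHyperbolic_of_isAvoiding hΩ (δ := δ) (n := n) (k := k) (c := c + 3 * k)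
    (fun _ _ => rfl) hk ?_ hsymm htri h4 hnG (fun x m hm => hn x m hm) fun q q' hq hq' => ?_
  · have := le_max_right (2 * k + 2) (C + 2)
    linarith
  · refine ((hbase q hq).trans ((hbase q' hq').symm hsymm) hsymm h4).mono ?_
    rw [max_self]
    linarith

end IsPoincareCover

theorem IsDenjoyDomain.mem_of_im_ne_zero {Ω : Set ℂ} (hΩ : IsDenjoyDomain Ω) {x : ℝ}
    (hx : (x : ℂ) ∈ Ω) {z : ℂ} (hz : z.im ≠ 0) : z ∈ Ω := by
  obtain ⟨ho, -, hf⟩ := hΩ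
  have key : ∀ U : Set ℂ, Convex ℝ U → (U ∩ Ω).Nonempty → Disjoint U realLine → U ⊆ Ω := by
    intro U hU hne hd
    refine hU.isPreconnected.subset_of_closure_inter_subset ho hne fun w hw => ?_
    by_contra h
    refine disjoint_left.1 hd hw.2 (hf ⟨hw.1, ?_⟩)
    rwa [ho.interior_eq]
  obtain ⟨ε, hε, hεΩ⟩ := Metric.isOpen_iff.1 ho _ hx
  have hmem : ∀ y : ℝ, |y| < ε → (x + y * I : ℂ) ∈ Ω := fun y hy => hεΩ (by
    simpa [mem_ball_iff_norm] using hy)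
  have hε2 : |ε / 2| < ε := by rw [abs_of_pos (half_pos hε)]; exact half_lt_self hε
  rcases hz.lt_or_gt with hz | hz
  · refine key _ (convex_halfSpace_im_lt 0) ⟨_, ?_, hmem (-(ε / 2)) (by rwa [abs_neg])⟩ ?_ hz
    · simpa using hε
    · exact disjoint_left.2 fun w hw hw' => hw.ne hw'
  · refine key _ (convex_halfSpace_im_gt 0) ⟨_, ?_, hmem (ε / 2) hε2⟩ ?_ hz
    · simpa using hε
    · exact disjoint_left.2 fun w hw hw' => hw.ne' hw'

/-- Theorem 1.1(1), Poincaré case: if `liminf (bₙ - aₙ)/aₙ > 0` then `(Ω, h_Ω)` is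
Gromov hyperbolic. -/
theorem denjoy_poincare_hyperbolic_of_liminf_pos
    (Ω : Set ℂ) (a b : ℕ → ℝ)
    (hΩ : IsDenjoyDomain Ω)
    (hapos : ∀ n, 0 < a n)
    (hab : ∀ n, a n < b n)
    (hba : ∀ n, b n ≤ a (n + 1))
    (hlim : Filter.Tendsto a Filter.atTop Filter.atTop)
    (hre : (fun x : ℝ => (x : ℂ)) ⁻¹' Ω = Iio 0 ∪ ⋃ n, Ioo (a n) (b n))
    (hliminf : ∃ c > 0, ∀ᶠ n in Filter.atTop, c ≤ (b n - a n) / a n)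
    (lam : ℂ → ℝ) (hlam : IsPoincareDensity Ω lam) :
    IsGromovHyperbolic Ω (densityDist Ω lam) := by
  obtain ⟨p, h1, h2, h3, h4⟩ := hlam
  have hp : IsPoincareCover Ω lam p := ⟨h1, h2, h3, h4⟩
  have hneg : ((-1 : ℝ) : ℂ) ∈ Ω := by
    change (-1 : ℝ) ∈ (fun x : ℝ => (x : ℂ)) ⁻¹' Ω
    rw [hre]
    exact Or.inl (by simp)
  obtain ⟨c, hc, hcl⟩ := hliminf
  have hbd : Filter.IsBoundedUnder (· ≤ ·) atTop
      (fun n => Real.pi ^ 2 / Real.log (b n / a n)) := by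
    refine ⟨Real.pi ^ 2 / Real.log (1 + c), ?_⟩
    rw [eventually_map]
    filter_upwards [hcl] with n hn
    have hcn : 1 + c ≤ b n / a n := by
      rw [sub_div, div_self (hapos n).ne'] at hn
      linarith
    have : 0 < Real.log (1 + c) := Real.log_pos (by linarith)
    gcongr
  obtain ⟨C, hC⟩ := hbd.bddAbove_range
  exact hp.isGromovHyperbolic_of_gaps (fun z hz => hΩ.mem_of_im_ne_zero hneg hz) hapos hab hre
    (le_max_left 0 C) fun n => (hC ⟨n, rfl⟩).trans (le_max_right _ _)

end
end
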